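/- Fix c ∈ [n] and let G be chosen uniformly at random from Φ(K_n^↔). Let ℰ^c be the event that for every v ∈ [n], G contains a well-spread collection of at least n²/2¹⁰⁰ (v,c)-absorbing gadgets, and let 𝒞^c be the event that at most n/10⁹ loops of G have colour c. Then there exist constants a > 0 and n₀, independent of c, such that for all n ≥ n₀, P[ℰ^c | 𝒞^c] ≥ 1 − exp(−a·n²). -/

import Mathlib

open scoped Classical

noncomputable section

namespace RandomLatin

/-- `φ` is a proper `n`-arc-colouring of the complete digraph with loops on `Fin n`:
`φ i j` is the colour of the arc `i → j`, and no two arcs of the same colour share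
a common tail or a common head. -/
def IsProper {n : ℕ} (φ : Fin n → Fin n → Fin n) : Prop :=
  (∀ i j j' : Fin n, φ i j = φ i j' → j = j') ∧
  (∀ i i' j : Fin n, φ i j = φ i' j → i = i')

/-- The set `Φ(K_n^↔)` of proper `n`-arc-colourings of the complete digraph with loops. -/
abbrev Colouring (n : ℕ) : Type := {φ : Fin n → Fin n → Fin n // IsProper φ}

/-- `L` is an `n × n` Latin square with symbols `Fin n`. -/
def IsLatin {n : ℕ} (L : Fin n → Fin n → Fin n) : Prop :=
  (∀ i, Function.Bijective (L i)) ∧ (∀ j, Function.Bijective fun i => L i j)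

abbrev LatinSquare (n : ℕ) : Type := {L : Fin n → Fin n → Fin n // IsLatin L}

/-- The set of positions `{(i, σ i) : i}` is a (full) transversal of `L`. -/
def IsTransversal {n : ℕ} (L : Fin n → Fin n → Fin n) (σ : Equiv.Perm (Fin n)) : Prop :=
  Function.Bijective fun i => L i (σ i)

/-- A transversal is Hamilton if its arc set `{i → σ i}` is a directed Hamilton cycle. -/
def IsHamiltonTransversal {n : ℕ} (L : Fin n → Fin n → Fin n) (σ : Equiv.Perm (Fin n)) :
    Prop :=
  IsTransversal L σ ∧ σ.IsCycle ∧ σ.support = Finset.univ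

def hamTransversalCount {n : ℕ} (L : Fin n → Fin n → Fin n) : ℕ :=
  Nat.card {σ : Equiv.Perm (Fin n) // IsHamiltonTransversal L σ}

/-- The number of rainbow directed Hamilton cycles of a coloured `K_n^↔`. -/
def rainbowHamCycleCount {n : ℕ} (φ : Fin n → Fin n → Fin n) : ℕ :=
  Nat.card {σ : Equiv.Perm (Fin n) //
    Function.Injective (fun i => φ i (σ i)) ∧ σ.IsCycle ∧ σ.support = Finset.univ}

/-- The maximum number of appearances of a symbol on the leading diagonal. -/
def diagMax {n : ℕ} (L : Fin n → Fin n → Fin n) : ℕ :=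
  Finset.univ.sup fun s : Fin n => (Finset.univ.filter fun i : Fin n => L i i = s).card

/-! ### The spaces `𝒢_D` -/

/-- `𝒢_D`: proper arc-colourings, with colour set `D`, of spanning subdigraphs of `K_n^↔`
in which every vertex has in- and out-degree `|D|`.  `f d i` is the head of the unique
`d`-coloured arc with tail `i`. -/
def GD (n : ℕ) (D : Finset (Fin n)) : Type :=
  {f : {d : Fin n // d ∈ D} → Fin n → Fin n //
    (∀ d, Function.Bijective (f d)) ∧ ∀ i : Fin n, Function.Injective fun d => f d i}

/-- `comp H`: the number of completions of `H ∈ 𝒢_D` to an element of `Φ(K_n^↔)`,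
i.e. the number of `g ∈ 𝒢_{Dᶜ}` whose arc set is disjoint from that of `H`. -/
def completionCount {n : ℕ} {D : Finset (Fin n)} (H : GD n D) : ℕ :=
  Nat.card {g : GD n Dᶜ //
    ∀ (d : {d : Fin n // d ∈ D}) (d' : {d : Fin n // d ∈ Dᶜ}) (i : Fin n),
      H.1 d i ≠ g.1 d' i}

/-- `e_H(A₁, A₂)`: the number of arcs of `H` with tail in `A₁` and head in `A₂`. -/
def eArcs {n : ℕ} {D : Finset (Fin n)} (H : GD n D) (A₁ A₂ : Finset (Fin n)) : ℕ :=
  Nat.card {p : {d : Fin n // d ∈ D} × Fin n // p.2 ∈ A₁ ∧ H.1 p.1 p.2 ∈ A₂}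

/-! ### Absorbing gadgets -/

/-- A `(v,c)`-absorbing gadget, recorded by its vertices `x 0 = x₁, …, x 5 = x₆`. -/
def IsAbsGadget {n : ℕ} (φ : Fin n → Fin n → Fin n) (v c : Fin n) (x : Fin 6 → Fin n) :
    Prop :=
  ([v, x 0, x 1, x 2, x 3, x 4, x 5] : List (Fin n)).Nodup ∧
  φ (x 0) v = φ (x 3) (x 5) ∧
  φ v (x 1) = φ (x 2) (x 4) ∧
  φ (x 0) (x 1) = φ (x 2) (x 3) ∧
  φ (x 4) (x 5) = c ∧
  ([φ (x 0) v, φ v (x 1), φ (x 0) (x 1), c] : List (Fin n)).Nodup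

def absGadgetVerts {n : ℕ} (v : Fin n) (x : Fin 6 → Fin n) : Finset (Fin n) :=
  insert v (Finset.image x Finset.univ)

/-- The gadget contains an arc of colour `d`. -/
def absGadgetHasColour {n : ℕ} (φ : Fin n → Fin n → Fin n) (v : Fin n)
    (x : Fin 6 → Fin n) (d : Fin n) : Prop :=
  d = φ (x 0) v ∨ d = φ v (x 1) ∨ d = φ (x 0) (x 1) ∨ d = φ (x 2) (x 3) ∨
  d = φ (x 2) (x 4) ∨ d = φ (x 3) (x 5) ∨ d = φ (x 4) (x 5)

def WellSpreadAbsGadgets {n : ℕ} (φ : Fin n → Fin n → Fin n) (v c : Fin n)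
    (𝒜 : Finset (Fin 6 → Fin n)) : Prop :=
  (∀ u : Fin n, u ≠ v → (𝒜.filter fun x => u ∈ absGadgetVerts v x).card ≤ n) ∧
  (∀ d : Fin n, d ≠ c → (𝒜.filter fun x => absGadgetHasColour φ v x d).card ≤ n)

/-! ### Bridging gadgets (with respect to a full colouring) -/

/-- A `(y,z)`-bridging gadget, recorded by its vertices `w 0 = w₁, …, w 5 = w₆`. -/
def IsBridgeGadget {n : ℕ} (φ : Fin n → Fin n → Fin n) (y z : Fin n)
    (w : Fin 6 → Fin n) : Prop :=
  ([y, z, w 0, w 1, w 2, w 3, w 4, w 5] : List (Fin n)).Nodup ∧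
  φ y (w 0) = φ (w 5) (w 4) ∧
  φ (w 1) (w 0) = φ (w 5) z ∧
  φ (w 3) y = φ (w 1) (w 2) ∧
  φ (w 3) (w 4) = φ z (w 2) ∧
  ([φ y (w 0), φ (w 1) (w 0), φ (w 3) y, φ (w 3) (w 4)] : List (Fin n)).Nodup

def bridgeVerts {n : ℕ} (y z : Fin n) (w : Fin 6 → Fin n) : Finset (Fin n) :=
  insert y (insert z (Finset.image w Finset.univ))

def bridgeHasColour {n : ℕ} (φ : Fin n → Fin n → Fin n) (y z : Fin n)
    (w : Fin 6 → Fin n) (d : Fin n) : Prop :=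
  d = φ y (w 0) ∨ d = φ (w 1) (w 0) ∨ d = φ (w 1) (w 2) ∨ d = φ z (w 2) ∨
  d = φ (w 3) y ∨ d = φ (w 3) (w 4) ∨ d = φ (w 5) (w 4) ∨ d = φ (w 5) z

def WellSpreadBridgeGadgets {n : ℕ} (φ : Fin n → Fin n → Fin n) (y z : Fin n)
    (ℬ : Finset (Fin 6 → Fin n)) : Prop :=
  (∀ u : Fin n, u ≠ y → u ≠ z → (ℬ.filter fun w => u ∈ bridgeVerts y z w).card ≤ n) ∧
  (∀ d : Fin n, (ℬ.filter fun w => bridgeHasColour φ y z w d).card ≤ n)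


/-- The number of loops of colour `c`. -/
def loopCount {n : ℕ} (φ : Fin n → Fin n → Fin n) (c : Fin n) : ℕ :=
  Nat.card {i : Fin n // φ i i = c}

/-- For all `v, c`, a well-spread collection of at least `n²/2¹⁰⁰` `(v,c)`-absorbing
gadgets exists. -/
def HasAbsGadgets {n : ℕ} (φ : Fin n → Fin n → Fin n) : Prop :=
  ∀ v c : Fin n, ∃ 𝒜 : Finset (Fin 6 → Fin n),
    (∀ x ∈ 𝒜, IsAbsGadget φ v c x) ∧ WellSpreadAbsGadgets φ v c 𝒜 ∧
    (n : ℝ) ^ 2 / 2 ^ 100 ≤ 𝒜.card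

/-- For all distinct `y, z`, a well-spread collection of at least `n²/10⁵⁰`
`(y,z)`-bridging gadgets exists. -/
def HasBridgeGadgets {n : ℕ} (φ : Fin n → Fin n → Fin n) : Prop :=
  ∀ y z : Fin n, y ≠ z → ∃ ℬ : Finset (Fin 6 → Fin n),
    (∀ w ∈ ℬ, IsBridgeGadget φ y z w) ∧ WellSpreadBridgeGadgets φ y z ℬ ∧
    (n : ℝ) ^ 2 / 10 ^ 50 ≤ ℬ.card

/-! ### `(y,z,𝒫)`-bridges in `𝒢_D` -/

/-- `(D₁, …, D₆)` is an equitable ordered partition of `D` into six parts. -/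
def IsEquitableSixPartition {n : ℕ} (D : Finset (Fin n)) (P : Fin 6 → Finset (Fin n)) :
    Prop :=
  (∀ i, P i ⊆ D) ∧ (∀ i j, i ≠ j → Disjoint (P i) (P j)) ∧
  (Finset.univ.biUnion P = D) ∧ (∀ i j, (P i).card ≤ (P j).card + 1)

/-- A `(y,z,𝒫)`-bridge in `H ∈ 𝒢_D`. -/
def IsBridge {n : ℕ} {D : Finset (Fin n)} (H : GD n D) (y z : Fin n)
    (P : Fin 6 → Finset (Fin n)) (w : Fin 6 → Fin n) : Prop :=
  ([y, z, w 0, w 1, w 2, w 3, w 4, w 5] : List (Fin n)).Nodup ∧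
  ∃ d₁ d₂ d₃ d₄ d₅ d₆ : {d : Fin n // d ∈ D},
    (d₁ : Fin n) ∈ P 0 ∧ (d₂ : Fin n) ∈ P 1 ∧ (d₃ : Fin n) ∈ P 2 ∧
    (d₄ : Fin n) ∈ P 3 ∧ (d₅ : Fin n) ∈ P 4 ∧ (d₆ : Fin n) ∈ P 5 ∧
    H.1 d₁ y = w 0 ∧ H.1 d₁ (w 5) = w 4 ∧
    H.1 d₂ (w 1) = w 0 ∧ H.1 d₂ (w 5) = z ∧
    H.1 d₃ (w 3) = y ∧ H.1 d₃ (w 1) = w 2 ∧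
    H.1 d₄ (w 3) = w 4 ∧ H.1 d₄ z = w 2 ∧
    H.1 d₅ y = w 1 ∧ H.1 d₆ z = w 4

/-- The ten arcs of a `(y,z,𝒫)`-bridge. -/
def bridgeArcsOf {n : ℕ} (y z : Fin n) (w : Fin 6 → Fin n) : Finset (Fin n × Fin n) :=
  {(y, w 0), (w 1, w 0), (w 1, w 2), (z, w 2), (w 3, y), (w 3, w 4), (w 5, w 4), (w 5, z),
   (y, w 1), (z, w 4)}

/-- The four arcs `w₂→w₁, w₂→w₃, w₄→w₅, w₆→w₅` of a bridge. -/
def keyArcsOf {n : ℕ} (w : Fin 6 → Fin n) : Finset (Fin n × Fin n) :=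
  {(w 1, w 0), (w 1, w 2), (w 3, w 4), (w 5, w 4)}

/-- A distinguishable `(y,z,𝒫)`-bridge: the only bridge containing any of its four key arcs. -/
def IsDistinguishableBridge {n : ℕ} {D : Finset (Fin n)} (H : GD n D) (y z : Fin n)
    (P : Fin 6 → Finset (Fin n)) (w : Fin 6 → Fin n) : Prop :=
  IsBridge H y z P w ∧
  ∀ w' : Fin 6 → Fin n, IsBridge H y z P w' →
    ¬ Disjoint (keyArcsOf w) (bridgeArcsOf y z w') → w' = w

/-- `r_{(y,z,𝒫)}(H)`: the number of distinguishable `(y,z,𝒫)`-bridges in `H`. -/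
def distBridgeCount {n : ℕ} {D : Finset (Fin n)} (H : GD n D) (y z : Fin n)
    (P : Fin 6 → Finset (Fin n)) : ℕ :=
  Nat.card {w : Fin 6 → Fin n // IsDistinguishableBridge H y z P w}

/-- Membership in `Q̂_D^{(y,z,𝒫)} = ⋃_{s=0}^{n|D|} M_s^{(y,z,𝒫)}`. -/
def InQhat {n : ℕ} {D : Finset (Fin n)} (H : GD n D) (y z : Fin n)
    (P : Fin 6 → Finset (Fin n)) : Prop :=
  distBridgeCount H y z P ≤ n * D.card ∧
  ∀ A₁ A₂ : Finset (Fin n), A₁.card = D.card → A₂.card = D.card →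
    (eArcs H A₁ A₂ : ℝ) ≤ 2 * (D.card : ℝ) ^ 3 / n + 12 * distBridgeCount H y z P

/-- A `(y,z)`-bridging gadget of `H ∈ 𝒢_D`. -/
def IsBridgeGadgetGD {n : ℕ} {D : Finset (Fin n)} (H : GD n D) (y z : Fin n)
    (w : Fin 6 → Fin n) : Prop :=
  ([y, z, w 0, w 1, w 2, w 3, w 4, w 5] : List (Fin n)).Nodup ∧
  ∃ d₁ d₂ d₃ d₄ : {d : Fin n // d ∈ D},
    ([(d₁ : Fin n), (d₂ : Fin n), (d₃ : Fin n), (d₄ : Fin n)] : List (Fin n)).Nodup ∧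
    H.1 d₁ y = w 0 ∧ H.1 d₁ (w 5) = w 4 ∧
    H.1 d₂ (w 1) = w 0 ∧ H.1 d₂ (w 5) = z ∧
    H.1 d₃ (w 3) = y ∧ H.1 d₃ (w 1) = w 2 ∧
    H.1 d₄ (w 3) = w 4 ∧ H.1 d₄ z = w 2

/-- The gadget (in `H ∈ 𝒢_D`) contains an arc of colour `d`. -/
def bridgeGadgetGDHasColour {n : ℕ} {D : Finset (Fin n)} (H : GD n D) (y z : Fin n)
    (w : Fin 6 → Fin n) (d : Fin n) : Prop :=
  ∃ d' : {d : Fin n // d ∈ D}, (d' : Fin n) = d ∧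
    (H.1 d' y = w 0 ∨ H.1 d' (w 1) = w 0 ∨ H.1 d' (w 1) = w 2 ∨ H.1 d' z = w 2 ∨
     H.1 d' (w 3) = y ∨ H.1 d' (w 3) = w 4 ∨ H.1 d' (w 5) = w 4 ∨ H.1 d' (w 5) = z)

def WellSpreadBridgeGadgetsGD {n : ℕ} {D : Finset (Fin n)} (H : GD n D) (y z : Fin n)
    (ℬ : Finset (Fin 6 → Fin n)) : Prop :=
  (∀ u : Fin n, u ≠ y → u ≠ z → (ℬ.filter fun w => u ∈ bridgeVerts y z w).card ≤ n) ∧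
  (∀ d : Fin n, (ℬ.filter fun w => bridgeGadgetGDHasColour H y z w d).card ≤ n)

/-! ### Directed paths, absorbers, `T`-absorbers -/

/-- The arcs of the directed path whose vertices are the entries of `p`, in order. -/
def pathArcs {n : ℕ} (p : List (Fin n)) : List (Fin n × Fin n) := p.zip p.tail

def pathColours {n : ℕ} (φ : Fin n → Fin n → Fin n) (p : List (Fin n)) : List (Fin n) :=
  (pathArcs p).map fun e => φ e.1 e.2

def internalVerts {n : ℕ} (p : List (Fin n)) : List (Fin n) := (p.drop 1).dropLast

set_option maxHeartbeats 1600000 in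
/-- A `(v,c)`-absorber: a `(v,c)`-absorbing gadget with vertices `x`, bridged by an
`(x₄,x₅)`-bridging gadget with vertices `w`, completed by four rainbow directed paths. -/
structure Absorber (n : ℕ) (φ : Fin n → Fin n → Fin n) (v c : Fin n) where
  x : Fin 6 → Fin n
  w : Fin 6 → Fin n
  P : Fin 4 → List (Fin n)
  gadget : IsAbsGadget φ v c x
  bridge : IsBridgeGadget φ (x 3) (x 4) w
  meetAB : absGadgetVerts v x ∩ bridgeVerts (x 3) (x 4) w = {x 3, x 4}
  colourDisjointAB :
    ∀ d : Fin n, absGadgetHasColour φ v x d → bridgeHasColour φ (x 3) (x 4) w d → False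
  pathNodup : ∀ i, (P i).Nodup
  pathEnds :
    (P 0).head? = some (x 1) ∧ (P 0).getLast? = some (x 2) ∧
    (P 1).head? = some (w 0) ∧ (P 1).getLast? = some (w 3) ∧
    (P 2).head? = some (w 4) ∧ (P 2).getLast? = some (w 1) ∧
    (P 3).head? = some (w 2) ∧ (P 3).getLast? = some (w 5)
  pathsDisjoint : ∀ i j, i ≠ j → ∀ a ∈ P i, a ∉ P j
  pathInternalDisjoint : ∀ i, ∀ a ∈ internalVerts (P i),
    a ∉ absGadgetVerts v x ∧ a ∉ bridgeVerts (x 3) (x 4) w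
  pathsRainbowEach : ∀ i, (pathColours φ (P i)).Nodup
  pathsRainbowPair : ∀ i j, i ≠ j → ∀ d ∈ pathColours φ (P i), d ∉ pathColours φ (P j)
  pathColoursNew : ∀ i, ∀ d ∈ pathColours φ (P i),
    ¬ absGadgetHasColour φ v x d ∧ ¬ bridgeHasColour φ (x 3) (x 4) w d

def Absorber.arcs {n : ℕ} {φ : Fin n → Fin n → Fin n} {v c : Fin n}
    (A : Absorber n φ v c) : Finset (Fin n × Fin n) :=
  ({(A.x 0, v), (v, A.x 1), (A.x 0, A.x 1), (A.x 2, A.x 3), (A.x 2, A.x 4),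
    (A.x 3, A.x 5), (A.x 4, A.x 5)} : Finset (Fin n × Fin n)) ∪
  ({(A.x 3, A.w 0), (A.w 1, A.w 0), (A.w 1, A.w 2), (A.x 4, A.w 2), (A.w 3, A.x 3),
    (A.w 3, A.w 4), (A.w 5, A.w 4), (A.w 5, A.x 4)} : Finset (Fin n × Fin n)) ∪
  Finset.univ.biUnion fun i : Fin 4 => (pathArcs (A.P i)).toFinset

def Absorber.verts {n : ℕ} {φ : Fin n → Fin n → Fin n} {v c : Fin n}
    (A : Absorber n φ v c) : Finset (Fin n) :=
  absGadgetVerts v A.x ∪ bridgeVerts (A.x 3) (A.x 4) A.w ∪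
    Finset.univ.biUnion fun i : Fin 4 => (A.P i).toFinset

def Absorber.colours {n : ℕ} {φ : Fin n → Fin n → Fin n} {v c : Fin n}
    (A : Absorber n φ v c) : Finset (Fin n) :=
  A.arcs.image fun e => φ e.1 e.2

def Absorber.initial {n : ℕ} {φ : Fin n → Fin n → Fin n} {v c : Fin n}
    (A : Absorber n φ v c) : Fin n := A.x 0

def Absorber.terminal {n : ℕ} {φ : Fin n → Fin n → Fin n} {v c : Fin n}
    (A : Absorber n φ v c) : Fin n := A.x 5

/-- A `T`-absorber inside the coloured `K_n^↔`, with arc set `H`. -/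
structure TAbsorber (n : ℕ) (φ : Fin n → Fin n → Fin n) {α β : Type}
    [Fintype α] [Fintype β] [DecidableEq α] [DecidableEq β]
    (T : Finset (α × β)) (H : Finset (Fin n × Fin n)) where
  fV : α → Fin n
  fC : β → Fin n
  fVinj : Function.Injective fV
  fCinj : Function.Injective fC
  fCrange : ∀ b : β, fC b ∈ H.image fun e : Fin n × Fin n => φ e.1 e.2
  Ab : (e : α × β) → e ∈ T → Absorber n φ (fV e.1) (fC e.2)
  AbSub : ∀ e he, (Ab e he).arcs ⊆ H
  AbUnique : ∀ e he (A' : Absorber n φ (fV e.1) (fC e.2)),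
    A'.arcs ⊆ H → A'.arcs = (Ab e he).arcs
  AbVertexDisjoint : ∀ e he e' he', e ≠ e' →
    ∀ u : Fin n, u ∈ (Ab e he).verts → u ∈ (Ab e' he').verts → e.1 = e'.1 ∧ u = fV e.1
  AbColourDisjoint : ∀ e he e' he', e ≠ e' →
    ∀ d : Fin n, d ∈ (Ab e he).colours → d ∈ (Ab e' he').colours → e.2 = e'.2 ∧ d = fC e.2
  es : Fin T.card → α × β
  esInj : Function.Injective es
  esMem : ∀ i, es i ∈ T
  link : Fin (T.card - 1) → List (Fin n)
  linkLen : ∀ i, (link i).length = 4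
  linkNodup : ∀ i, (link i).Nodup
  linkSub : ∀ i, ∀ e ∈ pathArcs (link i), e ∈ H
  linkPairwiseDisjoint : ∀ i j, i ≠ j → ∀ a ∈ link i, a ∉ link j
  linkRainbowEach : ∀ i, (pathColours φ (link i)).Nodup
  linkRainbowPair : ∀ i j, i ≠ j → ∀ d ∈ pathColours φ (link i), d ∉ pathColours φ (link j)
  linkColourNew : ∀ i, ∀ d ∈ pathColours φ (link i), ∀ e he, d ∉ (Ab e he).colours
  linkHead : ∀ i : Fin (T.card - 1),
    (link i).head? = some (Ab (es (Fin.castLE (Nat.sub_le _ _) i)) (esMem _)).terminal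
  linkLast : ∀ i : Fin (T.card - 1),
    (link i).getLast? =
      some (Ab (es ⟨i.1 + 1, by have := i.2; omega⟩) (esMem _)).initial
  linkInternalDisjoint : ∀ i, ∀ a ∈ internalVerts (link i), ∀ e he, a ∉ (Ab e he).verts
  minimal : H = (T.attach.biUnion fun e => (Ab e.1 e.2).arcs) ∪
      (Finset.univ.biUnion fun i => (pathArcs (link i)).toFinset)

def TAbsorber.initialVtx {n : ℕ} {φ : Fin n → Fin n → Fin n} {α β : Type}
    [Fintype α] [Fintype β] [DecidableEq α] [DecidableEq β]
    {T : Finset (α × β)} {H : Finset (Fin n × Fin n)} (𝔸 : TAbsorber n φ T H)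
    (h : 0 < T.card) : Fin n :=
  (𝔸.Ab (𝔸.es ⟨0, h⟩) (𝔸.esMem _)).initial

def TAbsorber.terminalVtx {n : ℕ} {φ : Fin n → Fin n → Fin n} {α β : Type}
    [Fintype α] [Fintype β] [DecidableEq α] [DecidableEq β]
    {T : Finset (α × β)} {H : Finset (Fin n × Fin n)} (𝔸 : TAbsorber n φ T H)
    (h : 0 < T.card) : Fin n :=
  (𝔸.Ab (𝔸.es ⟨T.card - 1, Nat.sub_lt h Nat.one_pos⟩) (𝔸.esMem _)).terminal

/-- `T` (bipartite, edge set a finset of `α × β`) is robustly matchable with respect to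
flexible sets `A'`, `B'`. -/
def RobustlyMatchable {α β : Type} [DecidableEq α] [DecidableEq β]
    (T : Finset (α × β)) (A' : Finset α) (B' : Finset β) : Prop :=
  ∀ X : Finset α, ∀ Y : Finset β, X ⊆ A' → Y ⊆ B' → X.card = Y.card →
    (X.card : ℝ) ≤ min ((A'.card : ℝ) / 2) ((B'.card : ℝ) / 2) →
    ∃ M : Finset (α × β), M ⊆ T ∧ (∀ e ∈ M, e.1 ∉ X ∧ e.2 ∉ Y) ∧
      (∀ a : α, a ∉ X → ∃! e, e ∈ M ∧ e.1 = a) ∧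
      (∀ b : β, b ∉ Y → ∃! e, e ∈ M ∧ e.2 = b)

def arcVerts {n : ℕ} (H : Finset (Fin n × Fin n)) : Finset (Fin n) :=
  H.image Prod.fst ∪ H.image Prod.snd

/-- `H` (an arc set in the coloured `K_n^↔`) is robustly rainbow-Hamiltonian with respect
to flexible sets `Vf`, `Cf` and initial and terminal vertices `u`, `v`. -/
def RobustlyRainbowHam {n : ℕ} (φ : Fin n → Fin n → Fin n) (H : Finset (Fin n × Fin n))
    (Vf Cf : Finset (Fin n)) (u v : Fin n) : Prop :=
  ∀ X Y : Finset (Fin n), X ⊆ Vf → Y ⊆ Cf → X.card = Y.card →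
    (X.card : ℝ) ≤ min ((Vf.card : ℝ) / 2) ((Cf.card : ℝ) / 2) →
    ∃ p : List (Fin n), p.Nodup ∧ p.head? = some u ∧ p.getLast? = some v ∧
      (∀ e ∈ pathArcs p, e ∈ H) ∧
      (∀ a ∈ p, a ∉ X) ∧
      p.toFinset = arcVerts H \ X ∧
      (pathColours φ p).Nodup ∧
      (∀ d ∈ pathColours φ p, d ∉ Y)

/-! ### Lower-quasirandomness and rainbow directed path forests -/

/-- `e_{G,D}(U₁,U₂)`: the number of arcs with tail in `U₁`, head in `U₂`, colour in `D`. -/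
def colArcCount {n : ℕ} (φ : Fin n → Fin n → Fin n) (U₁ U₂ D : Finset (Fin n)) : ℕ :=
  Nat.card {p : Fin n × Fin n // p.1 ∈ U₁ ∧ p.2 ∈ U₂ ∧ φ p.1 p.2 ∈ D}

def LowerQuasirandom {n : ℕ} (φ : Fin n → Fin n → Fin n) : Prop :=
  ∀ U₁ U₂ D : Finset (Fin n),
    (U₁.card : ℝ) * U₂.card * D.card / n - (n : ℝ) ^ (5 / 3 : ℝ) ≤ colArcCount φ U₁ U₂ D

/-- The arc set `Q` contains a directed cycle (a loop counts as a cycle of length one). -/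
def HasDiCycle {n : ℕ} (Q : Finset (Fin n × Fin n)) : Prop :=
  ∃ (a : Fin n) (l : List (Fin n)), (a :: l).Nodup ∧
    List.Chain (fun u v : Fin n => (u, v) ∈ Q) a l ∧
    ((a :: l).getLast (List.cons_ne_nil a l), a) ∈ Q

/-- `Q` is (the arc set of) a spanning rainbow directed path forest of `G − U`, using no
colour of `D`, with at most `n^{9/10}` components. -/
def IsGoodPathForest {n : ℕ} (φ : Fin n → Fin n → Fin n) (U D : Finset (Fin n))
    (Q : Finset (Fin n × Fin n)) : Prop :=
  (∀ e ∈ Q, e.1 ∉ U ∧ e.2 ∉ U) ∧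
  (∀ e ∈ Q, ∀ e' ∈ Q, e ≠ e' → e.1 ≠ e'.1 ∧ e.2 ≠ e'.2) ∧
  ¬ HasDiCycle Q ∧
  Set.InjOn (fun e : Fin n × Fin n => φ e.1 e.2) (Q : Set (Fin n × Fin n)) ∧
  (∀ e ∈ Q, φ e.1 e.2 ∉ D) ∧
  ((n : ℝ) - U.card - Q.card ≤ (n : ℝ) ^ (9 / 10 : ℝ))

/-- The logarithm of the geometric mean of `1, …, r`, which is `0` for `r = 0`. -/
def logFactMean (r : ℕ) : ℝ := Real.log (r.factorial : ℝ) / r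

lemma natCast_mul_logFactMean (r : ℕ) : (r : ℝ) * logFactMean r = Real.log (r.factorial : ℝ) := by
  rcases Nat.eq_zero_or_pos r with h | h
  · simp [h]
  · have : (r : ℝ) ≠ 0 := by positivity
    rw [logFactMean]; field_simp

lemma log_add_pred_mul_logFactMean {r : ℕ} (hr : 0 < r) :
    Real.log r + ((r - 1 : ℕ) : ℝ) * logFactMean (r - 1) = r * logFactMean r := by
  rw [natCast_mul_logFactMean, natCast_mul_logFactMean]
  obtain ⟨s, rfl⟩ : ∃ s, r = s + 1 := ⟨r - 1, by omega⟩
  rw [Nat.add_sub_cancel, Nat.factorial_succ, Nat.cast_mul,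
    Real.log_mul (by positivity) (by positivity)]

/-- The number of bijections `σ` with `σ i ∈ A i` for all `i`. -/
def sysCount {ι κ : Type} [Fintype ι] [Fintype κ] (A : ι → Finset κ) : ℕ :=
  (Finset.univ.filter fun σ : ι ≃ κ => ∀ i, σ i ∈ A i).card

lemma filter_apply_eq_card_le {ι κ : Type} [Fintype ι] [Fintype κ] (A : ι → Finset κ)
    (i : ι) (k : κ) :
    ((Finset.univ.filter fun σ : ι ≃ κ => ∀ i, σ i ∈ A i).filter fun σ => σ i = k).card ≤
      sysCount (fun j : {j // j ≠ i} => (A j).subtype fun y => y ≠ k) := by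
  refine Finset.card_le_card_of_injOn
    (fun σ => (σ.trans (Equiv.swap (σ i) k)).subtypeEquiv (p := fun j => j ≠ i)
      (q := fun y => y ≠ k) (fun a => by
        simp only [Equiv.trans_apply, ne_eq]
        rw [Equiv.swap_apply_eq_iff, Equiv.swap_apply_right]; simp)) ?_ ?_
  · intro σ hσ
    simp only [Finset.coe_filter, Finset.mem_filter, Finset.mem_univ, true_and,
      Set.mem_ofPred_eq] at hσ ⊢
    intro j
    simp [hσ.1, hσ.2]
  · intro σ hσ τ hτ h
    simp only [Finset.coe_filter, Finset.mem_filter, Finset.mem_univ, true_and,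
      Set.mem_ofPred_eq] at hσ hτ
    ext j
    by_cases hj : j = i
    · rw [hj, hσ.2, hτ.2]
    · have := congrArg (fun e => (e ⟨j, hj⟩).1) h
      simpa [hσ.2, hτ.2] using this

lemma sum_logFactMean_erase {ι κ : Type} [Fintype ι] [Fintype κ] (σ : ι ≃ κ) (B : Finset κ) (j : ι)
    (hj : σ j ∈ B) :
    ∑ i ∈ Finset.univ.erase j, logFactMean ((B.erase (σ i)).card) =
      ((B.card - 1 : ℕ) : ℝ) * logFactMean (B.card - 1) +
        ((Fintype.card ι : ℝ) - B.card) * logFactMean B.card := by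
  have h1 : ∑ i ∈ Finset.univ.erase j, logFactMean ((B.erase (σ i)).card) =
      ∑ k ∈ Finset.univ.erase (σ j), logFactMean ((B.erase k).card) := by
    refine Finset.sum_equiv σ ?_ ?_
    · simp
    · simp
  rw [h1]
  have h2 : (Finset.univ.erase (σ j) : Finset κ) = B.erase (σ j) ∪ Bᶜ := by
    ext k
    simp only [Finset.mem_erase, Finset.mem_univ, Finset.mem_union, Finset.mem_compl, and_true]
    constructor
    · intro h; tauto
    · rintro (h | h)
      · exact h.1
      · rintro rfl; exact h hj
  rw [h2, Finset.sum_union]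
  · congr 1
    · rw [Finset.sum_congr rfl (g := fun _ => logFactMean (B.card - 1))]
      · simp [Finset.card_erase_of_mem hj]
      · intro k hk
        rw [Finset.card_erase_of_mem (Finset.mem_of_mem_erase hk)]
    · rw [Finset.sum_congr rfl (g := fun _ => logFactMean (B.card))]
      · simp only [Finset.sum_const, Finset.card_compl, nsmul_eq_mul]
        rw [Nat.cast_sub (Finset.card_le_univ _), Fintype.card_congr σ]
      · intro k hk
        rw [Finset.erase_eq_of_notMem (Finset.mem_compl.1 hk)]
  · rw [Finset.disjoint_left]
    intro k hk hk'
    exact Finset.mem_compl.1 hk' (Finset.mem_of_mem_erase hk)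

/-- **Brégman's theorem**: an upper bound for the permanent of a `0`-`1` matrix. -/
theorem sysCount_le_exp : ∀ (N : ℕ) {ι κ : Type} [Fintype ι] [Fintype κ] (A : ι → Finset κ),
    Fintype.card ι = N →
    (sysCount A : ℝ) ≤ Real.exp (∑ i, logFactMean (A i).card) := by
  intro N
  induction N with
  | zero =>
    intro ι κ _ _ A h
    have : IsEmpty ι := Fintype.card_eq_zero_iff.1 h
    have h1 : sysCount A ≤ 1 := by
      rw [sysCount, Finset.card_le_one]
      intro a _ b _
      ext i
      exact isEmptyElim i
    simpa using h1
  | succ N ih =>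
    intro ι κ _ _ A hN
    set P : Finset (ι ≃ κ) := Finset.univ.filter fun σ : ι ≃ κ => ∀ i, σ i ∈ A i with hP
    have hsys : sysCount A = P.card := rfl
    rw [hsys]
    rcases P.eq_empty_or_nonempty with h0 | hne
    · rw [h0]; simp only [Finset.card_empty, Nat.cast_zero]; positivity
    have hp : 0 < P.card := hne.card_pos
    have hpR : (0 : ℝ) < P.card := by exact_mod_cast hp
    have hmem : ∀ σ ∈ P, ∀ i, σ i ∈ A i := fun σ hσ => (Finset.mem_filter.1 hσ).2
    obtain ⟨σ₀, hσ₀⟩ := hne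
    have hr : ∀ i, 0 < (A i).card := fun i => Finset.card_pos.2 ⟨_, hmem σ₀ hσ₀ i⟩
    let q : ι → κ → ℕ := fun i k => (P.filter fun σ => σ i = k).card
    have hq : ∀ σ ∈ P, ∀ i, 0 < q i (σ i) := fun σ hσ i =>
      Finset.card_pos.2 ⟨σ, Finset.mem_filter.2 ⟨hσ, rfl⟩⟩
    have step1 : ∀ i, 0 ≤ ∑ σ ∈ P, (Real.log (A i).card + Real.log (q i (σ i)) -
        Real.log P.card) := by
      intro i
      have hri : (0 : ℝ) < (A i).card := by exact_mod_cast hr i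
      have h1 : ∀ σ ∈ P, 1 - (P.card / (A i).card : ℝ) * (1 / q i (σ i)) ≤
          Real.log (A i).card + Real.log (q i (σ i)) - Real.log P.card := by
        intro σ hσ
        have hqi : (0 : ℝ) < q i (σ i) := by exact_mod_cast hq σ hσ i
        have := Real.one_sub_inv_le_log_of_pos
          (show (0 : ℝ) < (A i).card * q i (σ i) / P.card by positivity)
        rw [Real.log_div (by positivity) (by positivity),
          Real.log_mul (by positivity) (by positivity)] at this
        refine le_trans (le_of_eq ?_) this
        field_simp
      refine le_trans ?_ (Finset.sum_le_sum h1)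
      rw [Finset.sum_sub_distrib, ← Finset.mul_sum]
      have h2 : ∑ σ ∈ P, (1 / (q i (σ i)) : ℝ) ≤ (A i).card := by
        rw [← Finset.sum_fiberwise_of_maps_to (s := P) (t := A i) (g := fun σ => σ i)
          (fun σ hσ => hmem σ hσ i)]
        calc _ ≤ ∑ k ∈ A i, (1 : ℝ) := by
              refine Finset.sum_le_sum fun k _ => ?_
              rw [Finset.sum_congr rfl (g := fun _ => (1 / (q i k) : ℝ))]
              · rw [Finset.sum_const, nsmul_eq_mul]
                show (q i k : ℝ) * (1 / q i k) ≤ 1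
                rcases Nat.eq_zero_or_pos (q i k) with h | h
                · simp [h]
                · have : (q i k : ℝ) ≠ 0 := by positivity
                  field_simp; exact le_refl _
              · intro σ hσ
                rw [(Finset.mem_filter.1 hσ).2]
          _ = _ := by simp
      have h3 : (P.card / (A i).card : ℝ) * ∑ σ ∈ P, (1 / (q i (σ i)) : ℝ) ≤ P.card := by
        calc _ ≤ (P.card / (A i).card : ℝ) * (A i).card := by gcongr
          _ = _ := by field_simp
      simp only [Finset.sum_const, nsmul_eq_mul, mul_one]
      linarith
    have step2 : ∀ σ ∈ P, ∀ i, Real.log (q i (σ i)) ≤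
        ∑ j ∈ Finset.univ.erase i, logFactMean ((A j).erase (σ i)).card := by
      intro σ hσ i
      have hqi : (0 : ℝ) < q i (σ i) := by exact_mod_cast hq σ hσ i
      rw [Real.log_le_iff_le_exp hqi]
      have h1 : (q i (σ i) : ℝ) ≤
          sysCount (fun j : {j // j ≠ i} => (A j).subtype fun y => y ≠ σ i) := by
        exact_mod_cast filter_apply_eq_card_le A i (σ i)
      refine h1.trans ((ih _ ?_).trans (le_of_eq ?_))
      · rw [Fintype.card_subtype_compl, hN]; simp
      · congr 1
        rw [← Finset.filter_ne', ← Finset.sum_subtype_eq_sum_filter, Finset.subtype_univ]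
        refine Finset.sum_congr rfl fun j _ => ?_
        congr 1
        rw [Finset.card_subtype]
        congr 1
        ext y
        simp [and_comm]
    have step3 : ∀ σ ∈ P, ∑ i, (Real.log (A i).card + Real.log (q i (σ i)) - Real.log P.card) ≤
        (N + 1 : ℝ) * (∑ i, logFactMean (A i).card) - (N + 1 : ℝ) * Real.log P.card := by
      intro σ hσ
      rw [Finset.sum_sub_distrib, Finset.sum_add_distrib]
      have h1 : ∑ i, Real.log (q i (σ i)) ≤
          ∑ j, ∑ i ∈ Finset.univ.erase j, logFactMean ((A j).erase (σ i)).card := by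
        refine (Finset.sum_le_sum fun i _ => step2 σ hσ i).trans (le_of_eq ?_)
        refine Finset.sum_comm' ?_
        intro x y
        simp [eq_comm]
      have h2 : ∑ i, Real.log (A i).card +
          ∑ j, ∑ i ∈ Finset.univ.erase j, logFactMean ((A j).erase (σ i)).card =
          (N + 1 : ℝ) * ∑ i, logFactMean (A i).card := by
        rw [← Finset.sum_add_distrib, Finset.mul_sum]
        refine Finset.sum_congr rfl fun j _ => ?_
        rw [sum_logFactMean_erase σ _ j (hmem σ hσ j), hN, ← add_assoc,
          log_add_pred_mul_logFactMean (hr j)]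
        push_cast
        ring
      have h3 : ∑ _i : ι, Real.log P.card = (N + 1 : ℝ) * Real.log P.card := by
        simp [hN]
      linarith
    have step4 : 0 ≤ ∑ σ ∈ P, ((N + 1 : ℝ) * (∑ i, logFactMean (A i).card) -
        (N + 1 : ℝ) * Real.log P.card) := by
      refine le_trans ?_ (Finset.sum_le_sum step3)
      rw [Finset.sum_comm]
      exact Finset.sum_nonneg fun i _ => step1 i
    rw [Finset.sum_const, nsmul_eq_mul, ← mul_sub] at step4
    have h5 : 0 ≤ ∑ i, logFactMean (A i).card - Real.log P.card := by
      by_contra hcon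
      push Not at hcon
      have : (P.card : ℝ) * ((N + 1 : ℝ) * (∑ i, logFactMean (A i).card - Real.log P.card)) < 0 :=
        mul_neg_of_pos_of_neg hpR (mul_neg_of_pos_of_neg (by positivity) hcon)
      linarith
    rw [← Real.log_le_iff_le_exp hpR]
    linarith

section Stable

open MvPolynomial

variable {ι : Type}

/-- The derivative of a polynomial in direction `a`. -/
def dirDeriv [Fintype ι] (a : ι → ℝ) (f : MvPolynomial ι ℝ) : MvPolynomial ι ℝ :=
  ∑ i, C (a i) * pderiv i f

/-- A homogeneous real polynomial of degree `m` without zeros in the right half space that is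
positive on the positive orthant. -/
structure HStable (m : ℕ) (f : MvPolynomial ι ℝ) : Prop where
  hom : f.IsHomogeneous m
  ne_zero : ∀ w : ι → ℂ, (∀ i, 0 < (w i).re) → aeval w f ≠ 0
  pos : ∀ w : ι → ℝ, (∀ i, 0 < w i) → 0 < aeval w f

/-- The restriction of `f` to the line `w + t a`. -/
def lineRestrict (f : MvPolynomial ι ℝ) (w : ι → ℂ) (a : ι → ℝ) : Polynomial ℂ :=
  aeval (fun i => Polynomial.C (w i) + Polynomial.C (a i : ℂ) * Polynomial.X) f

lemma eval_lineRestrict (f : MvPolynomial ι ℝ) (w : ι → ℂ) (a : ι → ℝ) (t : ℂ) :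
    (lineRestrict f w a).eval t = aeval (fun i => w i + a i * t) f := by
  have := map_aeval (fun i => Polynomial.C (w i) + Polynomial.C (a i : ℂ) * Polynomial.X)
    (Polynomial.evalRingHom t) f
  rw [Polynomial.coe_evalRingHom] at this
  rw [lineRestrict, this, aeval_def, coe_eval₂Hom]
  congr 1
  · ext x; simp
  · ext i; simp

lemma derivative_lineRestrict [Fintype ι] (f : MvPolynomial ι ℝ) (w : ι → ℂ) (a : ι → ℝ) :
    Polynomial.derivative (lineRestrict f w a) = lineRestrict (dirDeriv a f) w a := by
  unfold lineRestrict dirDeriv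
  induction f using MvPolynomial.induction_on with
  | C r =>
    simp
  | add p q hp hq => simp only [map_add, hp, hq, mul_add, Finset.sum_add_distrib]
  | mul_X p j hp =>
    have e : ∑ i, C (a i) * pderiv i (p * X j) =
        C (a j) * p + (∑ i, C (a i) * pderiv i p) * X j := by
      simp only [Derivation.leibniz, smul_eq_mul, mul_add, Finset.sum_add_distrib, pderiv_X]
      rw [Finset.sum_eq_single j (by
        intro b _ hb; rw [Pi.single_eq_of_ne hb.symm]; simp) (by simp), Finset.sum_mul]
      congr 1
      · simp
      · exact Finset.sum_congr rfl fun i _ => by ring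
    rw [e, map_mul, Polynomial.derivative_mul, hp]
    generalize (∑ i, C (a i) * pderiv i p) = S
    simp
    ring

lemma HStable.aeval_smul [Fintype ι] {R : Type} [CommRing R] [Algebra ℝ R] {m : ℕ}
    {f : MvPolynomial ι ℝ}
    (h : f.IsHomogeneous m) (s : R) (w : ι → R) :
    aeval (fun i => s * w i) f = s ^ m * aeval w f := by
  rw [aeval_def, aeval_def, eval₂_eq', eval₂_eq', Finset.mul_sum]
  refine Finset.sum_congr rfl fun d hd => ?_
  have hdm : ∑ i, d i = m := by
    have := h (mem_support_iff.1 hd)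
    rw [Finsupp.weight_apply, Finsupp.sum_fintype] at this
    · simpa using this
    · simp
  rw [← hdm, ← Finset.prod_pow_eq_pow_sum]
  simp only [mul_pow, Finset.prod_mul_distrib]
  ring

lemma aeval_ofReal (f : MvPolynomial ι ℝ) (w : ι → ℝ) :
    aeval (fun i => (w i : ℂ)) f = ((aeval w f : ℝ) : ℂ) := by
  have := map_aeval w (algebraMap ℝ ℂ) f
  rw [Complex.coe_algebraMap] at this
  rw [this, aeval_def, coe_eval₂Hom]
  congr 1

lemma HStable.root_re_neg {m : ℕ} {f : MvPolynomial ι ℝ} (h : HStable m f) {a : ι → ℝ}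
    (ha : ∀ i, 0 < a i) {w : ι → ℂ} (hw : ∀ i, 0 < (w i).re) {r : ℂ}
    (hr : (lineRestrict f w a).eval r = 0) : r.re < 0 := by
  by_contra hcon
  push Not at hcon
  rw [eval_lineRestrict] at hr
  refine h.ne_zero _ (fun i => ?_) hr
  have := mul_nonneg (ha i).le hcon
  simp
  linarith [hw i]

variable [Fintype ι]

lemma HStable.root_im {m : ℕ} {f : MvPolynomial ι ℝ} (h : HStable m f) {a : ι → ℝ}
    (ha : ∀ i, 0 < a i) {w : ι → ℝ} {r : ℂ}
    (hr : (lineRestrict f (fun i => (w i : ℂ)) a).eval r = 0) : r.im = 0 := by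
  rw [eval_lineRestrict] at hr
  rcases lt_trichotomy r.im 0 with h1 | h1 | h1
  · exfalso
    refine h.ne_zero (fun i => Complex.I * (w i + a i * r)) (fun i => ?_) ?_
    · have := mul_pos_of_neg_of_neg h1 (neg_neg_of_pos (ha i))
      simp
      linarith
    · rw [HStable.aeval_smul h.hom, hr, mul_zero]
  · exact h1
  · exfalso
    refine h.ne_zero (fun i => -Complex.I * (w i + a i * r)) (fun i => ?_) ?_
    · have := mul_pos h1 (ha i)
      simp
      linarith
    · rw [HStable.aeval_smul h.hom, hr, mul_zero]

lemma HStable.roots_ne_zero {m : ℕ} {f : MvPolynomial ι ℝ} (h : HStable (m + 1) f) {a : ι → ℝ}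
    (ha : ∀ i, 0 < a i) (w : ι → ℂ) : (lineRestrict f w a).roots ≠ 0 := by
  intro h0
  have hdeg : (lineRestrict f w a).natDegree = 0 := by
    rw [← Polynomial.splits_iff_card_roots.1 (IsAlgClosed.splits _), h0]; rfl
  obtain ⟨c, hc⟩ := Polynomial.natDegree_eq_zero.1 hdeg
  have h1 : ∀ s : ℝ, 0 < s → aeval (fun i => (s : ℂ) * w i + a i) f = (s : ℂ) ^ (m + 1) * c := by
    intro s hs
    have h2 := eval_lineRestrict f w a (1 / s : ℂ)
    rw [← hc, Polynomial.eval_C] at h2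
    rw [h2, ← HStable.aeval_smul h.hom]
    congr 1
    congr 1
    ext i
    have : (s : ℂ) ≠ 0 := by exact_mod_cast hs.ne'
    field_simp
  have hcont : Continuous fun s : ℝ => aeval (fun i => (s : ℂ) * w i + a i) f := by
    simp only [aeval_def, eval₂_eq']
    fun_prop
  have t1 := (hcont.tendsto 0).mono_left (nhdsWithin_le_nhds (s := Set.Ioi 0))
  have t2 : Filter.Tendsto (fun s : ℝ => (s : ℂ) ^ (m + 1) * c) (nhdsWithin 0 (Set.Ioi 0))
      (nhds (((0 : ℝ) : ℂ) ^ (m + 1) * c)) :=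
    ((by fun_prop : Continuous fun s : ℝ => (s : ℂ) ^ (m + 1) * c).tendsto 0).mono_left
      nhdsWithin_le_nhds
  have t3 := tendsto_nhds_unique (t1.congr' (by
    filter_upwards [self_mem_nhdsWithin] with s hs using h1 s hs)) t2
  refine h.ne_zero (fun i => (a i : ℂ)) (fun i => by simpa using ha i) ?_
  simpa using t3

lemma HStable.dirDeriv_eq {m : ℕ} {f : MvPolynomial ι ℝ} (h : HStable m f)
    (a : ι → ℝ) {w : ι → ℂ} (hw : ∀ i, 0 < (w i).re) :
    aeval w (dirDeriv a f) =
      aeval w f * ((lineRestrict f w a).roots.map fun r => -(1 / r)).sum := by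
  have h0 : (lineRestrict f w a).eval 0 = aeval w f := by
    rw [eval_lineRestrict]; simp
  have h1 : (lineRestrict (dirDeriv a f) w a).eval 0 = aeval w (dirDeriv a f) := by
    rw [eval_lineRestrict]; simp
  rw [← h1, ← derivative_lineRestrict, ← h0,
    (IsAlgClosed.splits _).eval_derivative_eq_eval_mul_sum (by rw [h0]; exact h.ne_zero w hw)]
  congr 3
  ext r
  rw [zero_sub, one_div_neg_eq_neg_one_div]

lemma multiset_sum_pos {M : Type} (s : Multiset M) (g : M → ℝ) (h : ∀ x ∈ s, 0 < g x)
    (hs : s ≠ 0) : 0 < (s.map g).sum := by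
  induction s using Multiset.induction_on with
  | empty => exact absurd rfl hs
  | cons x s ih =>
    rw [Multiset.map_cons, Multiset.sum_cons]
    by_cases h0 : s = 0
    · subst h0; simpa using h x (by simp)
    · exact add_pos (h x (by simp)) (ih (fun y hy => h y (by simp [hy])) h0)

lemma HStable.dirDeriv {m : ℕ} {f : MvPolynomial ι ℝ} (h : HStable (m + 1) f) {a : ι → ℝ}
    (ha : ∀ i, 0 < a i) : HStable m (dirDeriv a f) := by
  have key : ∀ w : ι → ℂ, (∀ i, 0 < (w i).re) →
      0 < (((lineRestrict f w a).roots.map fun r => -(1 / r)).sum).re := by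
    intro w hw
    rw [← Complex.coe_reAddGroupHom, map_multiset_sum, Multiset.map_map]
    refine multiset_sum_pos _ _ (fun r hr => ?_) (h.roots_ne_zero ha w)
    have hre := h.root_re_neg ha hw (Polynomial.isRoot_of_mem_roots hr)
    have hr0 : 0 < Complex.normSq r := Complex.normSq_pos.2 (by rintro rfl; simp at hre)
    simp only [one_div, Function.comp_apply, Complex.coe_reAddGroupHom, Complex.neg_re,
      Complex.inv_re]
    rw [← neg_div]
    exact div_pos (by linarith) hr0
  refine ⟨?_, ?_, ?_⟩
  · unfold RandomLatin.dirDeriv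
    refine IsHomogeneous.sum _ _ _ fun i _ => ?_
    have := (isHomogeneous_C ι (a i)).mul (h.hom.pderiv (i := i))
    simpa using this
  · intro w hw
    rw [h.dirDeriv_eq a hw]
    refine mul_ne_zero (h.ne_zero w hw) fun h0 => ?_
    have := key w hw
    rw [h0] at this
    simp at this
  · intro w hw
    have hw' : ∀ i, 0 < ((fun i => (w i : ℂ)) i).re := by simpa using hw
    have h1 := h.dirDeriv_eq a hw'
    rw [aeval_ofReal, aeval_ofReal] at h1
    have h2 := congrArg Complex.re h1
    rw [Complex.re_ofReal_mul, Complex.ofReal_re] at h2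
    rw [h2]
    exact mul_pos (h.pos w hw) (key _ hw')

lemma multiset_prod_one_add_le (s : Multiset ℝ) (hs : ∀ x ∈ s, 0 ≤ x) (t : ℝ) (ht : 0 ≤ t) :
    (s.map fun x => 1 + t * x).prod ≤ Real.exp (t * s.sum) := by
  induction s using Multiset.induction_on with
  | empty => simp
  | cons x s ih =>
    have hx := hs x (by simp)
    rw [Multiset.map_cons, Multiset.prod_cons, Multiset.sum_cons, mul_add, Real.exp_add]
    refine mul_le_mul ?_ (ih fun y hy => hs y (by simp [hy])) ?_ (by positivity)
    · linarith [Real.add_one_le_exp (t * x)]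
    · refine Multiset.prod_nonneg fun y hy => ?_
      obtain ⟨z, hz, rfl⟩ := Multiset.mem_map.1 hy
      have := hs z (by simp [hz])
      positivity

/-- The restriction of `f` to a ray grows at most exponentially. -/
lemma HStable.aeval_line_le {m : ℕ} {f : MvPolynomial ι ℝ} (h : HStable m f) {a : ι → ℝ}
    (ha : ∀ i, 0 < a i) {w : ι → ℝ} (hw : ∀ i, 0 < w i) {t : ℝ} (ht : 0 ≤ t) :
    aeval (fun i => w i + a i * t) f ≤
      aeval w f * Real.exp (t * (aeval w (RandomLatin.dirDeriv a f) / aeval w f)) := by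
  have hw' : ∀ i, 0 < ((fun i => (w i : ℂ)) i).re := by simpa using hw
  have hf := h.pos w hw
  set R := lineRestrict f (fun i => (w i : ℂ)) a with hR
  have h0 : R.eval 0 = (aeval w f : ℝ) := by
    rw [hR, eval_lineRestrict, ← aeval_ofReal]; simp
  have hroot : ∀ r ∈ R.roots, r = (r.re : ℂ) ∧ r.re < 0 := fun r hr =>
    ⟨Complex.ext rfl (by simpa using h.root_im ha (Polynomial.isRoot_of_mem_roots hr)),
      h.root_re_neg ha hw' (Polynomial.isRoot_of_mem_roots hr)⟩
  set s : Multiset ℝ := R.roots.map fun r => -(1 / r.re) with hs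
  have hsum : (s.sum : ℝ) = aeval w (RandomLatin.dirDeriv a f) / aeval w f := by
    have h1 := h.dirDeriv_eq a hw'
    rw [aeval_ofReal, aeval_ofReal] at h1
    have h2 : ((s.sum : ℝ) : ℂ) = (R.roots.map fun r => -(1 / r)).sum := by
      rw [← Complex.ofRealHom_eq_coe, map_multiset_sum, hs, Multiset.map_map]
      congr 1
      refine Multiset.map_congr rfl fun r hr => ?_
      simp only [Function.comp_apply, Complex.ofRealHom_eq_coe]
      conv_rhs => rw [(hroot r hr).1]
      push_cast; rfl
    rw [← h2] at h1
    rw [eq_div_iff hf.ne', mul_comm]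
    exact_mod_cast h1.symm
  have hprod : aeval (fun i => w i + a i * t) f = aeval w f * (s.map fun x => 1 + t * x).prod := by
    have h1 := eval_lineRestrict f (fun i => (w i : ℂ)) a t
    have h2 : (aeval (fun i => (w i : ℂ) + a i * t) f : ℂ) =
        ((aeval (fun i => w i + a i * t) f : ℝ) : ℂ) := by
      rw [← aeval_ofReal]; push_cast; rfl
    rw [h2, (IsAlgClosed.splits _).eval_eq_prod_roots] at h1
    rw [(IsAlgClosed.splits _).eval_eq_prod_roots] at h0
    have h3 : (R.roots.map fun r => (t : ℂ) - r).prod =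
        (R.roots.map fun r => (0 : ℂ) - r).prod * ((s.map fun x => 1 + t * x).prod : ℝ) := by
      have h4 : ((s.map fun x => 1 + t * x).prod : ℂ) =
          Complex.ofRealHom (s.map fun x => 1 + t * x).prod := rfl
      rw [h4, map_multiset_prod, hs, Multiset.map_map, Multiset.map_map, ← Multiset.prod_map_mul]
      congr 1
      refine Multiset.map_congr rfl fun r hr => ?_
      have hr0 : (r.re : ℂ) ≠ 0 := by exact_mod_cast (hroot r hr).2.ne
      simp only [Function.comp_apply, Complex.ofRealHom_eq_coe]
      rw [(hroot r hr).1]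
      push_cast
      simp only [Complex.ofReal_re]
      field_simp
      ring
    rw [h3, ← mul_assoc, h0] at h1
    exact_mod_cast h1.symm
  rw [hprod, ← hsum]
  refine mul_le_mul_of_nonneg_left (multiset_prod_one_add_le s ?_ t ht) hf.le
  intro x hx
  obtain ⟨r, hr, rfl⟩ := Multiset.mem_map.1 hx
  have := (hroot r hr).2
  rw [← one_div_neg_eq_neg_one_div]
  exact one_div_nonneg.2 (by linarith)

/-- The iterated directional derivative along `l 0, …, l (m - 1)`. -/
def iterDeriv : (m : ℕ) → (Fin m → ι → ℝ) → MvPolynomial ι ℝ → MvPolynomial ι ℝ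
  | 0, _, f => f
  | m + 1, l, f => iterDeriv m (fun j => l j.succ) (dirDeriv (l 0) f)

lemma aeval_add_eq_of_linear {f : MvPolynomial ι ℝ} (hf : f.IsHomogeneous 1)
    (a : ι → ℝ) : aeval (0 : ι → ℝ) (dirDeriv a f) = aeval a f := by
  have h1 : (lineRestrict (dirDeriv a f) 0 a).eval 0 =
      aeval (fun i => ((0 : ι → ℝ) i : ℂ)) (dirDeriv a f) := by
    rw [eval_lineRestrict]; congr 1; congr 1; ext i; simp
  have h2 : lineRestrict f 0 a = Polynomial.C (((aeval a f : ℝ)) : ℂ) * Polynomial.X := by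
    refine Polynomial.funext fun t => ?_
    rw [eval_lineRestrict]
    have := HStable.aeval_smul hf t (fun i => (a i : ℂ))
    rw [aeval_ofReal] at this
    simp only [Pi.zero_apply, zero_add, Polynomial.eval_mul, Polynomial.eval_C, Polynomial.eval_X]
    rw [mul_comm, ← pow_one t, ← this]
    simp [mul_comm]
  rw [aeval_ofReal, ← derivative_lineRestrict, h2] at h1
  simp only [Polynomial.derivative_mul, Polynomial.derivative_C, Polynomial.derivative_X,
    zero_mul, zero_add, mul_one, Polynomial.eval_C] at h1
  exact_mod_cast h1.symm

/-- The capacity bound for iterated derivatives. -/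
theorem HStable.le_iterDeriv : ∀ (m : ℕ) (f : MvPolynomial ι ℝ), HStable m f →
    ∀ (l : Fin m → ι → ℝ), (∀ j i, 0 < l j i) → ∀ K : ℝ, 0 < K →
    (∀ t : Fin m → ℝ, (∀ j, 0 < t j) → K * ∏ j, t j ≤ aeval (fun i => ∑ j, t j * l j i) f) →
    K * Real.exp (-m) ≤ aeval (0 : ι → ℝ) (iterDeriv m l f) := by
  intro m
  induction m with
  | zero =>
    intro f _ l _ K _ h
    have := h (fun _ => 1) (by simp)
    simp only [Finset.univ_eq_empty, Finset.prod_empty, Finset.sum_empty] at this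
    simpa [iterDeriv] using this
  | succ m ih =>
    intro f hf l hl K hK h
    rw [iterDeriv]
    have hstep : K * Real.exp (-1) * Real.exp (-m) = K * Real.exp (-(m + 1 : ℕ)) := by
      rw [mul_assoc, ← Real.exp_add]; push_cast; ring_nf
    rw [← hstep]
    refine ih _ (hf.dirDeriv (hl 0)) _ (fun j i => hl j.succ i) _ (by positivity) ?_
    intro t ht
    rcases Nat.eq_zero_or_pos m with hm | hm
    · subst hm
      have h1 := h (fun _ => 1) (by simp)
      simp only [Finset.univ_eq_empty, Finset.prod_empty, Finset.sum_empty, mul_one]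
      have h2 := aeval_add_eq_of_linear hf.hom (l 0)
      have h3 : (fun i => ∑ j : Fin (0 + 1), (fun _ => (1 : ℝ)) j * l j i) = l 0 := by
        ext i; simp
      rw [h3] at h1
      simp only [Finset.prod_const_one, mul_one] at h1
      show _ ≤ aeval (0 : ι → ℝ) _
      rw [h2]
      refine le_trans ?_ h1
      have : Real.exp (-1) ≤ 1 := Real.exp_le_one_iff.2 (by norm_num)
      nlinarith
    · set w : ι → ℝ := fun i => ∑ j : Fin m, t j * l j.succ i with hw
      have hwpos : ∀ i, 0 < w i := fun i =>
        Finset.sum_pos (fun j _ => mul_pos (ht j) (hl _ _)) ⟨⟨0, hm⟩, Finset.mem_univ _⟩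
      have hA := hf.pos w hwpos
      have hB := (hf.dirDeriv (hl 0)).pos w hwpos
      set A := aeval w f
      set D := aeval w (RandomLatin.dirDeriv (l 0) f)
      have h1 := h (Fin.cons (A / D) t) (by
        intro j
        refine Fin.cases ?_ (fun j => ?_) j
        · simpa using div_pos hA hB
        · simpa using ht j)
      have h2 := hf.aeval_line_le (hl 0) hwpos (div_pos hA hB).le
      rw [Fin.prod_univ_succ] at h1
      simp only [Fin.sum_univ_succ, Fin.cons_zero, Fin.cons_succ] at h1
      have h3 : (fun i => A / D * l 0 i + ∑ j : Fin m, t j * l j.succ i) =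
          fun i => w i + l 0 i * (A / D) := by
        ext i; rw [hw]; ring
      rw [h3] at h1
      have h4 := h1.trans h2
      have h5 : A / D * (D / A) = 1 := by field_simp
      rw [h5] at h4
      have h6 : K * Real.exp (-1) * ∏ j, t j =
          (K * (A / D * ∏ j, t j)) * (D / A * Real.exp (-1)) := by
        field_simp
      rw [h6]
      calc _ ≤ (A * Real.exp 1) * (D / A * Real.exp (-1)) := by gcongr
        _ = D * (Real.exp 1 * Real.exp (-1)) := by field_simp
        _ = D := by rw [← Real.exp_add]; simp

end Stable

section Stable

open MvPolynomial

variable {ι : Type} [Fintype ι]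

lemma dirDeriv_sum {α : Type} (a : ι → ℝ) (s : Finset α) (f : α → MvPolynomial ι ℝ) :
    dirDeriv a (∑ x ∈ s, f x) = ∑ x ∈ s, dirDeriv a (f x) := by
  simp only [dirDeriv, map_sum, Finset.mul_sum]
  exact Finset.sum_comm

lemma dirDeriv_C_mul (a : ι → ℝ) (r : ℝ) (f : MvPolynomial ι ℝ) :
    dirDeriv a (C r * f) = C r * dirDeriv a f := by
  simp only [dirDeriv, pderiv_C_mul, Finset.mul_sum]
  exact Finset.sum_congr rfl fun i _ => by ring

lemma iterDeriv_sum {α : Type} (s : Finset α) : ∀ (m : ℕ) (l : Fin m → ι → ℝ)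
    (f : α → MvPolynomial ι ℝ),
    iterDeriv m l (∑ x ∈ s, f x) = ∑ x ∈ s, iterDeriv m l (f x)
  | 0, _, _ => rfl
  | m + 1, l, f => by simp only [iterDeriv, dirDeriv_sum, iterDeriv_sum s m]

lemma iterDeriv_C_mul (r : ℝ) : ∀ (m : ℕ) (l : Fin m → ι → ℝ) (f : MvPolynomial ι ℝ),
    iterDeriv m l (C r * f) = C r * iterDeriv m l f
  | 0, _, _ => rfl
  | m + 1, l, f => by simp only [iterDeriv, dirDeriv_C_mul, iterDeriv_C_mul r m]

lemma dirDeriv_prod_X (a : ι → ℝ) (S : Finset ι) :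
    dirDeriv a (∏ i ∈ S, X i) = ∑ i ∈ S, C (a i) * ∏ k ∈ S.erase i, X k := by
  have key : ∀ (T : Finset ι) (k : ι), pderiv k (∏ i ∈ T, (X i : MvPolynomial ι ℝ)) =
      if k ∈ T then ∏ i ∈ T.erase k, X i else 0 := by
    intro T k
    split_ifs with hk
    · rw [← Finset.mul_prod_erase T _ hk, Derivation.leibniz, pderiv_X_self,
        pderiv_eq_zero_of_notMem_vars]
      · simp
      · intro hv
        have := vars_prod (fun i => (X i : MvPolynomial ι ℝ)) hv
        simp [vars_X] at this
    · refine pderiv_eq_zero_of_notMem_vars fun hv => hk ?_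
      have := vars_prod (fun i => (X i : MvPolynomial ι ℝ)) hv
      simpa [vars_X] using this
  simp only [dirDeriv, key, mul_ite, mul_zero]
  rw [Finset.sum_ite_mem, Finset.univ_inter]

/-- Iterated derivatives of a product of distinct variables are permanents. -/
lemma iterDeriv_prod_X : ∀ (m : ℕ) (l : Fin m → ι → ℝ) (S : Finset ι), S.card = m →
    iterDeriv m l (∏ i ∈ S, X i) =
      C (∑ p : Fin m → ι, if Function.Injective p ∧ ∀ j, p j ∈ S then ∏ j, l j (p j) else 0) := by
  intro m
  induction m with
  | zero =>
    intro l S hS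
    rw [Finset.card_eq_zero] at hS
    subst hS
    simp [iterDeriv, Function.injective_of_subsingleton]
  | succ m ih =>
    intro l S hS
    rw [iterDeriv, dirDeriv_prod_X, iterDeriv_sum]
    have h1 : ∀ i ∈ S, iterDeriv m (fun j => l j.succ) (C (l 0 i) * ∏ k ∈ S.erase i, X k) =
        C (l 0 i * ∑ p : Fin m → ι, if Function.Injective p ∧ ∀ j, p j ∈ S.erase i then
          ∏ j, l j.succ (p j) else 0) := by
      intro i hi
      rw [iterDeriv_C_mul, ih _ _ (by rw [Finset.card_erase_of_mem hi, hS]; rfl), C_mul]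
    rw [Finset.sum_congr rfl h1, ← map_sum]
    congr 1
    rw [← (Fin.consEquiv (fun _ : Fin (m + 1) => ι)).sum_comp, Fintype.sum_prod_type,
      ← Finset.sum_subset (Finset.subset_univ S)]
    · refine Finset.sum_congr rfl fun i hi => ?_
      rw [Finset.mul_sum]
      refine Finset.sum_congr rfl fun p _ => ?_
      simp only [Fin.consEquiv_apply, Fin.forall_fin_succ, Fin.cons_zero,
        Fin.cons_succ, Fin.prod_univ_succ, Finset.mem_erase]
      rw [mul_ite, mul_zero]
      refine if_congr ?_ rfl rfl
      refine Iff.trans ?_ (and_congr (Fin.cons_injective_iff (x₀ := i) (x := p)).symm Iff.rfl)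
      rw [Set.mem_range, not_exists]
      constructor
      · rintro ⟨h1, h2⟩; exact ⟨⟨fun j => (h2 j).1, h1⟩, hi, fun j => (h2 j).2⟩
      · rintro ⟨⟨h1, h2⟩, _, h3⟩; exact ⟨h2, fun j => ⟨h1 j, h3 j⟩⟩
    · intro i _ hi
      refine Finset.sum_eq_zero fun p _ => if_neg ?_
      rintro ⟨_, h⟩
      exact hi (by simpa using h 0)

lemma hStable_prod_X : HStable (Fintype.card ι) (∏ i : ι, X i) := by
  refine ⟨?_, fun w hw => ?_, fun w hw => ?_⟩
  · have := IsHomogeneous.prod (Finset.univ : Finset ι) (fun i => (X i : MvPolynomial ι ℝ))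
      (fun _ => 1) (fun i _ => isHomogeneous_X ℝ i)
    simpa using this
  · rw [map_prod]
    refine Finset.prod_ne_zero_iff.2 fun i _ h => ?_
    rw [aeval_X] at h
    have := hw i
    rw [h] at this
    simp at this
  · rw [map_prod]
    exact Finset.prod_pos fun i _ => by simpa using hw i

/-- A lower bound for the permanent of a positive doubly stochastic matrix. -/
lemma exp_neg_le_sum_prod {n : ℕ} (M : Fin n → Fin n → ℝ) (hpos : ∀ j i, 0 < M j i)
    (hrow : ∀ j, ∑ i, M j i = 1) (hcol : ∀ i, ∑ j, M j i = 1) :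
    Real.exp (-n) ≤ ∑ p : Fin n → Fin n, if Function.Injective p then ∏ j, M j (p j) else 0 := by
  have h := hStable_prod_X (ι := Fin n)
  rw [Fintype.card_fin] at h
  have h1 := h.le_iterDeriv n _ M hpos 1 one_pos (by
    intro t ht
    rw [map_prod, one_mul]
    simp only [aeval_X]
    have h2 : ∀ i ∈ Finset.univ, ∏ j, t j ^ M j i ≤ ∑ j, t j * M j i := by
      intro i _
      have := Real.geom_mean_le_arith_mean_weighted Finset.univ (fun j => M j i) t
        (fun j _ => (hpos j i).le) (hcol i) (fun j _ => (ht j).le)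
      simpa [mul_comm] using this
    refine le_trans (le_of_eq ?_) (Finset.prod_le_prod (fun i _ => ?_) h2)
    · rw [Finset.prod_comm]
      refine Finset.prod_congr rfl fun j _ => ?_
      rw [← Real.rpow_sum_of_pos (ht j), hrow, Real.rpow_one]
    · exact Finset.prod_nonneg fun j _ => (Real.rpow_pos_of_pos (ht j) _).le)
  rw [iterDeriv_prod_X _ _ _ (by simp), aeval_C, one_mul] at h1
  simpa using h1

lemma sysCount_eq_sum {n : ℕ} (A : Fin n → Finset (Fin n)) :
    (sysCount A : ℝ) = ∑ p : Fin n → Fin n, if Function.Injective p then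
      ∏ j, (if p j ∈ A j then (1 : ℝ) else 0) else 0 := by
  have h1 : ∀ p : Fin n → Fin n, (if Function.Injective p then
      ∏ j, (if p j ∈ A j then (1 : ℝ) else 0) else 0) =
      if Function.Injective p ∧ ∀ j, p j ∈ A j then 1 else 0 := by
    intro p
    by_cases hp : Function.Injective p
    · simp only [hp, if_true, true_and]
      rw [Finset.prod_ite_zero]; simp
    · simp [hp]
  rw [Finset.sum_congr rfl fun p _ => h1 p, Finset.sum_boole]
  norm_cast
  refine Finset.card_bij (fun σ _ => (σ : Fin n → Fin n)) ?_ ?_ ?_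
  · intro σ hσ
    simpa [σ.injective] using hσ
  · intro σ _ τ _ h
    exact DFunLike.coe_injective h
  · intro p hp
    simp only [Finset.mem_filter, Finset.mem_univ, true_and] at hp
    exact ⟨Equiv.ofBijective p (Finite.injective_iff_bijective.1 hp.1), by simpa using hp.2, rfl⟩

/-- **The van der Waerden bound** for `0`-`1` matrices, up to a polynomial factor. -/
theorem le_sysCount {n : ℕ} (k : ℕ) (hk : 0 < k) (A : Fin n → Finset (Fin n))
    (hrow : ∀ j, (A j).card = k) (hcol : ∀ i, (Finset.univ.filter fun j => i ∈ A j).card = k) :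
    (k * Real.exp (-1)) ^ n ≤ sysCount A := by
  rcases Nat.eq_zero_or_pos n with rfl | hn
  · have : sysCount A = 1 := by
      rw [sysCount, Finset.filter_true_of_mem (by intro σ _ i; exact i.elim0)]
      simp
    simp [this]
  have hk' : (0 : ℝ) < k := by exact_mod_cast hk
  have hn' : (0 : ℝ) < n := by exact_mod_cast hn
  let M : ℝ → Fin n → Fin n → ℝ := fun ε j i =>
    (1 - ε) * ((if i ∈ A j then (1 : ℝ) else 0) / k) + ε / n
  let F : ℝ → ℝ := fun ε => ∑ p : Fin n → Fin n,
    if Function.Injective p then ∏ j, M ε j (p j) else 0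
  have hF : ∀ ε ∈ Set.Ioo (0 : ℝ) 1, Real.exp (-n) ≤ F ε := by
    intro ε hε
    refine exp_neg_le_sum_prod (M ε) (fun j i => ?_) (fun j => ?_) (fun i => ?_)
    · have h1 : 0 ≤ (1 - ε) * ((if i ∈ A j then (1 : ℝ) else 0) / k) := by
        have := hε.2
        apply mul_nonneg
        · linarith
        · split_ifs <;> positivity
      have h2 : 0 < ε / n := div_pos hε.1 hn'
      exact add_pos_of_nonneg_of_pos h1 h2
    · simp only [M]
      rw [Finset.sum_add_distrib, ← Finset.mul_sum, ← Finset.sum_div, Finset.sum_boole]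
      simp only [Finset.filter_univ_mem, hrow, Finset.sum_const, Finset.card_univ,
        Fintype.card_fin, nsmul_eq_mul]
      field_simp
      ring
    · simp only [M]
      rw [Finset.sum_add_distrib, ← Finset.mul_sum, ← Finset.sum_div, Finset.sum_boole, hcol]
      simp only [Finset.sum_const, Finset.card_univ, Fintype.card_fin, nsmul_eq_mul]
      field_simp
      ring
  have hcont : Continuous F := by
    refine continuous_finsetSum _ fun p _ => ?_
    split_ifs
    · fun_prop
    · exact continuous_const
  have h0 : Real.exp (-n) ≤ F 0 := by
    refine ge_of_tendsto ((hcont.tendsto 0).mono_left (nhdsWithin_le_nhds (s := Set.Ioi 0))) ?_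
    filter_upwards [Ioo_mem_nhdsGT (zero_lt_one' ℝ)] with ε hε using hF ε hε
  have h1 : (sysCount A : ℝ) = k ^ n * F 0 := by
    rw [sysCount_eq_sum, Finset.mul_sum]
    refine Finset.sum_congr rfl fun p _ => ?_
    split_ifs
    · simp only [M, sub_zero, one_mul, zero_div, add_zero, Finset.prod_div_distrib,
        Finset.prod_const, Finset.card_univ, Fintype.card_fin]
      field_simp
    · simp
  rw [h1, mul_pow, ← Real.exp_nat_mul]
  have : (n : ℝ) * -1 = -n := by ring
  rw [this]
  gcongr

end Stable

/-- The permutations `g d`, one for each colour `d`, are pairwise disjoint. -/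
def IsRows {n : ℕ} (g : Fin n → Equiv.Perm (Fin n)) : Prop :=
  ∀ i d e, g d i = g e i → d = e

/-- The possible values of `g d i` given the rows that precede `d` in the order `τ`. -/
def avail {n : ℕ} (τ : Fin n ≃ Fin n) (g : Fin n → Equiv.Perm (Fin n)) (d i : Fin n) :
    Finset (Fin n) :=
  Finset.univ.filter fun j => ∀ d', τ d' < τ d → g d' i ≠ j

lemma card_avail {n : ℕ} (τ : Fin n ≃ Fin n) {g : Fin n → Equiv.Perm (Fin n)} (hg : IsRows g)
    (d i : Fin n) : (avail τ g d i).card = n - (τ d : ℕ) := by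
  have h1 : avail τ g d i =
      ((Finset.univ.filter fun d' => τ d' < τ d).image fun d' => g d' i)ᶜ := by
    ext j; simp [avail]
  have h2 : (Finset.univ.filter fun d' => τ d' < τ d).card = τ d := by
    rw [← Finset.card_map τ.toEmbedding]
    rw [show (Finset.univ.filter fun d' => τ d' < τ d).map τ.toEmbedding = Finset.Iio (τ d) by
      ext t
      simp only [Finset.mem_map_equiv, Finset.mem_filter, Finset.mem_univ, true_and,
        Equiv.apply_symm_apply, Finset.mem_Iio]]
    simp
  rw [h1, Finset.card_compl, Fintype.card_fin, Finset.card_image_of_injOn, h2]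
  intro a _ b _ h
  exact hg i a b h

lemma IsRows.mem_avail {n : ℕ} (τ : Fin n ≃ Fin n) {g : Fin n → Equiv.Perm (Fin n)}
    (hg : IsRows g) (d i : Fin n) : g d i ∈ avail τ g d i := by
  simp only [avail, Finset.mem_filter, Finset.mem_univ, true_and]
  intro d' hd' h
  rw [hg i d' d h] at hd'
  exact lt_irrefl _ hd'

/-- The product of the bounds of Brégman's theorem for the successive rows of a Latin square. -/
def rowBase (n : ℕ) : ℝ := ∏ t : Fin n, Real.exp (n * logFactMean (n - (t : ℕ)))

lemma rowBase_pos (n : ℕ) : 0 < rowBase n := Finset.prod_pos fun _ _ => Real.exp_pos _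

/-- A finite set of functions has at most as many elements as the product of the bounds on the
number of ways to extend by one more value. -/
lemma card_le_prod_of_extension {n : ℕ} {α : Type} (τ : Fin n ≃ Fin n)
    (S : Finset (Fin n → α)) (b : Fin n → ℝ) (hb : ∀ d, 0 ≤ b d)
    (h : ∀ d, ∀ g ∈ S, (((S.filter fun g' => ∀ d', τ d' < τ d → g' d' = g d').image
      fun g' => g' d).card : ℝ) ≤ b d) : (S.card : ℝ) ≤ ∏ d, b d := by
  let res : ℕ → (Fin n → α) → Fin n → Option α :=
    fun t g d => if (τ d : ℕ) < t then some (g d) else none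
  have hres : ∀ t g g', res t g = res t g' ↔ ∀ d, (τ d : ℕ) < t → g d = g' d := by
    intro t g g'
    constructor
    · intro e d hd
      have := congrFun e d
      simpa [res, hd] using this
    · intro e
      funext d
      by_cases hd : (τ d : ℕ) < t
      · simp [res, hd, e d hd]
      · simp [res, hd]
  have key : ∀ t : ℕ, t ≤ n → ((S.image (res t)).card : ℝ) ≤
      ∏ d ∈ Finset.univ.filter (fun d => (τ d : ℕ) < t), b d := by
    intro t
    induction t with
    | zero =>
      intro _
      have : (S.image (res 0)).card ≤ 1 := by
        rw [Finset.card_le_one]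
        intro x hx y hy
        obtain ⟨g, _, rfl⟩ := Finset.mem_image.1 hx
        obtain ⟨g', _, rfl⟩ := Finset.mem_image.1 hy
        rw [hres]; simp
      simpa using this
    | succ t ih =>
      intro ht
      let d₀ : Fin n := τ.symm ⟨t, ht⟩
      have hd₀ : (τ d₀ : ℕ) = t := by simp [d₀]
      have hfil : Finset.univ.filter (fun d => (τ d : ℕ) < t + 1) =
          insert d₀ (Finset.univ.filter fun d => (τ d : ℕ) < t) := by
        ext d
        simp only [Finset.mem_filter, Finset.mem_univ, true_and, Finset.mem_insert]
        constructor
        · intro hd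
          by_cases hlt : (τ d : ℕ) < t
          · exact Or.inr hlt
          · left
            apply τ.injective
            apply Fin.ext
            omega
        · rintro (rfl | hd)
          · omega
          · omega
      rw [hfil, Finset.prod_insert (by simp [hd₀])]
      let pr : (Fin n → Option α) → Fin n → Option α :=
        fun r d => if (τ d : ℕ) < t then r d else none
      have hpr : ∀ g, pr (res (t + 1) g) = res t g := by
        intro g
        funext d
        by_cases hd : (τ d : ℕ) < t
        · simp [pr, res, hd, hd.le]
        · simp [pr, res, hd]
      have hmaps : ∀ r ∈ S.image (res (t + 1)), pr r ∈ S.image (res t) := by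
        intro r hr
        obtain ⟨g, hg, rfl⟩ := Finset.mem_image.1 hr
        rw [hpr]
        exact Finset.mem_image_of_mem _ hg
      rw [Finset.card_eq_sum_card_fiberwise hmaps]
      push_cast
      calc _ ≤ ∑ r ∈ S.image (res t), b d₀ := by
            refine Finset.sum_le_sum fun r hr => ?_
            obtain ⟨g, hg, rfl⟩ := Finset.mem_image.1 hr
            refine le_trans ?_ (h d₀ g hg)
            norm_cast
            refine Finset.card_le_card_of_surjOn
              (fun x d => if d = d₀ then some x else res t g d) ?_
            intro r hr
            simp only [Finset.coe_filter, Finset.mem_image, Set.mem_ofPred_eq] at hr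
            obtain ⟨⟨g', hg', rfl⟩, hr2⟩ := hr
            rw [hpr, hres] at hr2
            refine ⟨g' d₀, ?_, ?_⟩
            · simp only [Finset.coe_image, Finset.coe_filter, Set.mem_image, Set.mem_ofPred_eq]
              refine ⟨g', ⟨hg', fun d' hd' => hr2 d' ?_⟩, rfl⟩
              have : (τ d' : ℕ) < τ d₀ := hd'
              omega
            · funext d
              by_cases hd : d = d₀
              · subst hd
                simp [res, hd₀]
              · have hne : (τ d : ℕ) ≠ t := fun e => hd (τ.injective (Fin.ext (by omega)))
                by_cases hlt : (τ d : ℕ) < t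
                · simp [res, hd, hlt, Nat.lt_succ_of_lt hlt, hr2 d hlt]
                · have : ¬ (τ d : ℕ) < t + 1 := by omega
                  simp [res, hd, hlt, this]
        _ = b d₀ * (S.image (res t)).card := by simp [mul_comm]
        _ ≤ _ := mul_le_mul_of_nonneg_left (ih (by omega)) (hb _)
  have h1 := key n le_rfl
  rw [Finset.filter_true_of_mem (fun d _ => (τ d).2), Finset.card_image_of_injective] at h1
  · exact h1
  · intro g g' e
    funext d
    exact (hres n g g').1 e d (τ d).2

/-- The number of systems of disjoint rows in which at least `s` of the rows in `D` are bad, when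
badness of a row depends only on it and on preceding rows, and any row is bad with relative
probability at most `q`. -/
lemma card_bad_rows_le {n : ℕ} (τ : Fin n ≃ Fin n) (D : Finset (Fin n))
    (bad : Fin n → (Fin n → Equiv.Perm (Fin n)) → Equiv.Perm (Fin n) → Prop)
    (hdep : ∀ d ∈ D, ∀ g g' : Fin n → Equiv.Perm (Fin n), (∀ d', τ d' < τ d → g' d' = g d') →
      ∀ σ, bad d g' σ → bad d g σ)
    (q : ℝ) (hq : 0 ≤ q)
    (hrow : ∀ d ∈ D, ∀ g, IsRows g → ((Finset.univ.filter fun σ : Equiv.Perm (Fin n) =>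
      (∀ i, σ i ∈ avail τ g d i) ∧ bad d g σ).card : ℝ) ≤
        Real.exp (n * logFactMean (n - (τ d : ℕ))) * q) (s : ℕ) :
    ((Finset.univ.filter fun g : Fin n → Equiv.Perm (Fin n) => IsRows g ∧
      s ≤ (D.filter fun d => bad d g (g d)).card).card : ℝ) ≤ 2 ^ n * (rowBase n * q ^ s) := by
  have hsub : (Finset.univ.filter fun g : Fin n → Equiv.Perm (Fin n) => IsRows g ∧
      s ≤ (D.filter fun d => bad d g (g d)).card) ⊆
      (D.powersetCard s).biUnion fun B => Finset.univ.filter fun g => IsRows g ∧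
        ∀ d ∈ B, bad d g (g d) := by
    intro g hg
    simp only [Finset.mem_filter, Finset.mem_univ, true_and] at hg
    obtain ⟨B, hB, hBc⟩ := Finset.exists_subset_card_eq hg.2
    simp only [Finset.mem_biUnion, Finset.mem_powersetCard, Finset.mem_filter, Finset.mem_univ,
      true_and]
    exact ⟨B, ⟨hB.trans (Finset.filter_subset _ _), hBc⟩, hg.1,
      fun d hd => (Finset.mem_filter.1 (hB hd)).2⟩
  have hB : ∀ B ∈ D.powersetCard s, ((Finset.univ.filter fun g : Fin n → Equiv.Perm (Fin n) =>
      IsRows g ∧ ∀ d ∈ B, bad d g (g d)).card : ℝ) ≤ rowBase n * q ^ s := by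
    intro B hB
    obtain ⟨hBD, hBs⟩ := Finset.mem_powersetCard.1 hB
    refine (card_le_prod_of_extension τ _ (fun d => Real.exp (n * logFactMean (n - (τ d : ℕ))) *
      if d ∈ B then q else 1) (fun d => ?_) ?_).trans (le_of_eq ?_)
    · split_ifs <;> positivity
    · intro d g hg
      have hgr := (Finset.mem_filter.1 hg).2.1
      have hav : ∀ g' : Fin n → Equiv.Perm (Fin n), (∀ d', τ d' < τ d → g' d' = g d') →
          ∀ i, avail τ g' d i = avail τ g d i := by
        intro g' hg' i
        ext j
        simp only [avail, Finset.mem_filter, Finset.mem_univ, true_and]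
        refine forall_congr' fun d' => forall_congr' fun hd' => ?_
        rw [hg' d' hd']
      split_ifs with hd
      · refine le_trans ?_ (hrow d (hBD hd) g hgr)
        norm_cast
        refine Finset.card_le_card fun σ hσ => ?_
        simp only [Finset.mem_image] at hσ
        obtain ⟨g', hg', rfl⟩ := hσ
        simp only [Finset.mem_filter, Finset.mem_univ, true_and] at hg' ⊢
        refine ⟨fun i => ?_, hdep d (hBD hd) g g' hg'.2 _ (hg'.1.2 d hd)⟩
        rw [← hav g' hg'.2]
        exact hg'.1.1.mem_avail τ d i
      · rw [mul_one]
        have h1 := sysCount_le_exp n (fun i => avail τ g d i) (by simp)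
        simp only [card_avail τ hgr, Finset.sum_const, Finset.card_univ, Fintype.card_fin,
          nsmul_eq_mul] at h1
        refine le_trans ?_ h1
        rw [sysCount]
        norm_cast
        refine Finset.card_le_card fun σ hσ => ?_
        simp only [Finset.mem_image] at hσ
        obtain ⟨g', hg', rfl⟩ := hσ
        simp only [Finset.mem_filter, Finset.mem_univ, true_and] at hg' ⊢
        intro i
        rw [← hav g' hg'.2]
        exact hg'.1.1.mem_avail τ d i
    · rw [Finset.prod_mul_distrib, Finset.prod_ite_mem, Finset.univ_inter, Finset.prod_const, hBs,
        rowBase, ← τ.prod_comp fun t => Real.exp (n * logFactMean (n - (t : ℕ)))]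
  calc _ ≤ (((D.powersetCard s).biUnion fun B => Finset.univ.filter fun g => IsRows g ∧
        ∀ d ∈ B, bad d g (g d)).card : ℝ) := by exact_mod_cast Finset.card_le_card hsub
    _ ≤ ∑ B ∈ D.powersetCard s, ((Finset.univ.filter fun g : Fin n → Equiv.Perm (Fin n) =>
        IsRows g ∧ ∀ d ∈ B, bad d g (g d)).card : ℝ) := by exact_mod_cast Finset.card_biUnion_le
    _ ≤ ∑ B ∈ D.powersetCard s, rowBase n * q ^ s := Finset.sum_le_sum hB
    _ = (D.powersetCard s).card * (rowBase n * q ^ s) := by simp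
    _ ≤ _ := by
      have h1 : (D.powersetCard s).card ≤ 2 ^ n := by
        refine (Finset.card_le_card (fun B hB => Finset.mem_powerset.2
          (Finset.mem_powersetCard.1 hB).1 : D.powersetCard s ⊆ D.powerset)).trans ?_
        rw [Finset.card_powerset]
        exact Nat.pow_le_pow_right (by norm_num) (by simpa using Finset.card_le_univ D)
      have h2 : 0 ≤ rowBase n * q ^ s := mul_nonneg (rowBase_pos n).le (pow_nonneg hq s)
      refine mul_le_mul_of_nonneg_right ?_ h2
      exact_mod_cast h1

lemma logFactMean_le_log (r : ℕ) : logFactMean r ≤ Real.log r := by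
  rcases Nat.eq_zero_or_pos r with rfl | hr
  · simp [logFactMean]
  have h0 : (0 : ℝ) < r := by exact_mod_cast hr
  rw [logFactMean, div_le_iff₀ h0, mul_comm, ← Real.log_pow]
  refine Real.log_le_log (by exact_mod_cast Nat.factorial_pos r) ?_
  exact_mod_cast Nat.factorial_le_pow r

lemma log_sub_one_le_logFactMean {r : ℕ} (hr : 0 < r) : Real.log r - 1 ≤ logFactMean r := by
  have h0 : (0 : ℝ) < r := by exact_mod_cast hr
  have hf : (0 : ℝ) < (Nat.factorial r : ℝ) := by exact_mod_cast Nat.factorial_pos r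
  have h1 := Real.pow_div_factorial_le_exp (r : ℝ) h0.le r
  have h2 := Real.log_le_log (by positivity) h1
  rw [Real.log_exp, Real.log_div (by positivity) hf.ne', Real.log_pow] at h2
  rw [logFactMean, le_div_iff₀ h0]
  linarith

lemma log_factorial_le {r : ℕ} (hr : 0 < r) :
    Real.log (Nat.factorial r : ℝ) ≤ r * Real.log r - r + 1 + Real.log r := by
  induction r, hr using Nat.le_induction with
  | base => simp
  | succ r hr ih =>
    have h0 : (0 : ℝ) < r := by exact_mod_cast hr
    have hf : (0 : ℝ) < (Nat.factorial r : ℝ) := by exact_mod_cast Nat.factorial_pos r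
    rw [Nat.factorial_succ]
    push_cast
    rw [Real.log_mul (by positivity) hf.ne']
    have h1 := Real.log_le_sub_one_of_pos (show (0 : ℝ) < r / (r + 1) by positivity)
    rw [Real.log_div h0.ne' (by positivity)] at h1
    have h2 : ((r : ℝ) + 1) * (Real.log r - Real.log (r + 1)) ≤ (r + 1) * (r / (r + 1) - 1) :=
      mul_le_mul_of_nonneg_left h1 (by positivity)
    have h3 : ((r : ℝ) + 1) * (r / (r + 1) - 1) = -1 := by field_simp; ring
    nlinarith

lemma logFactMean_le {r : ℕ} (hr : 0 < r) :
    logFactMean r ≤ Real.log r - 1 + (1 + Real.log r) / r := by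
  have h0 : (0 : ℝ) < r := by exact_mod_cast hr
  have h1 := log_factorial_le hr
  rw [logFactMean, div_le_iff₀ h0]
  have : (Real.log r - 1 + (1 + Real.log r) / r) * r = r * Real.log r - r + 1 + Real.log r := by
    field_simp; ring
  linarith

lemma logFactMean_mono : Monotone logFactMean := by
  refine monotone_nat_of_le_succ fun r => ?_
  have h0 : (0 : ℝ) < (r : ℝ) + 1 := by positivity
  have h1 : (r + 1 : ℝ) * logFactMean (r + 1) = Real.log (r + 1) + r * logFactMean r := by
    have a := natCast_mul_logFactMean (r + 1)
    have b := natCast_mul_logFactMean r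
    have hf : (0 : ℝ) < (Nat.factorial r : ℝ) := by exact_mod_cast Nat.factorial_pos r
    rw [Nat.factorial_succ] at a
    push_cast at a
    rw [Real.log_mul h0.ne' hf.ne'] at a
    rw [a, b]
  have h2 : logFactMean r ≤ Real.log (r + 1) := by
    refine (logFactMean_le_log r).trans ?_
    rcases Nat.eq_zero_or_pos r with rfl | hr
    · simp
    · exact Real.log_le_log (by exact_mod_cast hr) (by linarith)
  nlinarith

lemma card_le_sysCount {ι κ : Type} [Fintype ι] [Fintype κ] {A : ι → Finset κ}
    {S : Finset (ι ≃ κ)} (h : ∀ σ ∈ S, ∀ i, σ i ∈ A i) : S.card ≤ sysCount A :=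
  Finset.card_le_card fun σ hσ => by
    simp only [Finset.mem_filter, Finset.mem_univ, true_and]
    exact h σ hσ

/-- If many of the rows have a smaller set of allowed values, there are fewer permutations. -/
lemma sysCount_le_of_card_le_sub {n k s : ℕ} (A : Fin n → Finset (Fin n)) (W : Finset (Fin n))
    (hn : 0 < n) (hk : n ≤ 2 * k) (hkn : k ≤ n) (hs : 2 * s ≤ k) (hA : ∀ i, (A i).card ≤ k)
    (hW : ∀ i ∈ W, (A i).card + s ≤ k) :
    (sysCount A : ℝ) ≤ Real.exp (n * logFactMean k) *
      Real.exp (-(W.card * s / n) + 4 * (1 + Real.log n)) := by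
  have hk0 : 0 < k := by omega
  have hn' : (0 : ℝ) < n := by exact_mod_cast hn
  have hk' : (0 : ℝ) < k := by exact_mod_cast hk0
  have hks : 0 < k - s := by omega
  have hks' : (0 : ℝ) < (k : ℝ) - s := by
    have : s < k := by omega
    have : (s : ℝ) < k := by exact_mod_cast this
    linarith
  have hcast : ((k - s : ℕ) : ℝ) = (k : ℝ) - s := by
    rw [Nat.cast_sub (by omega)]
  have hlogn : 0 ≤ Real.log n := Real.log_natCast_nonneg n
  have hd : logFactMean (k - s) ≤ logFactMean k - s / n + 4 * (1 + Real.log n) / n := by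
    have h1 := logFactMean_le hks
    have h2 := log_sub_one_le_logFactMean hk0
    have h3 : Real.log ((k : ℝ) - s) - Real.log k ≤ - (s / n) := by
      rw [← Real.log_div hks'.ne' hk'.ne']
      refine (Real.log_le_sub_one_of_pos (by positivity)).trans ?_
      rw [sub_div, div_self hk'.ne']
      have : (s : ℝ) / n ≤ s / k :=
        div_le_div_of_nonneg_left (by positivity) hk' (by exact_mod_cast hkn)
      linarith
    have h4 : (1 + Real.log ((k : ℝ) - s)) / ((k : ℝ) - s) ≤ 4 * (1 + Real.log n) / n := by
      rw [div_le_div_iff₀ hks' hn']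
      have a : Real.log ((k : ℝ) - s) ≤ Real.log n := by
        refine Real.log_le_log hks' ?_
        have : (k : ℝ) ≤ n := by exact_mod_cast hkn
        have : (0 : ℝ) ≤ s := by positivity
        linarith
      have b : (n : ℝ) ≤ 4 * ((k : ℝ) - s) := by
        rw [← hcast]
        have : n ≤ 4 * (k - s) := by omega
        exact_mod_cast this
      calc (1 + Real.log ((k : ℝ) - s)) * n ≤ (1 + Real.log n) * n := by gcongr
        _ ≤ (1 + Real.log n) * (4 * ((k : ℝ) - s)) := by gcongr
        _ = _ := by ring
    rw [hcast] at h1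
    linarith
  refine (sysCount_le_exp n A (by simp)).trans ?_
  rw [← Real.exp_add, Real.exp_le_exp]
  have hsum : ∑ i, logFactMean (A i).card ≤
      ∑ i : Fin n, (logFactMean k +
          if i ∈ W then (-(s / n : ℝ) + 4 * (1 + Real.log n) / n) else 0) := by
    refine Finset.sum_le_sum fun i _ => ?_
    split_ifs with hi
    · have := hW i hi
      have h1 : logFactMean (A i).card ≤ logFactMean (k - s) := logFactMean_mono (by omega)
      linarith
    · simpa using logFactMean_mono (hA i)
  refine hsum.trans ?_
  rw [Finset.sum_add_distrib, Finset.sum_ite_mem, Finset.univ_inter]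
  simp only [Finset.sum_const, Finset.card_univ, Fintype.card_fin, nsmul_eq_mul]
  have hWn : (W.card : ℝ) ≤ n := by exact_mod_cast (by simpa using Finset.card_le_univ W)
  have h5 : (W.card : ℝ) * (4 * (1 + Real.log n) / n) ≤ 4 * (1 + Real.log n) := by
    calc _ ≤ (n : ℝ) * (4 * (1 + Real.log n) / n) := by gcongr
      _ = _ := by field_simp
  have h6 : (W.card : ℝ) * (-(s / n) + 4 * (1 + Real.log n) / n) =
      -(W.card * s / n) + W.card * (4 * (1 + Real.log n) / n) := by ring
  linarith

/-- Few permutations meet many of a family of small sets. -/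
lemma card_filter_hits_le {n k f m a : ℕ} (A F : Fin n → Finset (Fin n))
    (hn : 0 < n) (hk : n ≤ 2 * k) (hA : ∀ i, (A i).card ≤ k)
    (hF : ∀ i, (F i).card ≤ f) (hf : 6 * 2 ^ a * f ≤ n) :
    ((Finset.univ.filter fun σ : Equiv.Perm (Fin n) => (∀ i, σ i ∈ A i) ∧
      m ≤ (Finset.univ.filter fun i => σ i ∈ F i).card).card : ℝ) ≤
      Real.exp (n * logFactMean k) * (2 ^ n * (1 / 2) ^ (a * m)) := by
  have hk0 : 0 < k := by omega
  have hn' : (0 : ℝ) < n := by exact_mod_cast hn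
  have hk' : (0 : ℝ) < k := by exact_mod_cast hk0
  have hsub : (Finset.univ.filter fun σ : Equiv.Perm (Fin n) => (∀ i, σ i ∈ A i) ∧
      m ≤ (Finset.univ.filter fun i => σ i ∈ F i).card) ⊆
      ((Finset.univ : Finset (Fin n)).powersetCard m).biUnion fun I =>
        Finset.univ.filter fun σ : Equiv.Perm (Fin n) =>
          ∀ i, σ i ∈ if i ∈ I then A i ∩ F i else A i := by
    intro σ hσ
    simp only [Finset.mem_filter, Finset.mem_univ, true_and] at hσ
    obtain ⟨I, hI, hIc⟩ := Finset.exists_subset_card_eq hσ.2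
    simp only [Finset.mem_biUnion, Finset.mem_powersetCard, Finset.mem_filter, Finset.mem_univ,
      true_and]
    refine ⟨I, ⟨Finset.subset_univ _, hIc⟩, fun i => ?_⟩
    split_ifs with hi
    · exact Finset.mem_inter.2 ⟨hσ.1 i, (Finset.mem_filter.1 (hI hi)).2⟩
    · exact hσ.1 i
  have hI : ∀ I ∈ (Finset.univ : Finset (Fin n)).powersetCard m,
      ((Finset.univ.filter fun σ : Equiv.Perm (Fin n) =>
          ∀ i, σ i ∈ if i ∈ I then A i ∩ F i else A i).card : ℝ) ≤
      Real.exp (n * logFactMean k) * (1 / 2) ^ (a * m) := by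
    intro I hI
    have hIm := (Finset.mem_powersetCard.1 hI).2
    rcases Nat.eq_zero_or_pos f with rfl | hf0
    · rcases Finset.eq_empty_or_nonempty I with rfl | ⟨i, hi⟩
      · have hm0 : m = 0 := by simpa using hIm.symm
        subst hm0
        simp only [Finset.notMem_empty, if_false, mul_zero, pow_zero, mul_one]
        refine le_trans (Nat.cast_le.2 (card_le_sysCount fun σ hσ => (Finset.mem_filter.1 hσ).2))
          ((sysCount_le_exp n A (by simp)).trans ?_)
        rw [Real.exp_le_exp]
        refine (Finset.sum_le_sum fun i _ => logFactMean_mono (hA i)).trans (le_of_eq ?_)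
        simp
      · have : (Finset.univ.filter fun σ : Equiv.Perm (Fin n) =>
          ∀ i, σ i ∈ if i ∈ I then A i ∩ F i else A i) = ∅ := by
          refine Finset.filter_false_of_mem fun σ _ h => ?_
          have h1 := h i
          rw [if_pos hi, Finset.card_eq_zero.1 (Nat.le_zero.1 (hF i))] at h1
          simp at h1
        rw [this]
        simp only [Finset.card_empty, Nat.cast_zero]
        positivity
    · have hd : logFactMean f ≤ logFactMean k - a * Real.log 2 := by
        have h1 := logFactMean_le_log f
        have h2 := log_sub_one_le_logFactMean hk0
        have h3 : Real.log f + a * Real.log 2 + 1 ≤ Real.log k := by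
          have e : Real.log f + a * Real.log 2 + 1 = Real.log (f * 2 ^ a * Real.exp 1) := by
            rw [Real.log_mul (by positivity) (Real.exp_pos 1).ne', Real.log_mul (by positivity)
              (by positivity), Real.log_pow, Real.log_exp]
          rw [e]
          refine Real.log_le_log (by positivity) ?_
          have h4 : (f : ℝ) * 2 ^ a * 3 ≤ k := by
            have : f * 2 ^ a * 3 ≤ k := by
              have : 6 * 2 ^ a * f = 2 * (f * 2 ^ a * 3) := by ring
              omega
            exact_mod_cast this
          have h5 : Real.exp 1 ≤ 3 := by linarith [Real.exp_one_lt_d9]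
          have h6 : (0 : ℝ) ≤ f * 2 ^ a := by positivity
          nlinarith
        linarith
      refine le_trans (Nat.cast_le.2 (card_le_sysCount fun σ hσ => (Finset.mem_filter.1 hσ).2))
        ((sysCount_le_exp n (fun i => if i ∈ I then A i ∩ F i else A i) (by simp)).trans ?_)
      have e2 : ((1 : ℝ) / 2) ^ (a * m) = Real.exp (-(a * m * Real.log 2)) := by
        rw [Real.exp_neg, one_div, inv_pow, show (a * m * Real.log 2 : ℝ) =
          ((a * m : ℕ) : ℝ) * Real.log 2 by push_cast; ring, Real.exp_nat_mul,
          Real.exp_log (by norm_num)]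
      rw [e2, ← Real.exp_add, Real.exp_le_exp]
      have hsum : ∑ i, logFactMean (if i ∈ I then A i ∩ F i else A i).card ≤
          ∑ i : Fin n, (logFactMean k + if i ∈ I then (-(a * Real.log 2)) else 0) := by
        refine Finset.sum_le_sum fun i _ => ?_
        split_ifs with hi
        · have h1 : logFactMean (A i ∩ F i).card ≤ logFactMean f :=
            logFactMean_mono ((Finset.card_le_card Finset.inter_subset_right).trans (hF i))
          linarith
        · simpa using logFactMean_mono (hA i)
      refine hsum.trans (le_of_eq ?_)
      rw [Finset.sum_add_distrib, Finset.sum_ite_mem, Finset.univ_inter]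
      simp only [Finset.sum_const, Finset.card_univ, Fintype.card_fin, nsmul_eq_mul, hIm]
      ring
  calc _ ≤ ((((Finset.univ : Finset (Fin n)).powersetCard m).biUnion fun I =>
        Finset.univ.filter fun σ : Equiv.Perm (Fin n) =>
          ∀ i, σ i ∈ if i ∈ I then A i ∩ F i else A i).card : ℝ) := by
          exact_mod_cast Finset.card_le_card hsub
    _ ≤ ∑ I ∈ (Finset.univ : Finset (Fin n)).powersetCard m,
        ((Finset.univ.filter fun σ : Equiv.Perm (Fin n) =>
          ∀ i, σ i ∈ if i ∈ I then A i ∩ F i else A i).card : ℝ) := by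
          exact_mod_cast Finset.card_biUnion_le
    _ ≤ ∑ I ∈ (Finset.univ : Finset (Fin n)).powersetCard m,
        Real.exp (n * logFactMean k) * (1 / 2) ^ (a * m) := Finset.sum_le_sum hI
    _ = ((Finset.univ : Finset (Fin n)).powersetCard m).card *
        (Real.exp (n * logFactMean k) * (1 / 2) ^ (a * m)) := by simp
    _ ≤ 2 ^ n * (Real.exp (n * logFactMean k) * (1 / 2) ^ (a * m)) := by
      refine mul_le_mul_of_nonneg_right ?_ (by positivity)
      rw [Finset.card_powersetCard, Finset.card_univ, Fintype.card_fin]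
      exact_mod_cast Nat.choose_le_two_pow n m
    _ = _ := by ring

/-- Systems of disjoint rows defined on the first `t` colours in the order `τ`, extended
trivially, in which the row `c` is loop-free. -/
def partialRows {n : ℕ} (τ : Fin n ≃ Fin n) (c : Fin n) (t : ℕ) :
    Finset (Fin n → Equiv.Perm (Fin n)) :=
  Finset.univ.filter fun g => (∀ i d d', (τ d : ℕ) < t → (τ d' : ℕ) < t → g d i = g d' i → d = d') ∧
    (∀ d, t ≤ (τ d : ℕ) → g d = 1) ∧ ((τ c : ℕ) < t → ∀ i, g c i ≠ i)

lemma card_image_rows {n : ℕ} {t : ℕ} (τ : Fin n ≃ Fin n) (ht : t < n) (f : Fin n → Fin n)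
    (hf : ∀ d d', (τ d : ℕ) < t → (τ d' : ℕ) < t → f d = f d' → d = d') :
    (((Finset.univ.filter fun d => (τ d : ℕ) < t).image f)ᶜ).card = n - t := by
  have h2 : (Finset.univ.filter fun d => (τ d : ℕ) < t).card = t := by
    rw [← Finset.card_map τ.toEmbedding]
    rw [show (Finset.univ.filter fun d => (τ d : ℕ) < t).map τ.toEmbedding = Finset.Iio ⟨t, ht⟩ by
      ext s
      simp only [Finset.mem_map_equiv, Finset.mem_filter, Finset.mem_univ, true_and,
        Equiv.apply_symm_apply, Finset.mem_Iio, Fin.lt_def]]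
    simp
  rw [Finset.card_compl, Fintype.card_fin, Finset.card_image_of_injOn, h2]
  intro a ha b hb h
  simp only [Finset.coe_filter, Finset.mem_univ, true_and, Set.mem_ofPred_eq] at ha hb
  exact hf a b ha hb h

lemma card_partialRows_succ {n : ℕ} (τ : Fin n ≃ Fin n) (c : Fin n) (hc : (τ c : ℕ) = 0) (t k : ℕ)
    (ht : t < n) (hk : 0 < k) (hkt : k = if t = 0 then n - 1 else n - t) :
    (k * Real.exp (-1)) ^ n * ((partialRows τ c t).card : ℝ) ≤ (partialRows τ c (t + 1)).card := by
  let d₀ : Fin n := τ.symm ⟨t, ht⟩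
  have hd₀ : (τ d₀ : ℕ) = t := by simp [d₀]
  have hne : ∀ d, (τ d : ℕ) < t → d ≠ d₀ := by rintro d hd rfl; omega
  have heq : ∀ d, (τ d : ℕ) = t → d = d₀ := fun d hd => τ.injective (Fin.ext (by omega))
  let A : (Fin n → Equiv.Perm (Fin n)) → Fin n → Finset (Fin n) := fun g i =>
    Finset.univ.filter fun j => (∀ d, (τ d : ℕ) < t → g d i ≠ j) ∧ (t = 0 → i ≠ j)
  have hA : ∀ g ∈ partialRows τ c t, (k * Real.exp (-1)) ^ n ≤ (sysCount (A g) : ℝ) := by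
    intro g hg
    simp only [partialRows, Finset.mem_filter, Finset.mem_univ, true_and] at hg
    refine le_sysCount k hk (A g) ?_ ?_
    · intro i
      by_cases h0 : t = 0
      · have : A g i = Finset.univ.erase i := by
          ext j; simp [A, h0, eq_comm]
        rw [this, hkt, if_pos h0]; simp
      · rw [hkt, if_neg h0, ← card_image_rows τ ht (fun d => g d i) (fun d d' => hg.1 i d d')]
        congr 1
        ext j; simp [A, h0]
    · intro j
      by_cases h0 : t = 0
      · have : (Finset.univ.filter fun i => j ∈ A g i) = Finset.univ.erase j := by
          ext i; simp [A, h0]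
        rw [this, hkt, if_pos h0]; simp
      · rw [hkt, if_neg h0, ← card_image_rows τ ht (fun d => (g d).symm j) ?_]
        · congr 1
          ext i
          simp [A, h0, Equiv.symm_apply_eq, @eq_comm _ j]
        · intro d d' hd hd' e
          refine hg.1 ((g d).symm j) d d' hd hd' ?_
          rw [Equiv.apply_symm_apply]
          rw [e, Equiv.apply_symm_apply]
  have hmaps : ∀ g ∈ partialRows τ c t, ∀ σ : Equiv.Perm (Fin n), (∀ i, σ i ∈ A g i) →
      Function.update g d₀ σ ∈ partialRows τ c (t + 1) := by
    intro g hg σ hσ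
    simp only [partialRows, Finset.mem_filter, Finset.mem_univ, true_and] at hg ⊢
    simp only [A, Finset.mem_filter, Finset.mem_univ, true_and] at hσ
    refine ⟨fun i d d' hd hd' e => ?_, fun d hd => ?_, fun _ i => ?_⟩
    · rcases (Nat.lt_succ_iff_lt_or_eq.1 hd) with h | h <;>
        rcases (Nat.lt_succ_iff_lt_or_eq.1 hd') with h' | h'
      · rw [Function.update_of_ne (hne d h), Function.update_of_ne (hne d' h')] at e
        exact hg.1 i d d' h h' e
      · rw [heq d' h', Function.update_of_ne (hne d h), Function.update_self] at e
        exact absurd e ((hσ i).1 d h)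
      · rw [heq d h, Function.update_of_ne (hne d' h'), Function.update_self] at e
        exact absurd e.symm ((hσ i).1 d' h')
      · rw [heq d h, heq d' h']
    · rw [Function.update_of_ne]
      · exact hg.2.1 d (by omega)
      · rintro rfl; omega
    · by_cases h0 : t = 0
      · rw [heq c (by omega), Function.update_self]
        exact fun e => (hσ i).2 h0 e.symm
      · rw [Function.update_of_ne (hne c (by omega))]
        exact hg.2.2 (by omega) i
  let T : Finset (Σ _ : Fin n → Equiv.Perm (Fin n), Equiv.Perm (Fin n)) :=
    (partialRows τ c t).sigma fun g => Finset.univ.filter fun σ => ∀ i, σ i ∈ A g i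
  have hT : T.card ≤ (partialRows τ c (t + 1)).card := by
    refine Finset.card_le_card_of_injOn (fun p => Function.update p.1 d₀ p.2) ?_ ?_
    · rintro ⟨g, σ⟩ hp
      simp only [T, Finset.coe_sigma, Set.mem_sigma_iff, Finset.mem_coe, Finset.mem_filter,
        Finset.mem_univ, true_and] at hp
      exact hmaps g hp.1 σ hp.2
    · rintro ⟨g, σ⟩ hp ⟨g', σ'⟩ hp' e
      simp only [T, Finset.coe_sigma, Set.mem_sigma_iff, Finset.mem_coe, Finset.mem_filter,
        Finset.mem_univ, true_and, partialRows] at hp hp' e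
      have h1 : σ = σ' := by
        have := congrFun e d₀
        simpa using this
      have h2 : g = g' := by
        funext d
        by_cases hd : d = d₀
        · subst hd
          rw [hp.1.2.1 _ hd₀.ge, hp'.1.2.1 _ hd₀.ge]
        · have := congrFun e d
          rwa [Function.update_of_ne hd, Function.update_of_ne hd] at this
      subst h1 h2; rfl
  have hTc : (T.card : ℝ) = ∑ g ∈ partialRows τ c t,
      ((Finset.univ.filter fun σ : Equiv.Perm (Fin n) => ∀ i, σ i ∈ A g i).card : ℝ) := by
    rw [Finset.card_sigma]; push_cast; rfl
  calc _ = ∑ g ∈ partialRows τ c t, (k * Real.exp (-1)) ^ n := by simp [mul_comm]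
    _ ≤ T.card := by
      rw [hTc]
      refine Finset.sum_le_sum fun g hg => (hA g hg).trans ?_
      rw [sysCount]
      exact le_of_eq (by congr!)
    _ ≤ _ := by exact_mod_cast hT

lemma exp_logFactMean_le {n r k : ℕ} (hr : 0 < r) (hrn : r ≤ n) (hk : 0 < k) (δ : ℝ)
    (h : Real.log r - Real.log k ≤ δ) :
    Real.exp (n * logFactMean r) ≤
      Real.exp (n * δ + n * ((1 + Real.log n) * (r : ℝ)⁻¹)) * (k * Real.exp (-1)) ^ n := by
  have hr' : (0 : ℝ) < r := by exact_mod_cast hr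
  have hk' : (0 : ℝ) < k := by exact_mod_cast hk
  have e : (k * Real.exp (-1)) ^ n = Real.exp (n * (Real.log k - 1)) := by
    rw [Real.exp_nat_mul, sub_eq_add_neg, Real.exp_add, Real.exp_log hk']
  rw [e, ← Real.exp_add, Real.exp_le_exp, ← mul_add, ← mul_add]
  refine mul_le_mul_of_nonneg_left ?_ (Nat.cast_nonneg n)
  have h1 := logFactMean_le hr
  have h2 : (1 + Real.log r) / r ≤ (1 + Real.log n) * (r : ℝ)⁻¹ := by
    rw [div_eq_mul_inv]
    have : Real.log r ≤ Real.log n := Real.log_le_log hr' (by exact_mod_cast hrn)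
    gcongr
  linarith

/-- The number of systems of disjoint rows with a loop-free row `c` is not much smaller than the
bound given by Brégman's theorem. -/
lemma rowBase_le {n : ℕ} (hn : 2 ≤ n) (c : Fin n) :
    rowBase n ≤ Real.exp (n + n * (1 + Real.log n) ^ 2) *
      (Finset.univ.filter fun g : Fin n → Equiv.Perm (Fin n) =>
        IsRows g ∧ ∀ i, g c i ≠ i).card := by
  let τ : Fin n ≃ Fin n := Equiv.swap c ⟨0, by omega⟩
  have hτ : (τ c : ℕ) = 0 := by simp [τ]
  let D : ℕ → ℝ := fun t => n * (if t = 0 then 1 else 0) +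
    n * ((1 + Real.log n) * ((n - t : ℕ) : ℝ)⁻¹)
  have key : ∀ t : ℕ, t ≤ n → ∏ s ∈ Finset.range t, Real.exp (n * logFactMean (n - s)) ≤
      Real.exp (∑ s ∈ Finset.range t, D s) * (partialRows τ c t).card := by
    intro t
    induction t with
    | zero =>
      intro _
      have : (fun _ => 1) ∈ partialRows τ c 0 := by simp [partialRows]
      have : 1 ≤ (partialRows τ c 0).card := Finset.card_pos.2 ⟨_, this⟩
      simpa using this
    | succ t ih =>
      intro ht
      obtain ⟨k, hkt⟩ : ∃ k, k = if t = 0 then n - 1 else n - t := ⟨_, rfl⟩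
      have hk : 0 < k := by rw [hkt]; split_ifs <;> omega
      have h1 := card_partialRows_succ τ c hτ t k (by omega) hk hkt
      have h2 : Real.exp (n * logFactMean (n - t)) ≤
          Real.exp (D t) * (k * Real.exp (-1)) ^ n := by
        refine exp_logFactMean_le (by omega) (by omega) hk _ ?_
        split_ifs at hkt ⊢ with h0
        · have hk' : (0 : ℝ) < k := by exact_mod_cast hk
          rw [← Real.log_div (by simp; omega) hk'.ne']
          refine (Real.log_le_sub_one_of_pos (div_pos (by simp; omega) hk')).trans ?_
          rw [sub_le_iff_le_add, div_le_iff₀ hk']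
          have : n - t ≤ 2 * k := by omega
          have : ((n - t : ℕ) : ℝ) ≤ 2 * k := by exact_mod_cast this
          linarith
        · rw [hkt, sub_self]
      rw [Finset.prod_range_succ, Finset.sum_range_succ, Real.exp_add]
      calc _ ≤ (Real.exp (∑ s ∈ Finset.range t, D s) * (partialRows τ c t).card) *
            (Real.exp (D t) * (k * Real.exp (-1)) ^ n) :=
            mul_le_mul (ih (by omega)) h2 (by positivity) (by positivity)
        _ = (Real.exp (∑ s ∈ Finset.range t, D s) * Real.exp (D t)) *
            ((k * Real.exp (-1)) ^ n * (partialRows τ c t).card) := by ring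
        _ ≤ _ := mul_le_mul_of_nonneg_left h1 (by positivity)
  have h3 := key n le_rfl
  rw [← Fin.prod_univ_eq_prod_range (fun s => Real.exp (n * logFactMean (n - s)))] at h3
  refine h3.trans (mul_le_mul (Real.exp_le_exp.2 ?_) ?_ (by positivity) (by positivity))
  · rw [Finset.sum_add_distrib, ← Finset.mul_sum, ← Finset.mul_sum, ← Finset.mul_sum]
    have h4 : ∑ s ∈ Finset.range n, (if s = 0 then (1 : ℝ) else 0) = 1 := by
      rw [Finset.sum_ite_eq' (Finset.range n) 0 (fun _ => (1 : ℝ)), if_pos (by simp; omega)]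
    have h5 : ∑ s ∈ Finset.range n, ((n - s : ℕ) : ℝ)⁻¹ ≤ 1 + Real.log n := by
      rw [← Finset.sum_range_reflect]
      have := harmonic_le_one_add_log n
      rw [harmonic] at this
      push_cast at this
      refine le_trans (le_of_eq (Finset.sum_congr rfl fun j hj => ?_)) this
      rw [Finset.mem_range] at hj
      rw [show n - (n - 1 - j) = j + 1 by omega]
      push_cast; rfl
    have h6 : 0 ≤ 1 + Real.log n := by linarith [Real.log_natCast_nonneg n]
    rw [h4, mul_one, pow_two]
    gcongr
  · norm_cast
    refine Finset.card_le_card fun g hg => ?_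
    simp only [partialRows, Finset.mem_filter, Finset.mem_univ, true_and] at hg ⊢
    exact ⟨fun i d d' => hg.1 i d d' (τ d).2 (τ d').2, hg.2.2 (τ c).2⟩

/-- The `(v,c)`-absorbing gadgets that avoid the vertices in `U` and the colours in `C`. -/
def avoidingGadgets {n : ℕ} (φ : Fin n → Fin n → Fin n) (v c : Fin n) (U C : Finset (Fin n)) :
    Finset (Fin 6 → Fin n) :=
  Finset.univ.filter fun x => IsAbsGadget φ v c x ∧ (∀ i, x i ∉ U) ∧
    φ (x 0) v ∉ C ∧ φ v (x 1) ∉ C ∧ φ (x 0) (x 1) ∉ C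

lemma card_mul_le_of_popular {α β : Type} (S : Finset α) (T : Finset β) (r : α → β → Prop)
    [∀ a b, Decidable (r a b)]
    (n k : ℕ) (hT : ∀ b ∈ T, n ≤ (S.filter fun a => r a b).card)
    (hS : ∀ a ∈ S, (T.filter fun b => r a b).card ≤ k) : T.card * n ≤ k * S.card := by
  calc T.card * n = ∑ b ∈ T, n := by simp
    _ ≤ ∑ b ∈ T, (S.filter fun a => r a b).card := Finset.sum_le_sum hT
    _ = ∑ a ∈ S, (T.filter fun b => r a b).card :=
      (Finset.sum_card_bipartiteAbove_eq_sum_card_bipartiteBelow r).symm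
    _ ≤ ∑ a ∈ S, k := Finset.sum_le_sum hS
    _ = _ := by simp [mul_comm]

lemma card_filter_absGadgetHasColour_le {n : ℕ} (φ : Fin n → Fin n → Fin n) (v : Fin n)
    (x : Fin 6 → Fin n) (T : Finset (Fin n)) :
    (T.filter fun d => absGadgetHasColour φ v x d).card ≤ 7 := by
  refine le_trans (Finset.card_le_card (t := {φ (x 0) v, φ v (x 1), φ (x 0) (x 1), φ (x 2) (x 3),
    φ (x 2) (x 4), φ (x 3) (x 5), φ (x 4) (x 5)}) fun d hd => ?_) ?_
  · have := (Finset.mem_filter.1 hd).2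
    simpa [absGadgetHasColour] using this
  · exact (Finset.card_insert_le _ _).trans (Nat.succ_le_succ Finset.card_le_six)

lemma card_filter_absGadgetVerts_le {n : ℕ} (v : Fin n) (x : Fin 6 → Fin n)
    (T : Finset (Fin n)) : (T.filter fun u => u ∈ absGadgetVerts v x).card ≤ 7 := by
  refine le_trans (Finset.card_le_card (t := absGadgetVerts v x) fun d hd =>
    (Finset.mem_filter.1 hd).2) ?_
  refine (Finset.card_insert_le _ _).trans ?_
  have := Finset.card_image_le (s := (Finset.univ : Finset (Fin 6))) (f := x)
  simp only [Finset.card_univ, Fintype.card_fin] at this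
  omega

/-- If there are many absorbing gadgets that avoid any given small set of vertices and colours,
then there is a large well-spread collection of absorbing gadgets. -/
lemma exists_wellSpread {n : ℕ} (φ : Fin n → Fin n → Fin n) (v c : Fin n)
    (h : ∀ U C : Finset (Fin n), v ∉ U → c ∉ C → 2 ^ 97 * U.card ≤ n → 2 ^ 97 * C.card ≤ n →
      (n : ℝ) ^ 2 / 2 ^ 100 ≤ (avoidingGadgets φ v c U C).card) :
    ∃ 𝒜 : Finset (Fin 6 → Fin n), (∀ x ∈ 𝒜, IsAbsGadget φ v c x) ∧
      WellSpreadAbsGadgets φ v c 𝒜 ∧ (n : ℝ) ^ 2 / 2 ^ 100 ≤ 𝒜.card := by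
  have hn : 0 < n := v.pos
  have hn' : (0 : ℝ) < n := by exact_mod_cast hn
  obtain ⟨𝒜, h𝒜, hmax⟩ := Set.exists_max_image
    {𝒜 : Finset (Fin 6 → Fin n) |
      (∀ x ∈ 𝒜, IsAbsGadget φ v c x) ∧ WellSpreadAbsGadgets φ v c 𝒜} Finset.card
    (Set.toFinite _) ⟨∅, by simp, by simp [WellSpreadAbsGadgets]⟩
  refine ⟨𝒜, h𝒜.1, h𝒜.2, ?_⟩
  by_contra! hlt
  let U : Finset (Fin n) := Finset.univ.filter fun u => u ≠ v ∧
    n ≤ (𝒜.filter fun x => u ∈ absGadgetVerts v x).card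
  let C : Finset (Fin n) := Finset.univ.filter fun d => d ≠ c ∧
    n ≤ (𝒜.filter fun x => absGadgetHasColour φ v x d).card
  have small : ∀ T : Finset (Fin n), T.card * n ≤ 7 * 𝒜.card → 2 ^ 97 * T.card ≤ n := by
    intro T hT
    have h1 : (T.card : ℝ) * n ≤ 7 * 𝒜.card := by exact_mod_cast hT
    have h2 : (2 ^ 97 * T.card : ℝ) * n ≤ n * n := by
      have : (n : ℝ) ^ 2 / 2 ^ 100 * 2 ^ 100 = n * n := by
        rw [div_mul_cancel₀ _ (by positivity)]; ring
      have h3 : (0 : ℝ) ≤ T.card * n := by positivity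
      norm_num at this hlt ⊢
      nlinarith
    exact_mod_cast le_of_mul_le_mul_right h2 hn'
  have hU := small U (card_mul_le_of_popular 𝒜 U (fun x u => u ∈ absGadgetVerts v x) n 7
    (fun u hu => (Finset.mem_filter.1 hu).2.2) fun x _ => card_filter_absGadgetVerts_le v x U)
  have hC := small C (card_mul_le_of_popular 𝒜 C (fun x d => absGadgetHasColour φ v x d) n 7
    (fun d hd => (Finset.mem_filter.1 hd).2.2) fun x _ =>
      card_filter_absGadgetHasColour_le φ v x C)
  have hav := h U C (by simp [U]) (by simp [C]) hU hC
  have hlt' : 𝒜.card < (avoidingGadgets φ v c U C).card := by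
    exact_mod_cast hlt.trans_le hav
  obtain ⟨x, hx, hxA⟩ := Finset.exists_mem_notMem_of_card_lt_card hlt'
  simp only [avoidingGadgets, Finset.mem_filter, Finset.mem_univ, true_and] at hx
  obtain ⟨hg, hxU, hc1, hc2, hc3⟩ := hx
  have := hmax (insert x 𝒜) ⟨?_, ?_, ?_⟩
  · rw [Finset.card_insert_of_notMem hxA] at this
    omega
  · intro y hy
    rcases Finset.mem_insert.1 hy with rfl | hy
    exacts [hg, h𝒜.1 y hy]
  · intro u hu
    rw [Finset.filter_insert]
    split_ifs with hux
    · refine (Finset.card_insert_le _ _).trans ?_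
      simp only [absGadgetVerts, Finset.mem_insert, hu, Finset.mem_image, Finset.mem_univ, true_and,
        false_or] at hux
      obtain ⟨i, rfl⟩ := hux
      have := hxU i
      simp only [U, Finset.mem_filter, Finset.mem_univ, true_and, not_and, not_le] at this
      exact this hu
    · exact h𝒜.2.1 u hu
  · intro d hd
    rw [Finset.filter_insert]
    split_ifs with hdx
    · refine (Finset.card_insert_le _ _).trans ?_
      have hdC : d ∉ C := by
        obtain ⟨-, e1, e2, e3, e4, -⟩ := hg
        rcases hdx with rfl | rfl | rfl | rfl | rfl | rfl | rfl
        · exact hc1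
        · exact hc2
        · exact hc3
        · exact e3 ▸ hc3
        · exact e2 ▸ hc2
        · exact e1 ▸ hc1
        · exact absurd e4 hd
      simp only [C, Finset.mem_filter, Finset.mem_univ, true_and, not_and, not_le] at hdC
      exact hdC hd
    · exact h𝒜.2.2 d hd

lemma card_powerset_filter_card_le {α : Type} (Y : Finset α) (h : ℕ) (x : ℝ) (hx : 0 < x)
    (hx1 : x ≤ 1) : ((Y.powerset.filter fun H => H.card ≤ h).card : ℝ) ≤
      Real.exp (x * Y.card) * (x⁻¹) ^ h := by
  have h1 : ((Y.powerset.filter fun H => H.card ≤ h).card : ℝ) * x ^ h ≤ (x + 1) ^ Y.card := by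
    rw [← Finset.sum_pow_mul_eq_add_pow, ← nsmul_eq_mul, ← Finset.sum_const]
    refine (Finset.sum_le_sum (g := fun H => x ^ H.card * 1 ^ (Y.card - H.card)) ?_).trans
      (Finset.sum_le_sum_of_subset_of_nonneg (Finset.filter_subset _ _) ?_)
    · intro H hH
      rw [one_pow, mul_one]
      exact pow_le_pow_of_le_one hx.le hx1 (Finset.mem_filter.1 hH).2
    · intro H _ _
      positivity
  have h2 : (x + 1) ^ Y.card ≤ Real.exp (x * Y.card) := by
    rw [mul_comm x, Real.exp_nat_mul]
    exact pow_le_pow_left₀ (by positivity) (Real.add_one_le_exp x) _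
  rw [inv_pow, ← div_eq_mul_inv, le_div_iff₀ (by positivity)]
  exact h1.trans h2

/-- Few permutations avoid most of a family of large sets. -/
lemma card_filter_few_hits_le {n k s h : ℕ} (A X : Fin n → Finset (Fin n)) (Y : Finset (Fin n))
    (hn : 0 < n) (hk : n ≤ 2 * k) (hkn : k ≤ n) (hs : 2 * s ≤ k) (hA : ∀ i, (A i).card ≤ k)
    (hX : ∀ i ∈ Y, s ≤ (A i ∩ X i).card) (x : ℝ) (hx : 0 < x) (hx1 : x ≤ 1) :
    ((Finset.univ.filter fun σ : Equiv.Perm (Fin n) => (∀ i, σ i ∈ A i) ∧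
      (Y.filter fun i => σ i ∈ X i).card ≤ h).card : ℝ) ≤
      Real.exp (n * logFactMean k) * (Real.exp (x * Y.card) * (x⁻¹) ^ h *
        Real.exp (-((Y.card - h) * s / n) + 4 * (1 + Real.log n))) := by
  have hn' : (0 : ℝ) < n := by exact_mod_cast hn
  have hsub : (Finset.univ.filter fun σ : Equiv.Perm (Fin n) => (∀ i, σ i ∈ A i) ∧
      (Y.filter fun i => σ i ∈ X i).card ≤ h) ⊆
      (Y.powerset.filter fun H => H.card ≤ h).biUnion fun H =>
        Finset.univ.filter fun σ : Equiv.Perm (Fin n) =>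
          ∀ i, σ i ∈ if i ∈ Y \ H then A i \ X i else A i := by
    intro σ hσ
    simp only [Finset.mem_filter, Finset.mem_univ, true_and] at hσ
    simp only [Finset.mem_biUnion, Finset.mem_filter, Finset.mem_univ, true_and,
      Finset.mem_powerset]
    refine ⟨Y.filter fun i => σ i ∈ X i, ⟨Finset.filter_subset _ _, hσ.2⟩, fun i => ?_⟩
    split_ifs with hi
    · simp only [Finset.mem_sdiff, Finset.mem_filter, not_and] at hi ⊢
      exact ⟨hσ.1 i, hi.2 hi.1⟩
    · exact hσ.1 i
  have hH : ∀ H ∈ Y.powerset.filter fun H => H.card ≤ h,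
      ((Finset.univ.filter fun σ : Equiv.Perm (Fin n) =>
          ∀ i, σ i ∈ if i ∈ Y \ H then A i \ X i else A i).card : ℝ) ≤
      Real.exp (n * logFactMean k) *
        Real.exp (-((Y.card - h) * s / n) + 4 * (1 + Real.log n)) := by
    intro H hH
    simp only [Finset.mem_filter, Finset.mem_powerset] at hH
    refine le_trans (Nat.cast_le.2 (card_le_sysCount fun σ hσ => (Finset.mem_filter.1 hσ).2))
      ((sysCount_le_of_card_le_sub (k := k) (s := s)
        (fun i => if i ∈ Y \ H then A i \ X i else A i) (Y \ H) hn hk hkn hs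
        (fun i => ?_) (fun i hi => ?_)).trans ?_)
    · split_ifs
      · exact (Finset.card_le_card Finset.sdiff_subset).trans (hA i)
      · exact hA i
    · rw [if_pos hi]
      have h1 := hX i (Finset.mem_sdiff.1 hi).1
      have h2 := Finset.card_sdiff_add_card_inter (A i) (X i)
      have h3 := hA i
      omega
    · refine mul_le_mul_of_nonneg_left (Real.exp_le_exp.2 ?_) (Real.exp_pos _).le
      have h1 : (Y.card : ℝ) - h ≤ (Y \ H).card := by
        have := Finset.card_sdiff_of_subset hH.1
        have h2 : Y.card ≤ (Y \ H).card + h := by omega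
        have : (Y.card : ℝ) ≤ (Y \ H).card + h := by exact_mod_cast h2
        linarith
      gcongr
  calc _ ≤ (((Y.powerset.filter fun H => H.card ≤ h).biUnion fun H =>
        Finset.univ.filter fun σ : Equiv.Perm (Fin n) =>
          ∀ i, σ i ∈ if i ∈ Y \ H then A i \ X i else A i).card : ℝ) := by
          exact_mod_cast Finset.card_le_card hsub
    _ ≤ ∑ H ∈ Y.powerset.filter fun H => H.card ≤ h,
        ((Finset.univ.filter fun σ : Equiv.Perm (Fin n) =>
          ∀ i, σ i ∈ if i ∈ Y \ H then A i \ X i else A i).card : ℝ) := by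
          exact_mod_cast Finset.card_biUnion_le
    _ ≤ ∑ H ∈ Y.powerset.filter fun H => H.card ≤ h, Real.exp (n * logFactMean k) *
        Real.exp (-((Y.card - h) * s / n) + 4 * (1 + Real.log n)) := Finset.sum_le_sum hH
    _ = (Y.powerset.filter fun H => H.card ≤ h).card * (Real.exp (n * logFactMean k) *
        Real.exp (-((Y.card - h) * s / n) + 4 * (1 + Real.log n))) := by simp
    _ ≤ (Real.exp (x * Y.card) * (x⁻¹) ^ h) * (Real.exp (n * logFactMean k) *
        Real.exp (-((Y.card - h) * s / n) + 4 * (1 + Real.log n))) :=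
      mul_le_mul_of_nonneg_right (card_powerset_filter_card_le Y h x hx hx1) (by positivity)
    _ = _ := by ring

/-- It is unlikely that every vertex of `Y` has few out-neighbours in `X` in the colours of
`D`. -/
lemma card_few_arcs_le {n : ℕ} (τ : Fin n ≃ Fin n) (c : Fin n) (D Y X : Finset (Fin n))
    (μ h s x₀ : ℕ) (hn : 0 < n)
    (hD : ∀ d ∈ D, 2 * (τ d : ℕ) ≤ n) (hDc : ∀ d ∈ D, ∀ d', τ d' < τ d → d' = c ∨ d' ∈ D)
    (hX : X.card = x₀) (hx₀ : 4 * x₀ ≤ n)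
    (hs : Y.card * μ ≤ (D.card - s) * (h + 1)) (hsD : s ≤ D.card) (hY : 0 < Y.card)
    (x : ℝ) (hx : 0 < x) (hx1 : x ≤ 1) :
    ((Finset.univ.filter fun g : Fin n → Equiv.Perm (Fin n) => IsRows g ∧
      ∀ y ∈ Y, (D.filter fun d => g d y ∈ X).card < μ).card : ℝ) ≤
      2 ^ n * (rowBase n * (Real.exp (x * Y.card) * (x⁻¹) ^ h *
        Real.exp (-((Y.card - h) * (x₀ - μ - 1 : ℕ) / n) + 4 * (1 + Real.log n))) ^ s) := by
  obtain ⟨bad, hb⟩ : ∃ bad : Fin n → (Fin n → Equiv.Perm (Fin n)) → Equiv.Perm (Fin n) → Prop,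
      ∀ d g σ, bad d g σ ↔ (∀ y ∈ Y, (D.filter fun d' => τ d' < τ d ∧ g d' y ∈ X).card < μ) ∧
        (Y.filter fun y => σ y ∈ X).card ≤ h := ⟨_, fun _ _ _ => Iff.rfl⟩
  refine le_trans (Nat.cast_le.2 (Finset.card_le_card ?_)) (card_bad_rows_le τ D bad ?_ _
    (by positivity) ?_ s)
  · intro g hg
    simp only [Finset.mem_filter, Finset.mem_univ, true_and] at hg ⊢
    refine ⟨hg.1, ?_⟩
    have hbad : (D.filter fun d => bad d g (g d)) =
        D.filter fun d => (Y.filter fun y => g d y ∈ X).card ≤ h := by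
      refine Finset.filter_congr fun d _ => ?_
      simp only [hb, and_iff_right_iff_imp]
      intro _ y hy
      refine lt_of_le_of_lt (Finset.card_le_card fun d' hd' => ?_) (hg.2 y hy)
      simp only [Finset.mem_filter] at hd' ⊢
      exact ⟨hd'.1, hd'.2.2⟩
    rw [hbad]
    by_contra! hlt
    have h1 := Finset.card_filter_add_card_filter_not (s := D)
      (fun d => (Y.filter fun y => g d y ∈ X).card ≤ h)
    have h2 : (D.filter fun d => ¬ (Y.filter fun y => g d y ∈ X).card ≤ h).card * (h + 1) ≤
        ∑ d ∈ D, (Y.filter fun y => g d y ∈ X).card := by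
      rw [← smul_eq_mul, ← Finset.sum_const]
      refine (Finset.sum_le_sum fun d hd => ?_).trans
        (Finset.sum_le_sum_of_subset (Finset.filter_subset _ _))
      have := (Finset.mem_filter.1 hd).2
      omega
    have h3 : ∑ d ∈ D, (Y.filter fun y => g d y ∈ X).card =
        ∑ y ∈ Y, (D.filter fun d => g d y ∈ X).card :=
      Finset.sum_card_bipartiteAbove_eq_sum_card_bipartiteBelow fun d y => g d y ∈ X
    have h4 : ∑ y ∈ Y, (D.filter fun d => g d y ∈ X).card < Y.card * μ := by
      rw [← smul_eq_mul, ← Finset.sum_const]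
      exact Finset.sum_lt_sum_of_nonempty (Finset.card_pos.1 hY) hg.2
    have h5 : (D.card - s) * (h + 1) ≤
        (D.filter fun d => ¬ (Y.filter fun y => g d y ∈ X).card ≤ h).card * (h + 1) :=
      Nat.mul_le_mul_right _ (by omega)
    omega
  · intro d hd g g' hgg σ hbad
    rw [hb] at hbad ⊢
    refine ⟨fun y hy => ?_, hbad.2⟩
    refine lt_of_le_of_lt (Finset.card_le_card fun d' hd' => ?_) (hbad.1 y hy)
    simp only [Finset.mem_filter] at hd' ⊢
    rw [hgg d' hd'.2.1]
    exact hd'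
  · intro d hd g hg
    have hd2 := hD d hd
    by_cases hist : ∀ y ∈ Y, (D.filter fun d' => τ d' < τ d ∧ g d' y ∈ X).card < μ
    · have h1 := card_filter_few_hits_le (k := n - (τ d : ℕ)) (s := x₀ - μ - 1) (h := h)
        (avail τ g d) (fun _ => X) Y hn (by omega) (by omega) (by omega)
        (fun i => (card_avail τ hg d i).le) (fun y hy => ?_) x hx hx1
      · refine le_trans (Nat.cast_le.2 (Finset.card_le_card fun σ hσ => ?_)) h1
        simp only [Finset.mem_filter, Finset.mem_univ, true_and, hb] at hσ ⊢
        exact ⟨hσ.1, hσ.2.2⟩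
      · have h2 : X \ avail τ g d y ⊆
            insert (g c y)
              ((D.filter fun d' => τ d' < τ d ∧ g d' y ∈ X).image fun d' => g d' y) := by
          intro j hj
          simp only [avail, Finset.mem_sdiff, Finset.mem_filter, Finset.mem_univ, true_and,
            not_forall, not_not] at hj
          obtain ⟨hjX, d', hd', rfl⟩ := hj
          rcases hDc d hd d' hd' with rfl | hdD
          · exact Finset.mem_insert_self _ _
          · refine Finset.mem_insert_of_mem (Finset.mem_image.2 ⟨d', ?_, rfl⟩)
            exact Finset.mem_filter.2 ⟨hdD, hd', hjX⟩
        have h3 := (Finset.card_le_card h2).trans (Finset.card_insert_le _ _)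
        have h4 := Finset.card_image_le (s := D.filter fun d' => τ d' < τ d ∧ g d' y ∈ X)
          (f := fun d' => g d' y)
        have h5 := hist y hy
        have h6 := Finset.card_sdiff_add_card_inter X (avail τ g d y)
        rw [Finset.inter_comm] at h6
        omega
    · rw [Finset.filter_false_of_mem fun σ _ hσ => hist ((hb _ _ _).1 hσ.2).1]
      simp only [Finset.card_empty, Nat.cast_zero]
      positivity

/-- It is unlikely that many rows have a partner for which they meet too often a family of small
sets determined by the previous rows. -/
lemma card_many_hits_le {n : ℕ} (τ : Fin n ≃ Fin n) (D P : Finset (Fin n))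
    (F : Fin n → Fin n → (Fin n → Equiv.Perm (Fin n)) → Fin n → Finset (Fin n))
    (f m a s : ℕ) (hn : 0 < n) (hD : ∀ d ∈ D, 2 * (τ d : ℕ) ≤ n)
    (hdep : ∀ d ∈ D, ∀ p ∈ P, ∀ g g' : Fin n → Equiv.Perm (Fin n),
      (∀ d', τ d' < τ d → g' d' = g d') → F d p g' = F d p g)
    (hF : ∀ d ∈ D, ∀ p ∈ P, ∀ g i, (F d p g i).card ≤ f) (hf : 6 * 2 ^ a * f ≤ n) :
    ((Finset.univ.filter fun g : Fin n → Equiv.Perm (Fin n) => IsRows g ∧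
      s ≤ (D.filter fun d => ∃ p ∈ P,
        m ≤ (Finset.univ.filter fun i => g d i ∈ F d p g i).card).card).card : ℝ) ≤
      2 ^ n * (rowBase n * (n * (2 ^ n * (1 / 2) ^ (a * m))) ^ s) := by
  obtain ⟨bad, hb⟩ : ∃ bad : Fin n → (Fin n → Equiv.Perm (Fin n)) → Equiv.Perm (Fin n) → Prop,
      ∀ d g σ, bad d g σ ↔ ∃ p ∈ P, m ≤ (Finset.univ.filter fun i => σ i ∈ F d p g i).card :=
    ⟨_, fun _ _ _ => Iff.rfl⟩
  simp only [← hb]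
  refine card_bad_rows_le τ D bad ?_ (n * (2 ^ n * (1 / 2) ^ (a * m))) (by positivity) ?_ s
  · intro d hd g g' hgg σ hbad
    rw [hb] at hbad ⊢
    obtain ⟨p, hp, hm⟩ := hbad
    refine ⟨p, hp, ?_⟩
    rwa [← hdep d hd p hp g g' hgg]
  · intro d hd g hg
    have hd2 := hD d hd
    have hsub : (Finset.univ.filter fun σ : Equiv.Perm (Fin n) =>
        (∀ i, σ i ∈ avail τ g d i) ∧ bad d g σ) ⊆ P.biUnion fun p =>
        Finset.univ.filter fun σ : Equiv.Perm (Fin n) => (∀ i, σ i ∈ avail τ g d i) ∧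
          m ≤ (Finset.univ.filter fun i => σ i ∈ F d p g i).card := by
      intro σ hσ
      simp only [Finset.mem_filter, Finset.mem_univ, true_and, Finset.mem_biUnion, hb] at hσ ⊢
      obtain ⟨h1, p, hp, h2⟩ := hσ
      exact ⟨p, hp, h1, h2⟩
    calc _ ≤ ((P.biUnion fun p =>
        Finset.univ.filter fun σ : Equiv.Perm (Fin n) => (∀ i, σ i ∈ avail τ g d i) ∧
          m ≤ (Finset.univ.filter fun i => σ i ∈ F d p g i).card).card : ℝ) := by
          exact_mod_cast Finset.card_le_card hsub
      _ ≤ ∑ p ∈ P, ((Finset.univ.filter fun σ : Equiv.Perm (Fin n) =>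
          (∀ i, σ i ∈ avail τ g d i) ∧
          m ≤ (Finset.univ.filter fun i => σ i ∈ F d p g i).card).card : ℝ) := by
          exact_mod_cast Finset.card_biUnion_le
      _ ≤ ∑ p ∈ P, Real.exp (n * logFactMean (n - (τ d : ℕ))) * (2 ^ n * (1 / 2) ^ (a * m)) :=
          Finset.sum_le_sum fun p hp => card_filter_hits_le (avail τ g d) (F d p g) hn (by omega)
            (fun i => (card_avail τ hg d i).le) (hF d hd p hp g) hf
      _ = P.card * (Real.exp (n * logFactMean (n - (τ d : ℕ))) * (2 ^ n * (1 / 2) ^ (a * m))) := by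
          simp
      _ ≤ n * (Real.exp (n * logFactMean (n - (τ d : ℕ))) * (2 ^ n * (1 / 2) ^ (a * m))) := by
          refine mul_le_mul_of_nonneg_right ?_ (by positivity)
          exact_mod_cast (by simpa using Finset.card_le_univ P)
      _ = _ := by ring

/-- It is unlikely that many rows meet too rarely a family of large sets determined by the rows
that precede a given time. -/
lemma card_few_hits_rows_le {n : ℕ} (τ : Fin n ≃ Fin n) (D : Finset (Fin n)) (t₁ : ℕ)
    (T : (Fin n → Equiv.Perm (Fin n)) → Fin n → Fin n → Finset (Fin n))
    (ρ m₁ β κ s : ℕ) (hn : 0 < n) (hD : ∀ d ∈ D, 2 * (τ d : ℕ) ≤ n)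
    (hD1 : ∀ d ∈ D, t₁ ≤ (τ d : ℕ)) (hD2 : ∀ d ∈ D, (τ d : ℕ) ≤ t₁ + m₁)
    (hdep : ∀ g g' : Fin n → Equiv.Perm (Fin n),
      (∀ d', (τ d' : ℕ) < t₁ → g' d' = g d') → T g' = T g)
    (hT : ∀ g y i d', (τ d' : ℕ) < t₁ → g d' i ∉ T g y i)
    (hρ : 4 * ρ ≤ n) (x : ℝ) (hx : 0 < x) (hx1 : x ≤ 1) :
    ((Finset.univ.filter fun g : Fin n → Equiv.Perm (Fin n) => IsRows g ∧
      s ≤ (D.filter fun d => ∃ y, β ≤ (Finset.univ.filter fun i => ρ < (T g y i).card).card ∧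
        (Finset.univ.filter fun i => g d i ∈ T g y i).card ≤ κ).card).card : ℝ) ≤
      2 ^ n * (rowBase n * (n * (Real.exp (x * n) * (x⁻¹) ^ κ *
        Real.exp (-((β - κ) * (ρ - m₁ : ℕ) / n) + 4 * (1 + Real.log n)))) ^ s) := by
  have hn' : (0 : ℝ) < n := by exact_mod_cast hn
  obtain ⟨bad, hb⟩ : ∃ bad : Fin n → (Fin n → Equiv.Perm (Fin n)) → Equiv.Perm (Fin n) → Prop,
      ∀ d g σ, bad d g σ ↔ ∃ y, β ≤ (Finset.univ.filter fun i => ρ < (T g y i).card).card ∧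
        (Finset.univ.filter fun i => σ i ∈ T g y i).card ≤ κ := ⟨_, fun _ _ _ => Iff.rfl⟩
  have hb' : ∀ d g, (∃ y, β ≤ (Finset.univ.filter fun i => ρ < (T g y i).card).card ∧
      (Finset.univ.filter fun i => g d i ∈ T g y i).card ≤ κ) ↔ bad d g (g d) :=
    fun d g => (hb d g (g d)).symm
  simp only [hb']
  refine card_bad_rows_le τ D bad ?_ (n * (Real.exp (x * n) * (x⁻¹) ^ κ *
    Real.exp (-((β - κ) * (ρ - m₁ : ℕ) / n) + 4 * (1 + Real.log n)))) (by positivity) ?_ s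
  · intro d hd g g' hgg σ hbad
    rw [hb] at hbad ⊢
    obtain ⟨y, h1, h2⟩ := hbad
    have : T g' = T g := hdep g g' fun d' hd' =>
      hgg d' (Fin.lt_def.2 (lt_of_lt_of_le hd' (hD1 d hd)))
    rw [this] at h1 h2
    exact ⟨y, h1, h2⟩
  · intro d hd g hg
    have hd2 := hD d hd
    let Rich : Fin n → Finset (Fin n) := fun y => Finset.univ.filter fun i => ρ < (T g y i).card
    have hsub : (Finset.univ.filter fun σ : Equiv.Perm (Fin n) =>
        (∀ i, σ i ∈ avail τ g d i) ∧ bad d g σ) ⊆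
        (Finset.univ.filter fun y => β ≤ (Rich y).card).biUnion fun y =>
        Finset.univ.filter fun σ : Equiv.Perm (Fin n) => (∀ i, σ i ∈ avail τ g d i) ∧
          ((Rich y).filter fun i => σ i ∈ T g y i).card ≤ κ := by
      intro σ hσ
      simp only [Finset.mem_filter, Finset.mem_univ, true_and, Finset.mem_biUnion, hb] at hσ ⊢
      obtain ⟨h1, y, hy, h2⟩ := hσ
      exact ⟨y, hy, h1, (Finset.card_le_card (Finset.filter_subset_filter _
        (Finset.subset_univ _))).trans h2⟩
    have hrow : ∀ y ∈ Finset.univ.filter fun y => β ≤ (Rich y).card,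
        ((Finset.univ.filter fun σ : Equiv.Perm (Fin n) => (∀ i, σ i ∈ avail τ g d i) ∧
          ((Rich y).filter fun i => σ i ∈ T g y i).card ≤ κ).card : ℝ) ≤
        Real.exp (n * logFactMean (n - (τ d : ℕ))) * (Real.exp (x * n) * (x⁻¹) ^ κ *
        Real.exp (-((β - κ) * (ρ - m₁ : ℕ) / n) + 4 * (1 + Real.log n))) := by
      intro y hy
      have hy' := (Finset.mem_filter.1 hy).2
      refine (card_filter_few_hits_le (k := n - (τ d : ℕ)) (s := ρ - m₁) (h := κ)
        (avail τ g d) (T g y) (Rich y) hn (by omega) (by omega) (by omega)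
        (fun i => (card_avail τ hg d i).le) (fun i hi => ?_) x hx hx1).trans ?_
      · have hi' : ρ < (T g y i).card := (Finset.mem_filter.1 hi).2
        have h2 : T g y i \ avail τ g d i ⊆
            ((Finset.univ.filter fun d' => t₁ ≤ (τ d' : ℕ) ∧ τ d' < τ d).image
              fun d' => g d' i) := by
          intro j hj
          simp only [avail, Finset.mem_sdiff, Finset.mem_filter, Finset.mem_univ, true_and,
            not_forall, not_not] at hj
          obtain ⟨hjT, d', hd', rfl⟩ := hj
          refine Finset.mem_image.2 ⟨d', ?_, rfl⟩
          simp only [Finset.mem_filter, Finset.mem_univ, true_and]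
          refine ⟨?_, hd'⟩
          by_contra! hlt
          exact hT g y i d' hlt hjT
        have h3 := (Finset.card_le_card h2).trans Finset.card_image_le
        have h4 : (Finset.univ.filter fun d' => t₁ ≤ (τ d' : ℕ) ∧ τ d' < τ d).card ≤ m₁ := by
          have h5 : ((Finset.univ.filter fun d' => t₁ ≤ (τ d' : ℕ) ∧ τ d' < τ d).image
              fun d' => (τ d' : ℕ)) ⊆ Finset.Ico t₁ (τ d : ℕ) := by
            intro t ht
            obtain ⟨d', hd', rfl⟩ := Finset.mem_image.1 ht
            exact Finset.mem_Ico.2 ((Finset.mem_filter.1 hd').2.imp_right Fin.lt_def.1)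
          have h6 := Finset.card_le_card h5
          rw [Finset.card_image_of_injective _
            (fun a b h => τ.injective (Fin.ext h)), Nat.card_Ico] at h6
          have := hD2 d hd
          omega
        have h6 := Finset.card_sdiff_add_card_inter (T g y i) (avail τ g d i)
        rw [Finset.inter_comm] at h6
        omega
      · refine mul_le_mul_of_nonneg_left ?_ (Real.exp_pos _).le
        have h1 : ((Rich y).card : ℝ) ≤ n := by
          exact_mod_cast (by simpa using Finset.card_le_univ (Rich y))
        have h2 : (β : ℝ) ≤ (Rich y).card := by exact_mod_cast hy'
        gcongr
    calc _ ≤ (((Finset.univ.filter fun y => β ≤ (Rich y).card).biUnion fun y =>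
        Finset.univ.filter fun σ : Equiv.Perm (Fin n) => (∀ i, σ i ∈ avail τ g d i) ∧
          ((Rich y).filter fun i => σ i ∈ T g y i).card ≤ κ).card : ℝ) := by
          exact_mod_cast Finset.card_le_card hsub
      _ ≤ ∑ y ∈ Finset.univ.filter fun y => β ≤ (Rich y).card,
          ((Finset.univ.filter fun σ : Equiv.Perm (Fin n) => (∀ i, σ i ∈ avail τ g d i) ∧
          ((Rich y).filter fun i => σ i ∈ T g y i).card ≤ κ).card : ℝ) := by
          exact_mod_cast Finset.card_biUnion_le
      _ ≤ _ := Finset.sum_le_sum hrow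
      _ = (Finset.univ.filter fun y => β ≤ (Rich y).card).card *
          (Real.exp (n * logFactMean (n - (τ d : ℕ))) * (Real.exp (x * n) * (x⁻¹) ^ κ *
        Real.exp (-((β - κ) * (ρ - m₁ : ℕ) / n) + 4 * (1 + Real.log n)))) := by
          rw [Finset.sum_const, nsmul_eq_mul]
      _ ≤ n * (Real.exp (n * logFactMean (n - (τ d : ℕ))) * (Real.exp (x * n) * (x⁻¹) ^ κ *
        Real.exp (-((β - κ) * (ρ - m₁ : ℕ) / n) + 4 * (1 + Real.log n)))) := by
          refine mul_le_mul_of_nonneg_right ?_ (by positivity)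
          exact_mod_cast (by
            simpa using Finset.card_le_univ (Finset.univ.filter fun y => β ≤ (Rich y).card))
      _ = _ := by ring

/-- The heads `j` of the arcs `i → j` that would complete an absorbing gadget at `v` avoiding `U`
and `C`, whose vertex `x 0` is `y` and whose arcs other than `y → v` and `i → j` have
colours in `D₂`, `D₃` and `{c}`. -/
def endTargets {n : ℕ} (c : Fin n) (D₂ D₃ : Finset (Fin n)) (v : Fin n) (U C : Finset (Fin n))
    (g : Fin n → Equiv.Perm (Fin n)) (y i : Fin n) : Finset (Fin n) :=
  Finset.univ.filter fun j => (∃ f₂ ∈ D₂, ∃ f₃ ∈ D₃, ∃ x, f₂ ∉ C ∧ f₃ ∉ C ∧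
    g f₃ y = g f₂ v ∧ g f₃ x = i ∧ g c (g f₂ x) = j ∧
    [v, y, g f₂ v, x, i, g f₂ x, j].Nodup ∧ ∀ z ∈ [y, g f₂ v, x, i, g f₂ x, j], z ∉ U) ∧
    ∀ d ∈ insert c (D₂ ∪ D₃), g d i ≠ j

lemma exists_gadget_of_mem_endTargets {n : ℕ} {φ : Fin n → Fin n → Fin n} {c : Fin n}
    {D₂ D₃ : Finset (Fin n)} {v : Fin n} {U C : Finset (Fin n)}
    {g : Fin n → Equiv.Perm (Fin n)} (hφ : ∀ i j d, φ i j = d ↔ g d i = j)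
    (h23 : Disjoint D₂ D₃) (hc2 : c ∉ D₂) (hc3 : c ∉ D₃) {f y i : Fin n}
    (hfc : f ≠ c) (hf2 : f ∉ D₂) (hf3 : f ∉ D₃) (hfC : f ∉ C) (hy : g f y = v)
    (hi : g f i ∈ endTargets c D₂ D₃ v U C g y i) :
    ∃ x ∈ avoidingGadgets φ v c U C, x 0 = y ∧ x 3 = i := by
  simp only [endTargets, Finset.mem_filter, Finset.mem_univ, true_and] at hi
  obtain ⟨⟨f₂, h2, f₃, h3, x, h2C, h3C, e1, e2, e3, hnd, hU⟩, -⟩ := hi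
  have k1 : φ y v = f := (hφ _ _ _).2 hy
  have k2 : φ i (g f i) = f := (hφ _ _ _).2 rfl
  have k3 : φ v (g f₂ v) = f₂ := (hφ _ _ _).2 rfl
  have k4 : φ x (g f₂ x) = f₂ := (hφ _ _ _).2 rfl
  have k5 : φ y (g f₂ v) = f₃ := (hφ _ _ _).2 e1
  have k6 : φ x i = f₃ := (hφ _ _ _).2 e2
  have k7 : φ (g f₂ x) (g f i) = c := (hφ _ _ _).2 e3
  have n1 : f ≠ f₂ := fun h => hf2 (h ▸ h2)
  have n2 : f ≠ f₃ := fun h => hf3 (h ▸ h3)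
  have n3 : f₂ ≠ f₃ := fun h => Finset.disjoint_left.1 h23 h2 (h ▸ h3)
  have n4 : f₂ ≠ c := fun h => hc2 (h ▸ h2)
  have n5 : f₃ ≠ c := fun h => hc3 (h ▸ h3)
  refine ⟨![y, g f₂ v, x, i, g f₂ x, g f i], ?_, rfl, rfl⟩
  simp only [avoidingGadgets, Finset.mem_filter, Finset.mem_univ, true_and]
  refine ⟨⟨hnd, k1.trans k2.symm, k3.trans k4.symm, k5.trans k6.symm, k7, ?_⟩, ?_,
    ?_, ?_, ?_⟩
  · change [φ y v, φ v (g f₂ v), φ y (g f₂ v), c].Nodup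
    rw [k1, k3, k5]
    simp [n1, n2, n3, n4, n5, hfc]
  · intro k
    apply hU
    fin_cases k <;> simp
  · change φ y v ∉ C
    rwa [k1]
  · change φ v (g f₂ v) ∉ C
    rwa [k3]
  · change φ y (g f₂ v) ∉ C
    rwa [k5]

lemma card_le_sum_of_cover {α : Type} (L : List (Finset α)) (S : Finset α)
    (h : ∀ x ∈ S, ∃ A ∈ L, x ∈ A) : S.card ≤ (L.map Finset.card).sum := by
  induction L generalizing S with
  | nil =>
    simp only [List.not_mem_nil, false_and, exists_false, imp_false] at h
    simp [Finset.eq_empty_of_forall_notMem h]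
  | cons A L ih =>
    have h1 := ih (S \ A) fun x hx => by
      obtain ⟨hxS, hxA⟩ := Finset.mem_sdiff.1 hx
      obtain ⟨B, hB, hxB⟩ := h x hxS
      rcases List.mem_cons.1 hB with rfl | hB
      · exact absurd hxB hxA
      · exact ⟨B, hB, hxB⟩
    have h2 := Finset.card_le_card_sdiff_add_card (s := S) (t := A)
    simp only [List.map_cons, List.sum_cons]
    omega

lemma card_filter_perm_apply {α : Type} [Fintype α] (σ : Equiv.Perm α) (p : α → Prop)
    [DecidablePred p] :
    (Finset.univ.filter fun x => p (σ x)).card = (Finset.univ.filter p).card :=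
  Finset.card_equiv σ fun x => by simp

/-- The vertices `j` for which `g f₂ x = j` makes the end `g c j` of the arc of colour `c` from `j`
equal to one of the vertices that `g f₃ x` should avoid. -/
def collisions {n : ℕ} (τ : Fin n ≃ Fin n) (c : Fin n) (T : Fin n → Finset (Fin n))
    (f₂ f₃ : Fin n) (g : Fin n → Equiv.Perm (Fin n)) (x : Fin n) : Finset (Fin n) :=
  (T (g f₃ x) ∪ {x, g f₃ x} ∪
    (Finset.univ.filter fun d => τ d < τ f₂).image fun d => g d (g f₃ x)).image (g c).symm

lemma mem_collisions {n : ℕ} {τ : Fin n ≃ Fin n} {c : Fin n} {T : Fin n → Finset (Fin n)}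
    {f₂ f₃ : Fin n} {g : Fin n → Equiv.Perm (Fin n)} {x j : Fin n} :
    j ∈ collisions τ c T f₂ f₃ g x ↔ g c j ∈ T (g f₃ x) ∨ g c j = x ∨ g c j = g f₃ x ∨
      ∃ d, τ d < τ f₂ ∧ g d (g f₃ x) = g c j := by
  simp only [collisions, Finset.mem_image, Finset.mem_union, Finset.mem_insert,
    Finset.mem_singleton, Finset.mem_filter, Finset.mem_univ, true_and]
  constructor
  · rintro ⟨k, hk, rfl⟩
    simpa [or_assoc] using hk
  · intro h
    exact ⟨g c j, by simpa [or_assoc] using h, by simp⟩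

/-- If a vertex `y` and two colours avoid the exceptional configurations, then `y` has many rich
successors. -/
lemma le_card_rich {n : ℕ} {c : Fin n} {D₂ D₃ : Finset (Fin n)} {v : Fin n}
    {U C : Finset (Fin n)} {g : Fin n → Equiv.Perm (Fin n)} {τ₁ τ₂ : Fin n ≃ Fin n}
    {f₂ f₃ y : Fin n} {ρ m ℓ l : ℕ} (hg : IsRows g)
    (hτ : ∀ d ∈ insert c (D₂ ∪ D₃), d ≠ f₂ → τ₁ d < τ₁ f₂ ∨ τ₂ d < τ₂ f₂)
    (h2 : f₂ ∈ D₂) (h3 : f₃ ∈ D₃) (h2C : f₂ ∉ C) (h3C : f₃ ∉ C) (hne : f₂ ≠ f₃)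
    (hy : g f₃ y = g f₂ v) (hyU : y ∉ U) (hzU : g f₂ v ∉ U)
    (hyv : y ≠ v) (hzv : g f₂ v ≠ v) (hzy : g f₂ v ≠ y)
    (hl2 : (Finset.univ.filter fun x => g f₂ x = x).card < ℓ)
    (hl3 : (Finset.univ.filter fun x => g f₃ x = x).card < ℓ)
    (hlc : (Finset.univ.filter fun x => g c x = x).card ≤ l)
    {T : Fin n → Finset (Fin n)} (hT : ∀ i, (endTargets c D₂ D₃ v U C g y i).card ≤ ρ →
      T i = endTargets c D₂ D₃ v U C g y i)
    (hm1 : (Finset.univ.filter fun x => g f₂ x ∈ collisions τ₁ c T f₂ f₃ g x).card < m)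
    (hm2 : (Finset.univ.filter fun x => g f₂ x ∈ collisions τ₂ c T f₂ f₃ g x).card < m)
    (hm3 : (Finset.univ.filter fun x => g f₂ (g f₃ x) = g c (g f₂ x)).card < m) :
    n ≤ 4 * (U.card + 3) + 2 * ℓ + l + 3 * m +
      (Finset.univ.filter fun i => ρ < (endTargets c D₂ D₃ v U C g y i).card).card := by
  let E := endTargets c D₂ D₃ v U C g y
  let W : Finset (Fin n) := U ∪ {v, y, g f₂ v}
  have hW : W.card ≤ U.card + 3 := (Finset.card_union_le _ _).trans
    (Nat.add_le_add_left Finset.card_le_three _)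
  have hmemW : ∀ z, z ∉ W ↔ z ∉ U ∧ z ≠ v ∧ z ≠ y ∧ z ≠ g f₂ v := by
    intro z
    simp [W]
    tauto
  have hcov := card_le_sum_of_cover [W, Finset.univ.filter fun x => g f₃ x ∈ W,
    Finset.univ.filter fun x => g f₂ x ∈ W, Finset.univ.filter fun x => (g c) (g f₂ x) ∈ W,
    Finset.univ.filter fun x => g f₂ x = x, Finset.univ.filter fun x => g f₃ x = x,
    Finset.univ.filter fun x => g c (g f₂ x) = g f₂ x,
    Finset.univ.filter fun x => g f₂ x ∈ collisions τ₁ c T f₂ f₃ g x,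
    Finset.univ.filter fun x => g f₂ x ∈ collisions τ₂ c T f₂ f₃ g x,
    Finset.univ.filter fun x => g f₂ (g f₃ x) = g c (g f₂ x),
    Finset.univ.filter fun x => ρ < (E (g f₃ x)).card] Finset.univ ?_
  · have e1 := card_filter_perm_apply (g f₃) fun x => x ∈ W
    have e2 := card_filter_perm_apply (g f₂) fun x => x ∈ W
    have e3 := card_filter_perm_apply (g f₂) fun x => g c x ∈ W
    have e4 := card_filter_perm_apply (g c) fun x => x ∈ W
    have e5 := card_filter_perm_apply (g f₂) fun x => g c x = x
    have e6 := card_filter_perm_apply (g f₃) fun x => ρ < (E x).card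
    have e7 : (Finset.univ.filter fun x => x ∈ W) = W := by simp
    simp only [List.map_cons, List.map_nil, List.sum_cons, List.sum_nil, Finset.card_univ,
      Fintype.card_fin, e1, e2, e3, e4, e5, e6, e7] at hcov
    change _ ≤ _ + (Finset.univ.filter fun i => ρ < (E i).card).card
    omega
  · intro x _
    by_contra! hx
    simp only [List.mem_cons, List.not_mem_nil, or_false, forall_eq_or_imp, forall_eq,
      Finset.mem_filter, Finset.mem_univ, true_and, not_lt, hmemW, mem_collisions, not_or,
      not_exists, not_and] at hx
    obtain ⟨x0, x3, x2, xc, l2, l3, lc, ⟨a1, a2, a3, a4⟩, ⟨b1, b2, b3, b4⟩, c1, hR⟩ := hx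
    refine a1 ?_
    rw [show T (g f₃ x) = E (g f₃ x) from hT _ hR]
    simp only [E, endTargets, Finset.mem_filter, Finset.mem_univ, true_and]
    refine ⟨⟨f₂, h2, f₃, h3, x, h2C, h3C, hy, rfl, rfl, ?_, ?_⟩, ?_⟩
    · have h23 : g f₃ x ≠ g f₂ x := fun h => hne (hg x _ _ h).symm
      simp only [List.nodup_cons, List.mem_cons, List.not_mem_nil, or_false, not_or,
        List.nodup_nil, not_false_eq_true, and_true]
      exact ⟨⟨hyv.symm, hzv.symm, x0.2.1.symm, x3.2.1.symm, x2.2.1.symm, xc.2.1.symm⟩,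
        ⟨hzy.symm, x0.2.2.1.symm, x3.2.2.1.symm, x2.2.2.1.symm, xc.2.2.1.symm⟩,
        ⟨x0.2.2.2.symm, x3.2.2.2.symm, x2.2.2.2.symm, xc.2.2.2.symm⟩,
        ⟨Ne.symm l3, Ne.symm l2, Ne.symm a2⟩, ⟨h23, Ne.symm a3⟩, Ne.symm lc⟩
    · simp only [List.mem_cons, List.not_mem_nil, or_false, forall_eq_or_imp, forall_eq]
      exact ⟨hyU, hzU, x0.1, x3.1, x2.1, xc.1⟩
    · intro d hd
      by_cases hdf : d = f₂
      · rw [hdf]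
        exact c1
      · rcases hτ d hd hdf with h | h
        · exact a4 d h
        · exact b4 d h

lemma IsRows.injOn_symm_apply {n : ℕ} {g : Fin n → Equiv.Perm (Fin n)} (hg : IsRows g)
    (v : Fin n) : Function.Injective fun d => (g d).symm v := by
  intro d d' h
  refine hg ((g d).symm v) d d' ?_
  simp only at h
  rw [Equiv.apply_symm_apply, h, Equiv.apply_symm_apply]

lemma IsRows.card_filter_loops_mul_le {n : ℕ} {g : Fin n → Equiv.Perm (Fin n)} (hg : IsRows g)
    (ℓ : ℕ) : (Finset.univ.filter fun d =>
      ℓ ≤ (Finset.univ.filter fun x => g d x = x).card).card * ℓ ≤ n := by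
  have h := card_mul_le_of_popular (Finset.univ : Finset (Fin n)) (Finset.univ.filter fun d =>
      ℓ ≤ (Finset.univ.filter fun x => g d x = x).card) (fun x d => g d x = x) ℓ 1
    (fun d hd => (Finset.mem_filter.1 hd).2) (fun x _ => ?_)
  · simpa using h
  · refine Finset.card_le_one.2 fun d hd d' hd' => hg x d d' ?_
    rw [(Finset.mem_filter.1 hd).2, (Finset.mem_filter.1 hd').2]

/-- A colouring without any of the exceptional configurations has many gadgets at every vertex. -/
lemma le_card_avoidingGadgets {n : ℕ} {φ : Fin n → Fin n → Fin n} {c : Fin n}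
    {D₁ D₂ D₃ : Finset (Fin n)} {v : Fin n} {U C : Finset (Fin n)}
    {g : Fin n → Equiv.Perm (Fin n)} {τ₁ τ₂ : Fin n ≃ Fin n}
    {x₀ y₀ μ s₁ s₂ ρ κ β m ℓ l u L : ℕ} (hg : IsRows g) (hφ : ∀ i j d, φ i j = d ↔ g d i = j)
    (h12 : Disjoint D₁ D₂) (h13 : Disjoint D₁ D₃) (h23 : Disjoint D₂ D₃)
    (hc1 : c ∉ D₁) (hc2 : c ∉ D₂) (hc3 : c ∉ D₃)
    (hτ : ∀ f₂ ∈ D₂, ∀ d ∈ insert c (D₂ ∪ D₃), d ≠ f₂ → τ₁ d < τ₁ f₂ ∨ τ₂ d < τ₂ f₂)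
    (hU : U.card ≤ u) (hC : C.card ≤ u)
    (hx₀ : x₀ + 2 * u + 1 ≤ D₂.card) (hL : n < (L + 1) * ℓ)
    (hμ : u + 1 + 2 * L + 3 * s₂ < μ) (hn : 4 * (u + 3) + 2 * ℓ + l + 3 * m + β ≤ n)
    (hlc : (Finset.univ.filter fun x => g c x = x).card ≤ l)
    (hY : ∀ Y X : Finset (Fin n), Y.card = y₀ → X.card = x₀ →
      ∃ y ∈ Y, μ ≤ (D₃.filter fun d => g d y ∈ X).card)
    (hB1 : ∀ T : Fin n → Finset (Fin n), (∀ i, (T i).card ≤ ρ) →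
      (D₂.filter fun f₂ => ∃ f₃ ∈ D₃, m ≤
        (Finset.univ.filter fun x => g f₂ x ∈ collisions τ₁ c T f₂ f₃ g x).card).card ≤ s₂)
    (hB2 : ∀ T : Fin n → Finset (Fin n), (∀ i, (T i).card ≤ ρ) →
      (D₂.filter fun f₂ => ∃ f₃ ∈ D₃, m ≤
        (Finset.univ.filter fun x => g f₂ x ∈ collisions τ₂ c T f₂ f₃ g x).card).card ≤ s₂)
    (hB3 : (D₃.filter fun f₃ => ∃ f₂ ∈ D₂, m ≤
      (Finset.univ.filter fun x => g f₂ (g f₃ x) = g c (g f₂ x)).card).card ≤ s₂)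
    (hF : (D₁.filter fun f => ∃ y,
      β ≤ (Finset.univ.filter fun i => ρ < (endTargets c D₂ D₃ v U C g y i).card).card ∧
      (Finset.univ.filter fun i => g f i ∈ endTargets c D₂ D₃ v U C g y i).card ≤ κ).card ≤ s₁) :
    D₁.card * κ ≤ (avoidingGadgets φ v c U C).card + (2 * u + 1 + y₀ + s₁) * κ := by
  have hWc : (insert v U).card ≤ u + 1 := (Finset.card_insert_le _ _).trans (by omega)
  obtain ⟨X, hXsub, hX⟩ : ∃ X ⊆ (D₂ \ C).image (fun d => g d v) \ insert v U, X.card = x₀ := by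
    refine Finset.exists_subset_card_eq ?_
    have h1 := Finset.le_card_sdiff (insert v U) ((D₂ \ C).image (fun d => g d v))
    rw [Finset.card_image_of_injective _ fun d d' h => hg v d d' h] at h1
    have h2 := Finset.le_card_sdiff C D₂
    omega
  let Poor : Finset (Fin n) := Finset.univ.filter fun y => y ∉ insert v U ∧
    (D₃.filter fun d => g d y ∈ X).card < μ
  have hPoor : Poor.card < y₀ := by
    by_contra! h
    obtain ⟨Y, hYP, hYc⟩ := Finset.exists_subset_card_eq h
    obtain ⟨y, hy, hy2⟩ := hY Y X hYc hX
    have := (Finset.mem_filter.1 (hYP hy)).2.2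
    omega
  have hrich : ∀ y, y ∉ insert v U → y ∉ Poor →
      β ≤ (Finset.univ.filter fun i => ρ < (endTargets c D₂ D₃ v U C g y i).card).card := by
    intro y hyW hyP
    have hyμ : μ ≤ (D₃.filter fun d => g d y ∈ X).card := by
      by_contra! hlt
      exact hyP (Finset.mem_filter.2 ⟨Finset.mem_univ _, hyW, hlt⟩)
    have hex : ∀ d ∈ D₃.filter fun d => g d y ∈ X, ∃ f₂ ∈ D₂, f₂ ∉ C ∧ g f₂ v = g d y := by
      intro d hd
      have h1 := hXsub (Finset.mem_filter.1 hd).2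
      simp only [Finset.mem_sdiff, Finset.mem_image] at h1
      obtain ⟨⟨f, hf, e⟩, -⟩ := h1
      exact ⟨f, hf.1, hf.2, e⟩
    choose! e he1 he2 he3 using hex
    have hinj : Set.InjOn e (D₃.filter fun d => g d y ∈ X : Finset (Fin n)) := by
      intro d hd d' hd' h
      refine hg y d d' ?_
      rw [← he3 d hd, ← he3 d' hd', h]
    have hpre : ∀ B : Finset (Fin n),
        ((D₃.filter fun d => g d y ∈ X).filter fun d => e d ∈ B).card ≤ B.card := fun B =>
      Finset.card_le_card_of_injOn e (fun d hd => (Finset.mem_filter.1 hd).2)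
        (hinj.mono (Finset.coe_subset.2 (Finset.filter_subset _ _)))
    let T : Fin n → Finset (Fin n) := fun i =>
      if (endTargets c D₂ D₃ v U C g y i).card ≤ ρ then endTargets c D₂ D₃ v U C g y i else ∅
    have hT : ∀ i, (T i).card ≤ ρ := by
      intro i
      by_cases h : (endTargets c D₂ D₃ v U C g y i).card ≤ ρ <;> simp [T, h]
    have hloops := hg.card_filter_loops_mul_le ℓ
    have hL' : (Finset.univ.filter fun d =>
        ℓ ≤ (Finset.univ.filter fun x => g d x = x).card).card ≤ L := by
      by_contra! h
      have := Nat.mul_le_mul_right ℓ h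
      simp only [Nat.succ_eq_add_one] at this
      omega
    have hy1 : (Finset.univ.filter fun d => g d y = y).card ≤ 1 :=
      Finset.card_le_one.2 fun d hd d' hd' => hg y d d' <| by
        rw [(Finset.mem_filter.1 hd).2, (Finset.mem_filter.1 hd').2]
    obtain ⟨f₃, hf₃, hgood⟩ : ∃ d ∈ D₃.filter fun d => g d y ∈ X, ¬ ∃ A ∈ [C,
        Finset.univ.filter fun d => g d y = y,
        Finset.univ.filter fun d => ℓ ≤ (Finset.univ.filter fun x => g d x = x).card,
        (D₃.filter fun d => g d y ∈ X).filter fun d => e d ∈ Finset.univ.filter fun d =>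
          ℓ ≤ (Finset.univ.filter fun x => g d x = x).card,
        (D₃.filter fun d => g d y ∈ X).filter fun d => e d ∈ D₂.filter fun f₂ => ∃ f₃ ∈ D₃, m ≤
          (Finset.univ.filter fun x => g f₂ x ∈ collisions τ₁ c T f₂ f₃ g x).card,
        (D₃.filter fun d => g d y ∈ X).filter fun d => e d ∈ D₂.filter fun f₂ => ∃ f₃ ∈ D₃, m ≤
          (Finset.univ.filter fun x => g f₂ x ∈ collisions τ₂ c T f₂ f₃ g x).card,
        D₃.filter fun f₃ => ∃ f₂ ∈ D₂, m ≤
          (Finset.univ.filter fun x => g f₂ (g f₃ x) = g c (g f₂ x)).card], d ∈ A := by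
      by_contra! hcon
      have h1 := card_le_sum_of_cover _ _ hcon
      have k1 := hpre (Finset.univ.filter fun d =>
          ℓ ≤ (Finset.univ.filter fun x => g d x = x).card)
      have k2 := hpre (D₂.filter fun f₂ => ∃ f₃ ∈ D₃, m ≤
          (Finset.univ.filter fun x => g f₂ x ∈ collisions τ₁ c T f₂ f₃ g x).card)
      have k3 := hpre (D₂.filter fun f₂ => ∃ f₃ ∈ D₃, m ≤
          (Finset.univ.filter fun x => g f₂ x ∈ collisions τ₂ c T f₂ f₃ g x).card)
      have k4 := hB1 T hT
      have k5 := hB2 T hT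
      simp only [List.map_cons, List.map_nil, List.sum_cons, List.sum_nil] at h1
      omega
    have hs := hf₃
    simp only [Finset.mem_filter] at hf₃
    have hf₃D := hf₃.1
    have hz := (Finset.mem_sdiff.1 (hXsub hf₃.2)).2
    simp only [List.mem_cons, List.not_mem_nil, or_false, exists_eq_or_imp, exists_eq_left,
      Finset.mem_filter, Finset.mem_univ, true_and, hs, not_or, he1 f₃ hs, hf₃D, not_le,
      not_exists, not_and] at hgood
    obtain ⟨g1, g2, g3, g4, g5, g6, g7⟩ := hgood
    have he := he3 f₃ hs
    rw [Finset.mem_insert, not_or] at hz hyW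
    have := le_card_rich (ρ := ρ) hg (hτ _ (he1 f₃ hs)) (he1 f₃ hs) hf₃D (he2 f₃ hs) g1
      (fun h => Finset.disjoint_left.1 h23 (he1 f₃ hs) (by rwa [h])) he.symm hyW.2
      (he ▸ hz.2) hyW.1 (he ▸ hz.1) (he ▸ g2) g4 g3 hlc (T := T) (fun i hi => if_pos hi)
      (g5 f₃ hf₃D) (g6 f₃ hf₃D) (g7 _ (he1 f₃ hs))
    omega
  let hits : Fin n → Finset (Fin n) := fun f => Finset.univ.filter fun i =>
    g f i ∈ endTargets c D₂ D₃ v U C g ((g f).symm v) i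
  let F : Finset (Fin n) := D₁.filter fun f => f ∉ C ∧ κ ≤ (hits f).card
  have hpre : ∀ B : Finset (Fin n), (Finset.univ.filter fun d => (g d).symm v ∈ B).card ≤ B.card :=
    fun B => Finset.card_le_card_of_injOn _ (fun d hd => (Finset.mem_filter.1 hd).2)
        (hg.injOn_symm_apply v).injOn
  have hFc : D₁.card ≤ F.card + (2 * u + 1 + y₀ + s₁) := by
    have h1 := card_le_sum_of_cover [F, C, Finset.univ.filter fun d => (g d).symm v ∈ insert v U,
      Finset.univ.filter fun d => (g d).symm v ∈ Poor, D₁.filter fun f => ∃ y,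
      β ≤ (Finset.univ.filter fun i => ρ < (endTargets c D₂ D₃ v U C g y i).card).card ∧
      (Finset.univ.filter fun i => g f i ∈ endTargets c D₂ D₃ v U C g y i).card ≤ κ] D₁ ?_
    · have k1 := hpre (insert v U)
      have k2 := hpre Poor
      simp only [List.map_cons, List.map_nil, List.sum_cons, List.sum_nil] at h1
      omega
    · intro f hf
      by_contra! hcon
      simp only [List.mem_cons, List.not_mem_nil, or_false, forall_eq_or_imp, forall_eq] at hcon
      obtain ⟨q1, q2, q3, q4, q5⟩ := hcon
      simp only [Finset.mem_filter, Finset.mem_univ, true_and] at q3 q4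
      refine q1 (Finset.mem_filter.2 ⟨hf, q2, ?_⟩)
      by_contra! hlt
      exact q5 (Finset.mem_filter.2 ⟨hf, _, hrich _ q3 q4, hlt.le⟩)
  have hcount : F.card * κ ≤ (avoidingGadgets φ v c U C).card := by
    have h1 : F.card * κ ≤ (F.sigma hits).card := by
      rw [Finset.card_sigma, ← smul_eq_mul, ← Finset.sum_const]
      exact Finset.sum_le_sum fun f hf => (Finset.mem_filter.1 hf).2.2
    have h2 : ∀ p ∈ F.sigma hits, ∃ x ∈ avoidingGadgets φ v c U C,
        x 0 = (g p.1).symm v ∧ x 3 = p.2 := by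
      intro p hp
      obtain ⟨hp1, hp2⟩ := Finset.mem_sigma.1 hp
      obtain ⟨q1, q2, -⟩ := Finset.mem_filter.1 hp1
      exact exists_gadget_of_mem_endTargets hφ h23 hc2 hc3 (fun h => hc1 (h ▸ q1))
        (Finset.disjoint_left.1 h12 q1) (Finset.disjoint_left.1 h13 q1) q2
        (Equiv.apply_symm_apply _ _) (Finset.mem_filter.1 hp2).2
    have : Nonempty (Fin n) := ⟨c⟩
    choose! G hG1 hG2 hG3 using h2
    refine h1.trans (Finset.card_le_card_of_injOn G hG1 ?_)
    rintro ⟨f, i⟩ hp ⟨f', i'⟩ hp' h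
    have r1 := (hG2 _ hp).symm.trans ((congrFun h 0).trans (hG2 _ hp'))
    have r2 := (hG3 _ hp).symm.trans ((congrFun h 3).trans (hG3 _ hp'))
    have r3 := hg.injOn_symm_apply v r1
    simp only at r2 r3
    rw [r2, r3]
  have := Nat.mul_le_mul_right κ hFc
  rw [add_mul] at this
  omega

/-- Disjoint blocks `D₃`, `D₂`, `D₁` of colours, together with three orders in which the
rows can be exposed. -/
structure ColourBlocks {n : ℕ} (c : Fin n) (M m₁ : ℕ) where
  (D₁ D₂ D₃ : Finset (Fin n))
  (τ₁ τ₂ τ₃ : Fin n ≃ Fin n)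
  card₁ : D₁.card = m₁
  card₂ : D₂.card = M
  card₃ : D₃.card = M
  disj₁₂ : Disjoint D₁ D₂
  disj₁₃ : Disjoint D₁ D₃
  disj₂₃ : Disjoint D₂ D₃
  notMem₁ : c ∉ D₁
  notMem₂ : c ∉ D₂
  notMem₃ : c ∉ D₃
  cover : ∀ f ∈ D₂, ∀ d ∈ insert c (D₂ ∪ D₃), d ≠ f → τ₁ d < τ₁ f ∨ τ₂ d < τ₂ f
  before_iff : ∀ d, (τ₁ d : ℕ) < 2 * M + 1 ↔ d ∈ insert c (D₂ ∪ D₃)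
  le₁ : ∀ d ∈ D₁, (τ₁ d : ℕ) ≤ 2 * M + m₁
  le₁₂ : ∀ d ∈ D₂, (τ₁ d : ℕ) ≤ 2 * M
  le₂₂ : ∀ d ∈ D₂, (τ₂ d : ℕ) ≤ 2 * M
  le₁₃ : ∀ d ∈ D₃, (τ₁ d : ℕ) ≤ 2 * M
  le₃₃ : ∀ d ∈ D₃, (τ₃ d : ℕ) ≤ 2 * M
  initial₁₃ : ∀ d ∈ D₃, ∀ d', τ₁ d' < τ₁ d → d' = c ∨ d' ∈ D₃
  lt₁₂ : ∀ f ∈ D₂, ∀ d ∈ insert c D₃, τ₁ d < τ₁ f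
  lt₂₂ : ∀ f ∈ D₂, ∀ d ∈ insert c D₃, τ₂ d < τ₂ f
  lt₃₃ : ∀ f ∈ D₃, ∀ d ∈ insert c D₂, τ₃ d < τ₃ f

lemma card_filter_perm_Ico {n : ℕ} (π : Equiv.Perm (Fin n)) {a b : ℕ} (hb : b ≤ n) :
    (Finset.univ.filter fun d => a ≤ (π d : ℕ) ∧ (π d : ℕ) < b).card = b - a := by
  rw [card_filter_perm_apply π fun d => a ≤ (d : ℕ) ∧ (d : ℕ) < b, ← Nat.card_Ico]
  refine Finset.card_bij (fun d _ => (d : ℕ)) (fun d hd => ?_) (fun _ _ _ _ h => Fin.ext h)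
    (fun t ht => ?_)
  · exact Finset.mem_Ico.2 (Finset.mem_filter.1 hd).2
  · have := Finset.mem_Ico.1 ht
    exact ⟨⟨t, by omega⟩, Finset.mem_filter.2 ⟨Finset.mem_univ _, this⟩, rfl⟩

/-- The permutation of `Fin n` given by an involution of `ℕ` that preserves `{0, …, n - 1}`. -/
def finInvolution (n : ℕ) (r : ℕ → ℕ) (hr : ∀ t < n, r t < n) (hrr : ∀ t, r (r t) = t) :
    Fin n ≃ Fin n where
  toFun t := ⟨r t, hr t t.2⟩
  invFun t := ⟨r t, hr t t.2⟩
  left_inv t := Fin.ext (hrr t)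
  right_inv t := Fin.ext (hrr t)

lemma exists_colourBlocks {n : ℕ} (c : Fin n) (M m₁ : ℕ) (h : 2 * M + m₁ < n) :
    Nonempty (ColourBlocks c M m₁) := by
  have hn : 0 < n := c.pos
  let π : Equiv.Perm (Fin n) := Equiv.swap c ⟨0, hn⟩
  have hπc : ∀ d, (π d : ℕ) = 0 ↔ d = c := by
    intro d
    rw [← Equiv.apply_eq_iff_eq π (x := d) (y := c), Equiv.swap_apply_left, Fin.ext_iff]
  let r₂ : ℕ → ℕ := fun t => if M + 1 ≤ t ∧ t ≤ 2 * M then 3 * M + 1 - t else t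
  let r₃ : ℕ → ℕ := fun t => if 1 ≤ t ∧ t ≤ M then t + M else
    if M + 1 ≤ t ∧ t ≤ 2 * M then t - M else t
  let σ₂ := finInvolution n r₂ (by intro t ht; simp only [r₂]; split_ifs <;> omega)
    (by intro t; simp only [r₂]; split_ifs <;> omega)
  let σ₃ := finInvolution n r₃ (by intro t ht; simp only [r₃]; split_ifs <;> omega)
    (by intro t; simp only [r₃]; split_ifs <;> omega)
  have h2 : ∀ d, ((π.trans σ₂ d : Fin n) : ℕ) =
      if M + 1 ≤ (π d : ℕ) ∧ (π d : ℕ) ≤ 2 * M then 3 * M + 1 - (π d : ℕ) else π d := fun _ => rfl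
  have h3 : ∀ d, ((π.trans σ₃ d : Fin n) : ℕ) =
      if 1 ≤ (π d : ℕ) ∧ (π d : ℕ) ≤ M then (π d : ℕ) + M else
      if M + 1 ≤ (π d : ℕ) ∧ (π d : ℕ) ≤ 2 * M then (π d : ℕ) - M else π d := fun _ => rfl
  have hinj : ∀ d d', d ≠ d' → (π d : ℕ) ≠ π d' := fun d d' hd he =>
    hd (π.injective (Fin.ext he))
  have hc0 : (π c : ℕ) = 0 := (hπc c).2 rfl
  refine ⟨{
    D₁ := Finset.univ.filter fun d => 2 * M + 1 ≤ (π d : ℕ) ∧ (π d : ℕ) < 2 * M + 1 + m₁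
    D₂ := Finset.univ.filter fun d => M + 1 ≤ (π d : ℕ) ∧ (π d : ℕ) < 2 * M + 1
    D₃ := Finset.univ.filter fun d => 1 ≤ (π d : ℕ) ∧ (π d : ℕ) < M + 1
    τ₁ := π
    τ₂ := π.trans σ₂
    τ₃ := π.trans σ₃
    card₁ := by rw [card_filter_perm_Ico π (by omega)]; omega
    card₂ := by rw [card_filter_perm_Ico π (by omega)]; omega
    card₃ := by rw [card_filter_perm_Ico π (by omega)]; omega
    disj₁₂ := ?_
    disj₁₃ := ?_
    disj₂₃ := ?_
    notMem₁ := ?_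
    notMem₂ := ?_
    notMem₃ := ?_
    cover := ?_
    before_iff := ?_
    le₁ := ?_
    le₁₂ := ?_
    le₂₂ := ?_
    le₁₃ := ?_
    le₃₃ := ?_
    initial₁₃ := ?_
    lt₁₂ := ?_
    lt₂₂ := ?_
    lt₃₃ := ?_ }⟩
  all_goals
    try simp only [Finset.disjoint_left]
    simp only [Finset.mem_insert, Finset.mem_union, Finset.mem_filter, Finset.mem_univ, true_and,
      Fin.lt_def, h2, h3, ← hπc]
  · intro d; omega
  · intro d; omega
  · intro d; omega
  · omega
  · omega
  · omega
  · intro f hf d hd hdf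
    have := hinj d f hdf
    split_ifs <;> omega
  · intro d; omega
  · intro d; omega
  · intro d; omega
  · intro d; split_ifs <;> omega
  · intro d; omega
  · intro d; split_ifs <;> omega
  · intro d hd d'; omega
  · intro f hf d hd; omega
  · intro f hf d hd; split_ifs <;> omega
  · intro f hf d hd; split_ifs <;> omega

/-- A bijection of `Fin n` obtained from an injective map. -/
def permOfInjective {n : ℕ} (f : Fin n → Fin n) (hf : Function.Injective f) :
    Equiv.Perm (Fin n) :=
  Equiv.ofBijective f (Finite.injective_iff_bijective.1 hf)

lemma permOfInjective_apply {n : ℕ} (f : Fin n → Fin n) (hf : Function.Injective f) (i : Fin n) :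
    permOfInjective f hf i = f i := rfl

lemma permOfInjective_symm_eq_iff {n : ℕ} (f : Fin n → Fin n) (hf : Function.Injective f)
    (i j : Fin n) : (permOfInjective f hf).symm j = i ↔ f i = j := by
  rw [Equiv.symm_apply_eq, permOfInjective_apply, eq_comm]

/-- The colour classes of a proper colouring, seen as permutations. -/
def colourClass {n : ℕ} (G : Colouring n) (d : Fin n) : Equiv.Perm (Fin n) :=
  permOfInjective (fun i => (permOfInjective (G.1 i) fun j j' h => G.2.1 i j j' h).symm d)
    fun i i' h => by
      have h' := (permOfInjective_symm_eq_iff _ _ _ _).1 h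
      exact G.2.2 i i' _ (h'.trans ((permOfInjective_symm_eq_iff _ _ _ _).1 rfl).symm)

lemma colourClass_apply_eq_iff {n : ℕ} (G : Colouring n) (i j d : Fin n) :
    colourClass G d i = j ↔ G.1 i j = d :=
  permOfInjective_symm_eq_iff (G.1 i) (fun _ _ h => G.2.1 i _ _ h) j d

/-- The colouring with given colour classes. -/
def ofClasses {n : ℕ} (g : Fin n → Equiv.Perm (Fin n)) (hg : IsRows g) (i j : Fin n) : Fin n :=
  (permOfInjective (fun d => g d i) fun d d' h => hg i d d' h).symm j

lemma ofClasses_eq_iff {n : ℕ} {g : Fin n → Equiv.Perm (Fin n)} (hg : IsRows g) (i j d : Fin n) :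
    ofClasses g hg i j = d ↔ g d i = j :=
  permOfInjective_symm_eq_iff _ _ _ _

/-- A proper colouring corresponds to the family of its colour classes. -/
def rowsEquiv (n : ℕ) : Colouring n ≃ {g : Fin n → Equiv.Perm (Fin n) // IsRows g} where
  toFun G := ⟨colourClass G, fun i d d' h => by
    rw [colourClass_apply_eq_iff] at h
    rw [← h]
    exact (colourClass_apply_eq_iff G i _ d').1 rfl⟩
  invFun g := ⟨ofClasses g.1 g.2, fun i j j' h => by
      rw [ofClasses_eq_iff] at h
      rw [← h, (ofClasses_eq_iff g.2 i j' _).1 rfl], fun i i' j h => by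
      rw [ofClasses_eq_iff] at h
      exact (g.1 _).injective (h.trans ((ofClasses_eq_iff g.2 i' j _).1 rfl).symm)⟩
  left_inv G := Subtype.ext (funext fun i => funext fun j =>
    (ofClasses_eq_iff _ i j _).2 ((colourClass_apply_eq_iff G i j _).2 rfl))
  right_inv g := Subtype.ext (funext fun d => Equiv.ext fun i =>
    (colourClass_apply_eq_iff _ i _ d).2 ((ofClasses_eq_iff g.2 i _ d).2 rfl))

lemma loopCount_eq {n : ℕ} (G : Colouring n) (c : Fin n) :
    loopCount G.1 c = (Finset.univ.filter fun i => colourClass G c i = i).card := by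
  rw [loopCount, Nat.card_eq_fintype_card, Fintype.card_subtype]
  exact congrArg _ (Finset.filter_congr fun i _ => (colourClass_apply_eq_iff G i i c).symm)

lemma card_filter_exists_le {ι α : Type} [Fintype α] (S : Finset ι) (p : α → Prop)
    (q : ι → α → Prop) {_ : DecidablePred fun a => p a ∧ ∃ i ∈ S, q i a}
    [∀ i, DecidablePred fun a => p a ∧ q i a] (B N : ℝ) (hB : 0 ≤ B) (hN : (S.card : ℝ) ≤ N)
    (h : ∀ i ∈ S, ((Finset.univ.filter fun a => p a ∧ q i a).card : ℝ) ≤ B) :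
    ((Finset.univ.filter fun a => p a ∧ ∃ i ∈ S, q i a).card : ℝ) ≤ N * B := by
  have hsub : (Finset.univ.filter fun a => p a ∧ ∃ i ∈ S, q i a) ⊆
      S.biUnion fun i => Finset.univ.filter fun a => p a ∧ q i a := by
    intro a ha
    obtain ⟨-, hp, i, hi, hq⟩ := Finset.mem_filter.1 ha
    exact Finset.mem_biUnion.2 ⟨i, hi, Finset.mem_filter.2 ⟨Finset.mem_univ _, hp, hq⟩⟩
  calc _ ≤ ((S.biUnion fun i => Finset.univ.filter fun a => p a ∧ q i a).card : ℝ) := by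
        exact_mod_cast Finset.card_le_card hsub
    _ ≤ ∑ i ∈ S, ((Finset.univ.filter fun a => p a ∧ q i a).card : ℝ) := by
        exact_mod_cast Finset.card_biUnion_le
    _ ≤ ∑ i ∈ S, B := Finset.sum_le_sum h
    _ = S.card * B := by simp
    _ ≤ N * B := mul_le_mul_of_nonneg_right hN hB

section BadRows

variable {n : ℕ} {c : Fin n} {M m₁ : ℕ}

lemma ColourBlocks.card_few_arcs_le (b : ColourBlocks c M m₁) (y₀ x₀ μ h s : ℕ)
    (hM : 4 * M ≤ n) (hx₀ : 4 * x₀ ≤ n) (hs : y₀ * μ ≤ (M - s) * (h + 1)) (hsM : s ≤ M)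
    (hy₀ : 0 < y₀) (x : ℝ) (hx : 0 < x) (hx1 : x ≤ 1) :
    ((Finset.univ.filter fun g : Fin n → Equiv.Perm (Fin n) => IsRows g ∧
      ∃ P ∈ (Finset.univ : Finset (Finset (Fin n) × Finset (Fin n))), P.1.card = y₀ ∧
        P.2.card = x₀ ∧ ∀ y ∈ P.1, (b.D₃.filter fun d => g d y ∈ P.2).card < μ).card : ℝ) ≤
      4 ^ n * (2 ^ n * (rowBase n * (Real.exp (x * y₀) * (x⁻¹) ^ h *
        Real.exp (-((y₀ - h) * (x₀ - μ - 1 : ℕ) / n) + 4 * (1 + Real.log n))) ^ s)) := by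
  have hR := rowBase_pos n
  refine card_filter_exists_le _ _ _ _ _ (by positivity) ?_ ?_
  · simp only [Finset.card_univ, Fintype.card_prod, Fintype.card_finset, Fintype.card_fin,
      Nat.cast_mul, Nat.cast_pow, Nat.cast_ofNat]
    rw [← mul_pow]
    norm_num
  · rintro ⟨Y, X⟩ -
    by_cases hc : Y.card = y₀ ∧ X.card = x₀
    · obtain ⟨rfl, rfl⟩ := hc
      refine le_trans (Nat.cast_le.2 (Finset.card_le_card fun g hg => ?_))
        (RandomLatin.card_few_arcs_le b.τ₁ c b.D₃ Y X μ h s X.card c.pos (fun d hd => ?_)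
          b.initial₁₃ rfl hx₀ (by rwa [b.card₃]) (by rwa [b.card₃]) hy₀ x hx hx1)
      · simp only [Finset.mem_filter, Finset.mem_univ, true_and] at hg ⊢
        exact hg
      · have := b.le₁₃ d hd
        omega
    · rw [Finset.filter_false_of_mem fun g _ hg => hc ⟨hg.2.1, hg.2.2.1⟩]
      simp only [Finset.card_empty, Nat.cast_zero]
      positivity

lemma card_collisions_le (τ : Fin n ≃ Fin n) {T : Fin n → Finset (Fin n)} {ρ : ℕ}
    (hT : ∀ i, (T i).card ≤ ρ) (f₂ f₃ : Fin n) (g : Fin n → Equiv.Perm (Fin n)) (x : Fin n) :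
    (collisions τ c T f₂ f₃ g x).card ≤ ρ + 2 + τ f₂ := by
  refine Finset.card_image_le.trans ((Finset.card_union_le _ _).trans (Nat.add_le_add
    ((Finset.card_union_le _ _).trans (Nat.add_le_add (hT _) Finset.card_le_two))
    (Finset.card_image_le.trans ?_)))
  rw [card_filter_perm_apply τ fun t => t < τ f₂]
  refine le_of_eq ?_
  rw [← Fin.card_Iio]
  congr 1
  ext t
  simp

lemma card_many_collisions_le (τ : Fin n ≃ Fin n) (D₂ D₃ : Finset (Fin n)) (ρ m a s : ℕ)
    (hτ : ∀ f ∈ D₂, ∀ d ∈ insert c D₃, τ d < τ f) (hM : ∀ f ∈ D₂, (τ f : ℕ) ≤ 2 * M)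
    (hn : 4 * M ≤ n) (hf : 6 * 2 ^ a * (ρ + 2 + 2 * M) ≤ n) (x : ℝ) (hx : 0 < x) (hx1 : x ≤ 1) :
    ((Finset.univ.filter fun g : Fin n → Equiv.Perm (Fin n) => IsRows g ∧
      ∃ T ∈ (Fintype.piFinset fun _ : Fin n => (Finset.univ : Finset (Fin n)).powerset.filter
          fun H => H.card ≤ ρ),
        s ≤ (D₂.filter fun f₂ => ∃ f₃ ∈ D₃, m ≤ (Finset.univ.filter fun x =>
          g f₂ x ∈ collisions τ c T f₂ f₃ g x).card).card).card : ℝ) ≤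
      (Real.exp (x * n) * (x⁻¹) ^ ρ) ^ n *
        (2 ^ n * (rowBase n * (n * (2 ^ n * (1 / 2) ^ (a * m))) ^ s)) := by
  have hR := rowBase_pos n
  refine card_filter_exists_le _ _ _ _ _ (by positivity) ?_ ?_
  · rw [Fintype.card_piFinset, Finset.prod_const, Nat.cast_pow, Finset.card_univ,
      Fintype.card_fin]
    refine pow_le_pow_left₀ (by positivity) ?_ _
    simpa using card_powerset_filter_card_le (Finset.univ : Finset (Fin n)) ρ x hx hx1
  · intro T hT
    have hT' : ∀ i, (T i).card ≤ ρ := fun i =>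
      (Finset.mem_filter.1 (Fintype.mem_piFinset.1 hT i)).2
    refine card_many_hits_le τ D₂ D₃ (fun d p g => collisions τ c T d p g) _ m a s c.pos
      (fun d hd => ?_) (fun d hd p hp g g' hgg => ?_) (fun d hd p hp g i => ?_) hf
    · have := hM d hd
      omega
    · funext x
      ext j
      simp only [mem_collisions, hgg c (hτ d hd c (Finset.mem_insert_self _ _)),
        hgg p (hτ d hd p (Finset.mem_insert_of_mem hp))]
      refine or_congr Iff.rfl (or_congr Iff.rfl (or_congr Iff.rfl ?_))
      refine exists_congr fun d' => and_congr_right fun hd' => ?_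
      rw [hgg d' hd']
    · exact (card_collisions_le τ hT' d p g i).trans (Nat.add_le_add_left (hM d hd) _)

lemma ColourBlocks.card_many_coincidences_le (b : ColourBlocks c M m₁) (m a s : ℕ)
    (hM : 4 * M ≤ n) (hf : 6 * 2 ^ a * 1 ≤ n) :
    ((Finset.univ.filter fun g : Fin n → Equiv.Perm (Fin n) => IsRows g ∧
      s ≤ (b.D₃.filter fun f₃ => ∃ f₂ ∈ b.D₂, m ≤ (Finset.univ.filter fun x =>
          g f₂ (g f₃ x) = g c (g f₂ x)).card).card).card : ℝ) ≤
      2 ^ n * (rowBase n * (n * (2 ^ n * (1 / 2) ^ (a * m))) ^ s) := by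
  refine le_trans (Nat.cast_le.2 (Finset.card_le_card fun g hg => ?_))
    (card_many_hits_le b.τ₃ b.D₃ b.D₂ (fun _ p g x => {(g p).symm (g c (g p x))}) 1 m a s c.pos
      (fun d hd => ?_) (fun d hd p hp g g' hgg => ?_) (fun d hd p hp g i => ?_) hf)
  · simp only [Finset.mem_filter, Finset.mem_univ, true_and, Finset.mem_singleton] at hg ⊢
    refine ⟨hg.1, hg.2.trans (le_of_eq ?_)⟩
    refine congrArg _ (Finset.filter_congr fun f₃ _ => ?_)
    simp only [Equiv.eq_symm_apply]
  · have := b.le₃₃ d hd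
    omega
  · funext x
    rw [hgg c (b.lt₃₃ d hd c (Finset.mem_insert_self _ _)),
      hgg p (b.lt₃₃ d hd p (Finset.mem_insert_of_mem hp))]
  · simp

lemma ColourBlocks.card_few_completions_le (b : ColourBlocks c M m₁) (ρ β κ s : ℕ)
    (hM : 4 * M + 2 * m₁ ≤ n) (hρ : 4 * ρ ≤ n) (x : ℝ) (hx : 0 < x) (hx1 : x ≤ 1) :
    ((Finset.univ.filter fun g : Fin n → Equiv.Perm (Fin n) => IsRows g ∧
      ∃ P ∈ (Finset.univ : Finset (Fin n × Finset (Fin n) × Finset (Fin n))),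
        s ≤ (b.D₁.filter fun f => ∃ y,
      β ≤ (Finset.univ.filter fun i =>
        ρ < (endTargets c b.D₂ b.D₃ P.1 P.2.1 P.2.2 g y i).card).card ∧
      (Finset.univ.filter fun i =>
        g f i ∈ endTargets c b.D₂ b.D₃ P.1 P.2.1 P.2.2 g y i).card ≤ κ).card).card : ℝ) ≤
      n * 4 ^ n * (2 ^ n * (rowBase n * (n * (Real.exp (x * n) * (x⁻¹) ^ κ *
        Real.exp (-((β - κ) * (ρ - m₁ : ℕ) / n) + 4 * (1 + Real.log n)))) ^ s)) := by
  have hR := rowBase_pos n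
  refine card_filter_exists_le _ _ _ _ _ (by positivity) ?_ ?_
  · simp only [Finset.card_univ, Fintype.card_prod, Fintype.card_finset, Fintype.card_fin,
      Nat.cast_mul, Nat.cast_pow, Nat.cast_ofNat]
    rw [← mul_pow]
    norm_num
  · rintro ⟨v, U, C⟩ -
    refine card_few_hits_rows_le b.τ₁ b.D₁ (2 * M + 1)
      (fun g => endTargets c b.D₂ b.D₃ v U C g) ρ m₁ β κ s c.pos (fun d hd => ?_)
      (fun d hd => ?_) (fun d hd => ?_) (fun g g' hgg => ?_) (fun g y i d hd => ?_) hρ x hx hx1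
    · have := b.le₁ d hd
      omega
    · have h1 := (b.before_iff d).not
      by_contra! hlt
      refine h1.2 ?_ hlt
      simp only [Finset.mem_insert, Finset.mem_union, not_or]
      exact ⟨fun h => b.notMem₁ (h ▸ hd), Finset.disjoint_left.1 b.disj₁₂ hd,
        Finset.disjoint_left.1 b.disj₁₃ hd⟩
    · have := b.le₁ d hd
      omega
    · have hgc : ∀ d ∈ insert c (b.D₂ ∪ b.D₃), g' d = g d := fun d hd =>
        hgg d ((b.before_iff d).2 hd)
      funext y i
      ext j
      simp only [endTargets, Finset.mem_filter, Finset.mem_univ, true_and]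
      refine and_congr ?_ (forall_congr' fun d => forall_congr' fun hd => by rw [hgc d hd])
      refine exists_congr fun f₂ => and_congr_right fun h2 => exists_congr fun f₃ =>
        and_congr_right fun h3 => ?_
      rw [hgc c (by simp), hgc f₂ (by simp [h2]), hgc f₃ (by simp [h3])]
    · simp only [endTargets, Finset.mem_filter, not_and]
      intro _ _ h
      exact h d ((b.before_iff d).1 hd) rfl

end BadRows

lemma two_pow_le_exp (k : ℕ) : (2 : ℝ) ^ k ≤ Real.exp (0.69315 * k) := by
  have h : (2 : ℝ) ≤ Real.exp 0.69315 := by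
    rw [← Real.log_le_iff_le_exp (by norm_num)]
    linarith [Real.log_two_lt_d9]
  calc (2 : ℝ) ^ k ≤ Real.exp 0.69315 ^ k := pow_le_pow_left₀ (by norm_num) h k
    _ = Real.exp (0.69315 * k) := by rw [← Real.exp_nat_mul, mul_comm]

lemma four_pow_le_exp (k : ℕ) : (4 : ℝ) ^ k ≤ Real.exp (2 * k) := by
  rw [show (4 : ℝ) = 2 ^ 2 by norm_num, ← pow_mul]
  refine (two_pow_le_exp _).trans (Real.exp_le_exp.2 ?_)
  push_cast
  linarith

lemma inv_pow_le_exp (a k : ℕ) : (((1 / 2 : ℝ) ^ a)⁻¹) ^ k ≤ Real.exp (0.69315 * (a * k)) := by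
  have h := two_pow_le_exp (a * k)
  rwa [one_div, inv_pow (2 : ℝ), inv_inv, ← pow_mul, ← Nat.cast_mul]

lemma half_pow_le_exp (k : ℕ) : (1 / 2 : ℝ) ^ k ≤ Real.exp (-(0.69314 * k)) := by
  have h : (1 / 2 : ℝ) ≤ Real.exp (-0.69314) := by
    rw [← Real.log_le_iff_le_exp (by norm_num), one_div, Real.log_inv]
    linarith [Real.log_two_gt_d9]
  calc (1 / 2 : ℝ) ^ k ≤ Real.exp (-0.69314) ^ k := pow_le_pow_left₀ (by norm_num) h k
    _ = Real.exp (-(0.69314 * k)) := by rw [← Real.exp_nat_mul]; ring_nf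

/-- `w` is the unit of length for the parameters of the construction, and `n` is large. -/
structure Scale (n w : ℕ) : Prop where
  le : 2 ^ 60 * w ≤ n
  lt : n < 2 ^ 60 * (w + 1)
  log_sq_le : (1 + Real.log n) ^ 2 ≤ n / 2 ^ 200

namespace Scale

variable {n w : ℕ} (H : Scale n w)
include H

lemma two_pow_le : (2 : ℝ) ^ 200 ≤ n := by
  have h := H.log_sq_le
  have h0 : 0 ≤ Real.log n := Real.log_natCast_nonneg n
  rw [le_div_iff₀ (by positivity)] at h
  nlinarith [sq_nonneg (Real.log n)]

lemma one_add_log_le : 1 + Real.log n ≤ n / 2 ^ 200 := by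
  have h := H.log_sq_le
  nlinarith [Real.log_natCast_nonneg n]

lemma cast_le : (2 : ℝ) ^ 60 * w ≤ n := by exact_mod_cast H.le

lemma le_cast : (2 : ℝ) ^ 130 ≤ w := by
  have h : (n : ℝ) < 2 ^ 60 * (w + 1) := by exact_mod_cast H.lt
  have := H.two_pow_le
  linarith

lemma le_nat : 2 ^ 130 ≤ w := by exact_mod_cast H.le_cast

lemma cast_lt : (n : ℝ) ≤ 2 ^ 60 * (1 + 1 / 2 ^ 100) * w := by
  have h : (n : ℝ) < 2 ^ 60 * (w + 1) := by exact_mod_cast H.lt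
  have := H.le_cast
  linarith

lemma cast_le_exp : (n : ℝ) ≤ Real.exp (n / 2 ^ 200) := by
  have h0 : (0 : ℝ) < n := lt_of_lt_of_le (by positivity) H.two_pow_le
  rw [← Real.log_le_iff_le_exp h0]
  linarith [H.one_add_log_le]

lemma mul_le_sq {a : ℝ} (ha : 0 ≤ a) : a * n ≤ a / 2 ^ 60 * (w : ℝ) ^ 2 := by
  have h1 := H.cast_lt
  have h2 := H.le_cast
  have h3 : (n : ℝ) ≤ w ^ 2 / 2 ^ 60 := by
    rw [le_div_iff₀ (by positivity)]
    nlinarith [mul_le_mul_of_nonneg_right h2 (Nat.cast_nonneg (α := ℝ) w)]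
  calc a * n ≤ a * (w ^ 2 / 2 ^ 60) := mul_le_mul_of_nonneg_left h3 ha
    _ = _ := by ring

lemma sq_le : (n : ℝ) ^ 2 ≤ 2 ^ 121 * (w : ℝ) ^ 2 := by
  have h1 := H.cast_lt
  calc (n : ℝ) ^ 2 ≤ (2 ^ 60 * (1 + 1 / 2 ^ 100) * w) ^ 2 := pow_le_pow_left₀ (by positivity) h1 2
    _ = (2 ^ 60 * (1 + 1 / 2 ^ 100)) ^ 2 * w ^ 2 := by ring
    _ ≤ 2 ^ 121 * (w : ℝ) ^ 2 := mul_le_mul_of_nonneg_right (by norm_num) (by positivity)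

/-- A product of probabilities that decays like `exp (-q w²)` with `q > 2 ^ 31`. -/
lemma row_bound {R B : ℝ} (hR : 0 ≤ R) {A q : ℝ} {s : ℕ} (hA0 : 0 ≤ A) (hA : A ≤ Real.exp q)
    (hB : B ≤ Real.exp (-(2 ^ 32 * (w : ℝ) ^ 2) - s * q)) :
    B * (2 ^ n * (R * A ^ s)) ≤ Real.exp (-(n ^ 2 / 2 ^ 90)) * R := by
  have h1 : (2 : ℝ) ^ n ≤ Real.exp (w ^ 2) := by
    refine (two_pow_le_exp n).trans (Real.exp_le_exp.2 ((H.mul_le_sq (by norm_num)).trans ?_))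
    nlinarith [sq_nonneg (w : ℝ)]
  have h2 : A ^ s ≤ Real.exp (s * q) := by
    rw [Real.exp_nat_mul]
    exact pow_le_pow_left₀ hA0 hA s
  have h3 := H.sq_le
  calc B * (2 ^ n * (R * A ^ s))
      ≤ Real.exp (-(2 ^ 32 * (w : ℝ) ^ 2) - s * q) *
        (Real.exp (w ^ 2) * (R * Real.exp (s * q))) := by gcongr
    _ = Real.exp (-(2 ^ 32 * (w : ℝ) ^ 2) - s * q + w ^ 2 + s * q) * R := by
        rw [Real.exp_add, Real.exp_add]; ring
    _ ≤ _ := by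
        refine mul_le_mul_of_nonneg_right (Real.exp_le_exp.2 ?_) hR
        have : (n : ℝ) ^ 2 / 2 ^ 90 ≤ 2 ^ 31 * w ^ 2 := by
          rw [div_le_iff₀ (by positivity)]
          linarith
        nlinarith [sq_nonneg (w : ℝ)]

lemma few_arcs_bound {R : ℝ} (hR : 0 ≤ R) :
    4 ^ n * (2 ^ n * (R * (Real.exp ((1 / 2) ^ 16 * (2 ^ 19 * w : ℕ)) *
      (((1 / 2) ^ 16)⁻¹) ^ (8 * w) * Real.exp (-(((2 ^ 19 * w : ℕ) - (8 * w : ℕ)) *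
        (15 * 2 ^ 44 * w - 2 ^ 31 * w - 1 : ℕ) / n) + 4 * (1 + Real.log n))) ^ (2 ^ 47 * w))) ≤
      Real.exp (-((n : ℝ) ^ 2 / 2 ^ 90)) * R := by
  have h1 := H.cast_lt
  have h2 := H.le_cast
  have h3 := H.one_add_log_le
  have hn0 : (0 : ℝ) < n := lt_of_lt_of_le (by positivity) H.two_pow_le
  refine H.row_bound hR (q := -(20 * w)) (by positivity) ?_ ?_
  · have hw := H.le_nat
    have hc : (15 * 2 ^ 44 * w - 2 ^ 31 * w - 1 : ℕ) + 2 ^ 31 * w + 1 = 15 * 2 ^ 44 * w := by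
      omega
    have hc' : (((15 * 2 ^ 44 * w - 2 ^ 31 * w - 1 : ℕ) : ℝ)) + 2 ^ 31 * w + 1 =
        15 * 2 ^ 44 * w := by exact_mod_cast hc
    have hq : 119 * (w : ℝ) ≤ ((2 ^ 19 * w : ℕ) - (8 * w : ℕ)) *
        (15 * 2 ^ 44 * w - 2 ^ 31 * w - 1 : ℕ) / n := by
      rw [le_div_iff₀ hn0]
      have h5 : (15 * 2 ^ 44 - 2 ^ 32) * (w : ℝ) ≤ (15 * 2 ^ 44 * w - 2 ^ 31 * w - 1 : ℕ) := by
        linarith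
      have h6 : (0 : ℝ) ≤ 2 ^ 19 * w - 8 * w := by
        linarith
      calc 119 * (w : ℝ) * n ≤ 119 * w * (2 ^ 60 * (1 + 1 / 2 ^ 100) * w) := by gcongr
        _ ≤ (2 ^ 19 * w - 8 * w) * ((15 * 2 ^ 44 - 2 ^ 32) * (w : ℝ)) := by
          nlinarith [sq_nonneg (w : ℝ)]
        _ ≤ _ := by
          have := mul_le_mul_of_nonneg_left h5 h6
          simpa only [Nat.cast_mul, Nat.cast_pow, Nat.cast_ofNat] using this
    calc _ ≤ Real.exp ((1 / 2) ^ 16 * (2 ^ 19 * w : ℕ)) *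
          Real.exp (0.69315 * ((16 : ℕ) * (8 * w : ℕ))) *
          Real.exp (-(119 * w) + 4 * (n / 2 ^ 200)) := by
          gcongr
          exact inv_pow_le_exp 16 (8 * w)
      _ ≤ _ := by
        rw [← Real.exp_add, ← Real.exp_add, Real.exp_le_exp]
        push_cast
        linarith
  · refine (four_pow_le_exp n).trans (Real.exp_le_exp.2 ((H.mul_le_sq (by norm_num)).trans ?_))
    push_cast
    nlinarith [sq_nonneg (w : ℝ)]

lemma row_factor_le {m : ℕ} (hm : m = 9 * 2 ^ 55 * w) :
    (n : ℝ) * (2 ^ n * (1 / 2) ^ (8 * m)) ≤ Real.exp (-(0.8 * 2 ^ 60 * w)) := by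
  have h1 := H.cast_lt
  have h2 := H.le_cast
  calc (n : ℝ) * (2 ^ n * (1 / 2) ^ (8 * m))
      ≤ Real.exp (n / 2 ^ 200) * (Real.exp (0.69315 * n) *
          Real.exp (-(0.69314 * (8 * m : ℕ)))) := by
        gcongr
        · exact H.cast_le_exp
        · exact two_pow_le_exp n
        · exact half_pow_le_exp _
    _ ≤ _ := by
        rw [← Real.exp_add, ← Real.exp_add, Real.exp_le_exp, hm]
        push_cast
        linarith

lemma many_coincidences_bound {R : ℝ} (hR : 0 ≤ R) :
    2 ^ n * (R * (n * (2 ^ n * (1 / 2) ^ (8 * (9 * 2 ^ 55 * w)))) ^ (2 ^ 29 * w)) ≤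
      Real.exp (-((n : ℝ) ^ 2 / 2 ^ 90)) * R := by
  have h := H.row_bound (B := 1) hR (by positivity) (H.row_factor_le rfl) (s := 2 ^ 29 * w) (by
    refine Real.one_le_exp ?_
    push_cast
    nlinarith [sq_nonneg (w : ℝ)])
  rwa [one_mul] at h

lemma many_collisions_bound {R : ℝ} (hR : 0 ≤ R) :
    (Real.exp ((1 / 2) ^ 34 * n) * (((1 / 2) ^ 34)⁻¹) ^ (2 ^ 22 * w)) ^ n *
      (2 ^ n * (R * (n * (2 ^ n * (1 / 2) ^ (8 * (9 * 2 ^ 55 * w)))) ^ (2 ^ 29 * w))) ≤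
      Real.exp (-((n : ℝ) ^ 2 / 2 ^ 90)) * R := by
  have h1 := H.cast_lt
  have h2 := H.le_cast
  refine H.row_bound hR (by positivity) (H.row_factor_le rfl) ?_
  calc _ ≤ Real.exp (2.6 * 2 ^ 26 * w) ^ n := by
        gcongr
        refine (mul_le_mul_of_nonneg_left (inv_pow_le_exp 34 _) (Real.exp_pos _).le).trans ?_
        rw [← Real.exp_add, Real.exp_le_exp]
        push_cast
        linarith
    _ ≤ _ := by
        rw [← Real.exp_nat_mul, Real.exp_le_exp]
        push_cast
        nlinarith [mul_le_mul_of_nonneg_right h1 (Nat.cast_nonneg (α := ℝ) w),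
          sq_nonneg (w : ℝ)]

lemma few_completions_bound {R : ℝ} (hR : 0 ≤ R) :
    n * 4 ^ n * (2 ^ n * (R * (n * (Real.exp ((1 / 2) ^ 46 * n) *
      (((1 / 2) ^ 46)⁻¹) ^ (2 ^ 9 * w) * Real.exp (-(((2 ^ 56 * w : ℕ) - (2 ^ 9 * w : ℕ)) *
        (2 ^ 22 * w - 2 ^ 21 * w : ℕ) / n) + 4 * (1 + Real.log n)))) ^ (2 ^ 19 * w))) ≤
      Real.exp (-((n : ℝ) ^ 2 / 2 ^ 90)) * R := by
  have h1 := H.cast_lt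
  have h2 := H.le_cast
  have h3 := H.one_add_log_le
  have hn0 : (0 : ℝ) < n := lt_of_lt_of_le (by positivity) H.two_pow_le
  refine H.row_bound hR (q := -(2 ^ 16 * w)) (by positivity) ?_ ?_
  · have hc : 2 ^ 22 * w - 2 ^ 21 * w = 2 ^ 21 * w := by omega
    have hq : 0.9 * 2 ^ 17 * (w : ℝ) ≤ ((2 ^ 56 * w : ℕ) - (2 ^ 9 * w : ℕ)) *
        (2 ^ 22 * w - 2 ^ 21 * w : ℕ) / n := by
      rw [le_div_iff₀ hn0, hc]
      calc 0.9 * 2 ^ 17 * (w : ℝ) * n ≤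
            0.9 * 2 ^ 17 * w * (2 ^ 60 * (1 + 1 / 2 ^ 100) * w) := by gcongr
        _ ≤ _ := by
          push_cast
          nlinarith [sq_nonneg (w : ℝ)]
    calc _ ≤ Real.exp (n / 2 ^ 200) * (Real.exp ((1 / 2) ^ 46 * n) *
          Real.exp (0.69315 * ((46 : ℕ) * (2 ^ 9 * w : ℕ))) *
          Real.exp (-(0.9 * 2 ^ 17 * w) + 4 * (n / 2 ^ 200))) := by
          gcongr
          · exact H.cast_le_exp
          · exact inv_pow_le_exp 46 (2 ^ 9 * w)
      _ ≤ _ := by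
        rw [← Real.exp_add, ← Real.exp_add, ← Real.exp_add, Real.exp_le_exp]
        push_cast
        linarith
  · calc (n : ℝ) * 4 ^ n ≤ Real.exp (n / 2 ^ 200) * Real.exp (2 * n) := by
          gcongr
          · exact H.cast_le_exp
          · exact four_pow_le_exp n
      _ ≤ Real.exp (3 * n) := by
          rw [← Real.exp_add, Real.exp_le_exp]
          linarith
      _ ≤ _ := by
          refine Real.exp_le_exp.2 ((H.mul_le_sq (by norm_num)).trans ?_)
          push_cast
          nlinarith [sq_nonneg (w : ℝ)]

end Scale

lemma mem_filter_univ_of {α : Type} [Fintype α] {p : α → Prop} {_ : DecidablePred p} {a : α}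
    (h : p a) : a ∈ Finset.univ.filter p :=
  Finset.mem_filter.2 ⟨Finset.mem_univ a, h⟩

lemma exists_badRows {n w : ℕ} (H : Scale n w) (c : Fin n) :
    ∃ F : Finset (Fin n → Equiv.Perm (Fin n)),
      (F.card : ℝ) ≤ 5 * (Real.exp (-((n : ℝ) ^ 2 / 2 ^ 90)) * rowBase n) ∧
      ∀ G : Colouring n, colourClass G ∉ F → (loopCount G.1 c : ℝ) ≤ n / 10 ^ 9 →
        ∀ v : Fin n, ∃ 𝒜 : Finset (Fin 6 → Fin n),
          (∀ x ∈ 𝒜, IsAbsGadget G.1 v c x) ∧ WellSpreadAbsGadgets G.1 v c 𝒜 ∧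
            (n : ℝ) ^ 2 / 2 ^ 100 ≤ 𝒜.card := by
  have hw := H.le_nat
  have hle := H.le
  have hlt := H.lt
  have hR := (rowBase_pos n).le
  obtain ⟨b⟩ := exists_colourBlocks c (2 ^ 48 * w) (2 ^ 21 * w) (by omega)
  set B := Real.exp (-((n : ℝ) ^ 2 / 2 ^ 90)) * rowBase n
  obtain ⟨F₁, hF₁, h₁⟩ : ∃ F : Finset (Fin n → Equiv.Perm (Fin n)), (F.card : ℝ) ≤ B ∧
      ∀ g, IsRows g → g ∉ F → ∀ Y X : Finset (Fin n), Y.card = 2 ^ 19 * w →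
        X.card = 15 * 2 ^ 44 * w → ∃ y ∈ Y, 2 ^ 31 * w ≤ (b.D₃.filter fun d => g d y ∈ X).card := by
    refine ⟨_, (b.card_few_arcs_le (2 ^ 19 * w) (15 * 2 ^ 44 * w) (2 ^ 31 * w) (8 * w) (2 ^ 47 * w)
      (by omega) (by omega) ?_ (by omega) (by omega) ((1 / 2) ^ 16) (by positivity)
      (by norm_num)).trans (H.few_arcs_bound hR), fun g hg hF Y X hY hX => ?_⟩
    · rw [show 2 ^ 48 * w - 2 ^ 47 * w = 2 ^ 47 * w by omega]
      nlinarith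
    · by_contra! hlt
      exact hF (Finset.mem_filter.2 ⟨Finset.mem_univ _, hg, (Y, X), Finset.mem_univ _, hY, hX, hlt⟩)
  have hcoll : ∀ τ : Fin n ≃ Fin n, (∀ f ∈ b.D₂, ∀ d ∈ insert c b.D₃, τ d < τ f) →
      (∀ f ∈ b.D₂, (τ f : ℕ) ≤ 2 * (2 ^ 48 * w)) →
      ∃ F : Finset (Fin n → Equiv.Perm (Fin n)), (F.card : ℝ) ≤ B ∧
      ∀ g, IsRows g → g ∉ F → ∀ T : Fin n → Finset (Fin n), (∀ i, (T i).card ≤ 2 ^ 22 * w) →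
        (b.D₂.filter fun f₂ => ∃ f₃ ∈ b.D₃, 9 * 2 ^ 55 * w ≤
          (Finset.univ.filter fun x => g f₂ x ∈ collisions τ c T f₂ f₃ g x).card).card ≤
            2 ^ 29 * w := by
    intro τ hτ hM
    refine ⟨_, (card_many_collisions_le τ b.D₂ b.D₃ (2 ^ 22 * w) (9 * 2 ^ 55 * w) 8 (2 ^ 29 * w)
      hτ hM (by omega) (by omega) ((1 / 2) ^ 34) (by positivity) (by norm_num)).trans
      (H.many_collisions_bound hR), fun g hg hF T hT => ?_⟩
    by_contra! hlt
    exact hF (mem_filter_univ_of ⟨hg, T, Fintype.mem_piFinset.2 fun i =>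
      Finset.mem_filter.2 ⟨Finset.mem_powerset.2 (Finset.subset_univ _), hT i⟩, hlt.le⟩)
  obtain ⟨F₂, hF₂, h₂⟩ := hcoll b.τ₁ b.lt₁₂ b.le₁₂
  obtain ⟨F₃, hF₃, h₃⟩ := hcoll b.τ₂ b.lt₂₂ b.le₂₂
  obtain ⟨F₄, hF₄, h₄⟩ : ∃ F : Finset (Fin n → Equiv.Perm (Fin n)), (F.card : ℝ) ≤ B ∧
      ∀ g, IsRows g → g ∉ F → (b.D₃.filter fun f₃ => ∃ f₂ ∈ b.D₂, 9 * 2 ^ 55 * w ≤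
        (Finset.univ.filter fun x => g f₂ (g f₃ x) = g c (g f₂ x)).card).card ≤ 2 ^ 29 * w := by
    refine ⟨_, (b.card_many_coincidences_le (9 * 2 ^ 55 * w) 8 (2 ^ 29 * w) (by omega)
      (by omega)).trans (H.many_coincidences_bound hR), fun g hg hF => ?_⟩
    by_contra! hlt
    exact hF (Finset.mem_filter.2 ⟨Finset.mem_univ _, hg, hlt.le⟩)
  obtain ⟨F₅, hF₅, h₅⟩ : ∃ F : Finset (Fin n → Equiv.Perm (Fin n)), (F.card : ℝ) ≤ B ∧
      ∀ g, IsRows g → g ∉ F → ∀ (v : Fin n) (U C : Finset (Fin n)), (b.D₁.filter fun f => ∃ y,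
        2 ^ 56 * w ≤ (Finset.univ.filter fun i =>
          2 ^ 22 * w < (endTargets c b.D₂ b.D₃ v U C g y i).card).card ∧
        (Finset.univ.filter fun i => g f i ∈ endTargets c b.D₂ b.D₃ v U C g y i).card ≤
          2 ^ 9 * w).card ≤ 2 ^ 19 * w := by
    refine ⟨_, (b.card_few_completions_le (2 ^ 22 * w) (2 ^ 56 * w) (2 ^ 9 * w) (2 ^ 19 * w)
      (by omega) (by omega) ((1 / 2) ^ 46) (by positivity) (by norm_num)).trans
      (H.few_completions_bound hR), fun g hg hF v U C => ?_⟩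
    by_contra! hlt
    exact hF (Finset.mem_filter.2 ⟨Finset.mem_univ _, hg, (v, U, C), Finset.mem_univ _, hlt.le⟩)
  refine ⟨F₁ ∪ F₂ ∪ F₃ ∪ F₄ ∪ F₅, ?_, fun G hG hloop v => exists_wellSpread _ _ _
    fun U C hvU hcC hU hC => ?_⟩
  · have e₁ := Finset.card_union_le F₁ F₂
    have e₂ := Finset.card_union_le (F₁ ∪ F₂) F₃
    have e₃ := Finset.card_union_le (F₁ ∪ F₂ ∪ F₃) F₄
    have e₄ := Finset.card_union_le (F₁ ∪ F₂ ∪ F₃ ∪ F₄) F₅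
    have : ((F₁ ∪ F₂ ∪ F₃ ∪ F₄ ∪ F₅).card : ℝ) ≤
        F₁.card + F₂.card + F₃.card + F₄.card + F₅.card := by
      exact_mod_cast (by omega : (F₁ ∪ F₂ ∪ F₃ ∪ F₄ ∪ F₅).card ≤
        F₁.card + F₂.card + F₃.card + F₄.card + F₅.card)
    linarith
  · simp only [Finset.mem_union, not_or] at hG
    obtain ⟨⟨⟨⟨hG₁, hG₂⟩, hG₃⟩, hG₄⟩, hG₅⟩ := hG
    have hg : IsRows (colourClass G) := (rowsEquiv n G).2
    rw [loopCount_eq] at hloop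
    have hloop' : (Finset.univ.filter fun x => colourClass G c x = x).card ≤ 2 ^ 55 * w := by
      have : (Finset.univ.filter fun x => colourClass G c x = x).card * 10 ^ 9 ≤ n := by
        rw [le_div_iff₀ (by positivity)] at hloop
        exact_mod_cast hloop
      omega
    have key := le_card_avoidingGadgets (φ := G.1) (v := v) (U := U) (C := C)
      (ℓ := 2 ^ 54 * w) (L := 64) (u := w) hg
      (fun i j d => (colourClass_apply_eq_iff G i j d).symm) b.disj₁₂ b.disj₁₃ b.disj₂₃ b.notMem₁
      b.notMem₂ b.notMem₃ b.cover (by omega) (by omega) (by rw [b.card₂]; omega) (by omega)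
      (by omega) (by omega) hloop' (h₁ _ hg hG₁) (h₂ _ hg hG₂) (h₃ _ hg hG₃) (h₄ _ hg hG₄)
      (h₅ _ hg hG₅ v U C)
    rw [b.card₁] at key
    have h28 : 2 ^ 28 * w ^ 2 ≤ (avoidingGadgets G.1 v c U C).card := by
      nlinarith
    rw [div_le_iff₀ (by positivity)]
    have h28' : 2 ^ 28 * (w : ℝ) ^ 2 ≤ (avoidingGadgets G.1 v c U C).card := by
      exact_mod_cast h28
    linarith [H.sq_le, sq_nonneg (w : ℝ)]

lemma scale_of_large {n : ℕ} (h : (1 + Real.log n) ^ 2 ≤ n / 2 ^ 200) : Scale n (n / 2 ^ 60) where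
  le := Nat.mul_div_le n _
  lt := Nat.lt_mul_div_succ n (by positivity)
  log_sq_le := h

lemma eventually_log_sq_le :
    ∃ n₀ : ℕ, ∀ n : ℕ, n₀ ≤ n → (1 + Real.log n) ^ 2 ≤ n / 2 ^ 200 := by
  have h1 : (fun x : ℝ => (1 + Real.log x) ^ 2) =o[Filter.atTop] fun x : ℝ => x := by
    have h2 : (fun x : ℝ => 1 + Real.log x) =o[Filter.atTop] fun x : ℝ => x ^ (1 / 2 : ℝ) := by
      refine Asymptotics.IsLittleO.add ?_ (isLittleO_log_rpow_atTop (by norm_num))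
      refine (Asymptotics.isLittleO_const_left_of_ne one_ne_zero).2 ?_
      exact tendsto_norm_atTop_atTop.comp (tendsto_rpow_atTop (by norm_num))
    refine (h2.pow two_pos).congr' Filter.EventuallyEq.rfl ?_
    filter_upwards [Filter.eventually_ge_atTop 0] with x hx
    rw [← Real.sqrt_eq_rpow, Real.sq_sqrt hx]
  have h3 := (h1.def (c := 1 / 2 ^ 200) (by positivity)).natCast_atTop
  obtain ⟨n₀, h⟩ := Filter.eventually_atTop.1 h3
  refine ⟨n₀, fun n hn => ?_⟩
  have := h n hn
  rw [Real.norm_of_nonneg (by positivity), Real.norm_of_nonneg (by positivity)] at this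
  linarith

lemma exp_mul_card_ge {n w : ℕ} (H : Scale n w) (c : Fin n) :
    5 * (Real.exp (-((n : ℝ) ^ 2 / 2 ^ 90)) * rowBase n) ≤
      Real.exp (-(1 / 2 ^ 91 * (n : ℝ) ^ 2)) *
        (Finset.univ.filter fun G : Colouring n => (loopCount G.1 c : ℝ) ≤ n / 10 ^ 9).card := by
  have hn := H.two_pow_le
  have hn2 : 2 ≤ n := by
    have : (2 : ℝ) ≤ n := by linarith
    exact_mod_cast this
  have hcard : (Finset.univ.filter fun g : Fin n → Equiv.Perm (Fin n) =>
      IsRows g ∧ ∀ i, g c i ≠ i).card ≤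
        (Finset.univ.filter fun G : Colouring n => (loopCount G.1 c : ℝ) ≤ n / 10 ^ 9).card := by
    refine Finset.card_le_card_of_surjOn colourClass fun g hg => ?_
    have hg := (Finset.mem_filter.1 hg).2
    have hG : colourClass ((rowsEquiv n).symm ⟨g, hg.1⟩) = g :=
      congrArg Subtype.val ((rowsEquiv n).apply_symm_apply ⟨g, hg.1⟩)
    refine ⟨(rowsEquiv n).symm ⟨g, hg.1⟩, ?_, hG⟩
    simp only [Finset.coe_filter, Finset.mem_univ, true_and, Set.mem_ofPred_eq, loopCount_eq, hG]
    rw [Finset.filter_false_of_mem fun i _ => hg.2 i]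
    simp only [Finset.card_empty, Nat.cast_zero]
    positivity
  have h5 : (5 : ℝ) ≤ Real.exp (n ^ 2 / 2 ^ 200) := by
    refine le_trans ?_ (Real.add_one_le_exp _)
    have : (5 : ℝ) ≤ n ^ 2 / 2 ^ 200 := by
      rw [le_div_iff₀ (by positivity)]
      nlinarith
    linarith
  have hR := (rowBase_pos n).le
  have hN : (n : ℝ) ≤ n ^ 2 / 2 ^ 200 := by
    rw [le_div_iff₀ (by positivity)]
    nlinarith
  have hlog : (n : ℝ) * (1 + Real.log n) ^ 2 ≤ n ^ 2 / 2 ^ 200 := by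
    have := mul_le_mul_of_nonneg_left H.log_sq_le (Nat.cast_nonneg n)
    calc _ ≤ _ := this
      _ = _ := by ring
  set N := (Finset.univ.filter fun G : Colouring n => (loopCount G.1 c : ℝ) ≤ n / 10 ^ 9).card
  have hb : rowBase n ≤ Real.exp (n + n * (1 + Real.log n) ^ 2) * N :=
    (rowBase_le hn2 c).trans (mul_le_mul_of_nonneg_left (Nat.cast_le.2 hcard) (Real.exp_pos _).le)
  calc 5 * (Real.exp (-((n : ℝ) ^ 2 / 2 ^ 90)) * rowBase n)
      ≤ Real.exp (n ^ 2 / 2 ^ 200) * (Real.exp (-((n : ℝ) ^ 2 / 2 ^ 90)) *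
        (Real.exp (n + n * (1 + Real.log n) ^ 2) * N)) := by gcongr
    _ = Real.exp (n ^ 2 / 2 ^ 200 + -((n : ℝ) ^ 2 / 2 ^ 90) + (n + n * (1 + Real.log n) ^ 2)) *
        N := by rw [Real.exp_add (_ + _) (_ + _), Real.exp_add (_ / _)]; ring
    _ ≤ _ := by
        refine mul_le_mul_of_nonneg_right (Real.exp_le_exp.2 ?_) (Nat.cast_nonneg _)
        linarith [sq_nonneg (n : ℝ)]

/-- For a fixed colour `c`, conditionally on having at most `n/10⁹`
loops of colour `c`, a uniformly random proper `n`-arc-colouring contains, for every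
vertex `v`, a well-spread collection of at least `n²/2¹⁰⁰` `(v,c)`-absorbing gadgets,
with probability at least `1 - exp(-a n²)`. -/
theorem statement_18 :
    ∃ a : ℝ, 0 < a ∧ ∃ n₀ : ℕ, ∀ n : ℕ, n₀ ≤ n → ∀ c : Fin n,
      (1 - Real.exp (-(a * (n : ℝ) ^ 2))) *
          (Nat.card {G : Colouring n // (loopCount G.1 c : ℝ) ≤ n / 10 ^ 9} : ℝ) ≤
        (Nat.card {G : Colouring n //
          (∀ v : Fin n, ∃ 𝒜 : Finset (Fin 6 → Fin n),
            (∀ x ∈ 𝒜, IsAbsGadget G.1 v c x) ∧ WellSpreadAbsGadgets G.1 v c 𝒜 ∧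
            (n : ℝ) ^ 2 / 2 ^ 100 ≤ 𝒜.card) ∧
          (loopCount G.1 c : ℝ) ≤ n / 10 ^ 9} : ℝ) := by
  obtain ⟨n₀, hn₀⟩ := eventually_log_sq_le
  refine ⟨1 / 2 ^ 91, by positivity, n₀, fun n hn c => ?_⟩
  have H := scale_of_large (hn₀ n hn)
  obtain ⟨F, hF, hgood⟩ := exists_badRows H c
  have hB := hF.trans (exp_mul_card_ge H c)
  rw [Nat.card_eq_fintype_card, Nat.card_eq_fintype_card, Fintype.card_subtype,
    Fintype.card_subtype]
  set S := Finset.univ.filter fun G : Colouring n => (loopCount G.1 c : ℝ) ≤ n / 10 ^ 9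
  set T := Finset.univ.filter fun G : Colouring n => (∀ v : Fin n, ∃ 𝒜 : Finset (Fin 6 → Fin n),
    (∀ x ∈ 𝒜, IsAbsGadget G.1 v c x) ∧ WellSpreadAbsGadgets G.1 v c 𝒜 ∧
      (n : ℝ) ^ 2 / 2 ^ 100 ≤ 𝒜.card) ∧ (loopCount G.1 c : ℝ) ≤ n / 10 ^ 9
  have h1 : (S.filter fun G => colourClass G ∈ F).card ≤ F.card :=
    Finset.card_le_card_of_injOn colourClass (fun G hG => (Finset.mem_filter.1 hG).2)
      fun G _ G' _ h => (rowsEquiv n).injective (Subtype.ext h)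
  have h2 : (S.filter fun G => colourClass G ∉ F).card ≤ T.card :=
    Finset.card_le_card fun G hG => by
      obtain ⟨hS, hGF⟩ := Finset.mem_filter.1 hG
      have hS := (Finset.mem_filter.1 hS).2
      exact Finset.mem_filter.2 ⟨Finset.mem_univ _, hgood G hGF hS, hS⟩
  have h3 := Finset.card_filter_add_card_filter_not (s := S) fun G => colourClass G ∈ F
  have h4 : (S.card : ℝ) ≤ F.card + T.card := by exact_mod_cast (by omega)
  linarith

end RandomLatin
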